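/- arXiv:math/0703340 — 2 statements merged into one kernel-verified Lean document; each statement's English description precedes it below -/
import Mathlib

section
/- The off-line real zero of φ_K(a,·) is a nondecreasing function of a tending to 2: if max(a*_K,1) < a ≤ a′ and ρ ∈ (1, 2), ρ′ ∈ (1, 2) satisfy φ_K(a, ρ) = 0 and φ_K(a′, ρ′) = 0, then ρ ≤ ρ′; moreover, for every ε > 0 there exists A > max(a*_K,1) such that for all a > A, every zero ρ ∈ (1, 2) of φ_K(a,·) satisfies ρ > 2 - ε. -/
open Complex Filter NumberField

/-- The Dedekind zeta function of a number field `K`, given (for `Re(s) > 1`) as the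
sum of `N(I)^{-s}` over the nonzero ideals `I` of the ring of integers of `K`. -/
noncomputable def dedekindZetaSum (K : Type*) [Field K] [NumberField K] (s : ℂ) : ℂ :=
  ∑' I : {I : Ideal (𝓞 K) // I ≠ ⊥}, (Ideal.absNorm I.1 : ℂ) ^ (-s)

/-- `ΛK` is the completed Dedekind zeta function of `K`:
`Λ_K(s) = (√|d_K|/(2π))^s Γ(s) ζ_K(s)` for `Re(s) > 1`, holomorphic away from
(simple) poles at `s = 0` and `s = 1`, and satisfying `Λ_K(s) = Λ_K(1-s)`. -/
structure IsCompletedDedekindZeta (K : Type*) [Field K] [NumberField K]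
    (ΛK : ℂ → ℂ) : Prop where
  eq_on_gt_one : ∀ s : ℂ, 1 < s.re → ΛK s =
    ((Real.sqrt |(NumberField.discr K : ℝ)| / (2 * Real.pi) : ℝ) : ℂ) ^ s *
      Complex.Gamma s * dedekindZetaSum K s
  differentiableOn : DifferentiableOn ℂ ΛK {(0 : ℂ), 1}ᶜ
  functional_equation : ∀ s : ℂ, ΛK s = ΛK (1 - s)
  simple_pole_at_one : ∃ r : ℂ, r ≠ 0 ∧
    Tendsto (fun s : ℂ => (s - 1) * ΛK s) (nhdsWithin 1 {(1 : ℂ)}ᶜ) (nhds r)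

/-- The constant term `φ_K(a,s) = a^s Λ_K(s) + a^{2-s} Λ_K(s-1)` of the Eisenstein
series attached to `PSL(2, 𝓞_K)`. -/
noncomputable def phiK (ΛK : ℂ → ℂ) (a : ℝ) (s : ℂ) : ℂ :=
  (a : ℂ) ^ s * ΛK s + (a : ℂ) ^ (2 - s) * ΛK (s - 1)

theorem le_of_halfPlane_contraction {B : ℂ → ℂ} (hd : DifferentiableOn ℂ B {z | 0 < z.re})
    (hB : ∀ z : ℂ, 0 < z.re → ‖B z‖ ≤ 1) (hB1 : B 1 ≠ 0) {a a' t t' : ℝ} (ha : 1 < a)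
    (haa' : a ≤ a') (ht : t ∈ Set.Ioo (0 : ℝ) 1) (ht' : t' ∈ Set.Ioo (0 : ℝ) 1)
    (hBt : B t = (a ^ (2 * t) * ((1 - t) / (1 + t)) : ℝ))
    (hBt' : B t' = (a' ^ (2 * t') * ((1 - t') / (1 + t')) : ℝ)) : t ≤ t' := by
  by_contra! hlt
  obtain ⟨ht0, ht1⟩ := ht
  obtain ⟨ht'0, ht'1⟩ := ht'
  have hL : 0 < Real.log a := Real.log_pos ha
  set p : ℝ := (1 - t) / (1 + t) with hp
  set p' : ℝ := (1 - t') / (1 + t') with hp'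
  have hp0 : 0 < p := div_pos (by linarith) (by linarith)
  have hp1 : p < 1 := (div_lt_one (by linarith)).2 (by linarith)
  set f : ℂ → ℂ := fun z => B z * cexp (-(2 * Real.log a : ℝ) * z) with hf
  have hfd : DifferentiableOn ℂ f {z | 0 < z.re} := by
    refine hd.mul (Differentiable.differentiableOn ?_)
    fun_prop
  have hf1 : ∀ z : ℂ, 0 < z.re → ‖f z‖ < 1 := by
    intro z hz
    rw [hf]
    simp only [norm_mul, norm_exp, neg_mul, neg_re, re_ofReal_mul]
    have : Real.exp (-(2 * Real.log a * z.re)) < 1 := by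
      rw [Real.exp_lt_one_iff]
      have : 0 < Real.log a * z.re := mul_pos hL hz
      linarith
    nlinarith [hB z hz, norm_nonneg (B z), Real.exp_pos (-(2 * Real.log a * z.re))]
  have hfreal : ∀ (x b : ℝ) (y : ℝ), 0 < b → B x = ((b ^ (2 * x) * y : ℝ) : ℂ) →
      f x = ((b / a) ^ (2 * x) * y : ℝ) := by
    intro x b y hb h
    rw [hf]
    simp only [h]
    rw [← ofReal_neg, ← ofReal_mul, ← ofReal_exp, ← ofReal_mul]
    congr 1
    rw [Real.div_rpow hb.le (by linarith), Real.rpow_def_of_pos (by linarith : 0 < a),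
      div_eq_mul_inv, ← Real.exp_neg]
    ring_nf
  have hft : f t = (p : ℂ) := by
    rw [hfreal t a p (by linarith) hBt, div_self (by linarith), Real.one_rpow, one_mul]
  set q : ℝ := (a' / a) ^ (2 * t') * p' with hq
  have hft' : f t' = (q : ℂ) := hfreal t' a' p' (by linarith) hBt'
  have hp'0 : 0 < p' := div_pos (by linarith) (by linarith)
  have hqp' : p' ≤ q := by
    apply le_mul_of_one_le_left hp'0.le
    exact Real.one_le_rpow ((one_le_div (by linarith)).2 haa') (by linarith)
  have hq1 : q < 1 := by
    have := hf1 t' (by simpa using ht'0)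
    rw [hft', norm_real] at this
    exact (le_abs_self _).trans_lt this
  -- transport to the unit disc
  set x : ℂ → ℂ := fun w => t * (1 + w) / (1 - w) with hx
  have hden : ∀ w ∈ Metric.ball (0 : ℂ) 1, 1 - w ≠ 0 := by
    intro w hw h
    rw [mem_ball_zero_iff] at hw
    rw [sub_eq_zero] at h
    rw [← h] at hw; simp at hw
  have hxre : ∀ w ∈ Metric.ball (0 : ℂ) 1, 0 < (x w).re := by
    intro w hw
    have hns : 0 < normSq (1 - w) := normSq_pos.2 (hden w hw)
    rw [mem_ball_zero_iff] at hw
    have hw2 : w.re * w.re + w.im * w.im < 1 := by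
      rw [← normSq_apply, normSq_eq_norm_sq]; nlinarith [norm_nonneg w]
    have : (x w).re = t * (1 - (w.re * w.re + w.im * w.im)) / normSq (1 - w) := by
      simp only [hx, div_re, re_ofReal_mul, im_ofReal_mul, add_re, one_re, sub_re, add_im, one_im,
        sub_im]
      field_simp
      ring
    rw [this]
    apply div_pos _ hns
    apply mul_pos ht0
    linarith
  have hden2 : ∀ v : ℂ, ‖v‖ < 1 → 1 - p * v ≠ 0 := by
    intro v hv h
    have h1 : (p : ℂ) * v = 1 := (sub_eq_zero.1 h).symm
    have := congrArg norm h1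
    rw [norm_mul, norm_real, Real.norm_eq_abs, abs_of_pos hp0, norm_one] at this
    nlinarith [norm_nonneg v]
  set g : ℂ → ℂ := fun w => (f (x w) - p) / (1 - p * f (x w)) with hg
  have hx0 : x 0 = t := by simp [hx]
  have hg0 : g 0 = 0 := by simp [hg, hx0, hft]
  have hgd : DifferentiableOn ℂ g (Metric.ball 0 1) := by
    have hxd : DifferentiableOn ℂ x (Metric.ball 0 1) := by
      refine DifferentiableOn.div ?_ ?_ hden
      · fun_prop
      · fun_prop
    have hfx : DifferentiableOn ℂ (fun w => f (x w)) (Metric.ball 0 1) :=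
      hfd.comp hxd (fun w hw => hxre w hw)
    exact (hfx.sub_const _).div ((hfx.const_mul _).const_sub _)
      (fun w hw => hden2 _ (hf1 _ (hxre w hw)))
  have hmaps : Set.MapsTo g (Metric.ball 0 1) (Metric.closedBall (g 0) 1) := by
    intro w hw
    rw [hg0, mem_closedBall_zero_iff]
    have hv := hf1 _ (hxre w hw)
    rw [hg]; simp only
    rw [norm_div, div_le_one (norm_pos_iff.2 (hden2 _ hv))]
    set v := f (x w)
    apply (sq_le_sq₀ (norm_nonneg _) (norm_nonneg _)).1
    rw [← normSq_eq_norm_sq, ← normSq_eq_norm_sq, normSq_apply, normSq_apply]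
    have hv2 : v.re * v.re + v.im * v.im < 1 := by
      rw [← normSq_apply, normSq_eq_norm_sq]; nlinarith [norm_nonneg v]
    simp only [sub_re, sub_im, one_re, one_im, re_ofReal_mul, im_ofReal_mul, ofReal_re, ofReal_im]
    have : 0 ≤ (1 - p ^ 2) * (1 - (v.re * v.re + v.im * v.im)) :=
      mul_nonneg (by nlinarith) (by linarith)
    nlinarith
  -- the value at the second point
  set w : ℝ := (t' - t) / (t' + t) with hw
  have hwneg : w < 0 := div_neg_of_neg_of_pos (by linarith) (by linarith)
  have hwgt : -1 < w := by rw [hw, lt_div_iff₀ (by linarith)]; linarith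
  have hwball : (w : ℂ) ∈ Metric.ball (0 : ℂ) 1 := by
    rw [mem_ball_zero_iff, norm_real, Real.norm_eq_abs, abs_lt]
    exact ⟨hwgt, by linarith⟩
  have hxw : x w = t' := by
    simp only [hx]
    rw [← ofReal_one, ← ofReal_add, ← ofReal_sub, ← ofReal_mul, ← ofReal_div]
    congr 1
    have h1 : 1 - w ≠ 0 := by linarith
    have h2 : t' + t ≠ 0 := by linarith
    rw [div_eq_iff h1, hw]
    field_simp
    ring
  set y : ℝ := (q - p) / (1 - p * q) with hy
  have hgw : g w = (y : ℂ) := by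
    simp only [hg, hxw, hft', hy]
    push_cast; rfl
  have hpq : 0 < 1 - p * q := by nlinarith
  have hwy : -w ≤ y := by
    rw [hy, le_div_iff₀ hpq]
    have h1 : -w = (p' - p) / (1 - p * p') := by
      rw [hw, hp, hp']
      have : t' + t ≠ 0 := by linarith
      have : 1 + t ≠ 0 := by linarith
      have : 1 + t' ≠ 0 := by linarith
      have h4 : 1 - (1 - t) / (1 + t) * ((1 - t') / (1 + t')) ≠ 0 := by
        have : 1 - (1 - t) / (1 + t) * ((1 - t') / (1 + t')) =
          2 * (t + t') / ((1 + t) * (1 + t')) := by field_simp; ring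
        rw [this]
        have : 0 < 2 * (t + t') / ((1 + t) * (1 + t')) := by positivity
        exact this.ne'
      rw [eq_div_iff h4]
      field_simp
      ring
    have hpp' : 0 < 1 - p * p' := by nlinarith
    have h2 : -w * (1 - p * p') = p' - p := by rw [h1, div_mul_cancel₀ _ hpp'.ne']
    have : -w * p * (p' - q) ≥ -(q - p') := by
      have : -w * p ≤ 1 := by nlinarith
      nlinarith
    nlinarith
  have hds : dslope g 0 w = ((y / w : ℝ) : ℂ) := by
    rw [dslope_of_ne _ (by exact_mod_cast hwneg.ne), slope_def_field, hgw, hg0]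
    push_cast; ring
  have hyw1 : ‖dslope g 0 w‖ = 1 / 1 := by
    apply le_antisymm (norm_dslope_le_div_of_mapsTo_ball hgd hmaps hwball)
    rw [hds, norm_real, Real.norm_eq_abs, abs_div, abs_of_neg hwneg, div_one,
      le_div_iff₀ (by linarith), one_mul]
    exact hwy.trans (le_abs_self _)
  have hslope : dslope g 0 w = -1 := by
    have h1 : y / w < 0 := div_neg_of_pos_of_neg (by linarith) hwneg
    rw [hds, norm_real, Real.norm_eq_abs, abs_of_neg h1] at hyw1
    rw [hds, show y / w = -1 by linarith]
    simp
  have hpball : (p : ℂ) ∈ Metric.ball (0 : ℂ) 1 := by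
    rw [mem_ball_zero_iff, norm_real, Real.norm_eq_abs, abs_of_pos hp0]
    exact hp1
  have hfin := affine_of_mapsTo_ball_of_norm_dslope_eq_div hgd hmaps hwball hyw1 hpball
  have hxp : x p = 1 := by
    simp only [hx]
    rw [div_eq_one_iff_eq (hden _ hpball), ← ofReal_one, ← ofReal_add, ← ofReal_sub, ← ofReal_mul]
    congr 1
    have : 1 + t ≠ 0 := by linarith
    rw [hp]; field_simp; ring
  have hv := hden2 (f 1) (hf1 1 (by norm_num))
  have hgp : g p = (f 1 - p) / (1 - p * f 1) := by simp only [hg, hxp]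
  simp only [hg0, hslope, smul_eq_mul] at hfin
  rw [hgp, div_eq_iff hv] at hfin
  have hf10 : f 1 * (1 - (p : ℂ) ^ 2) = 0 := by linear_combination hfin
  rcases mul_eq_zero.1 hf10 with h | h
  · simp only [hf, mul_eq_zero, exp_ne_zero, or_false] at h
    exact hB1 h
  · have : (1 : ℝ) - p ^ 2 = 0 := by exact_mod_cast h
    nlinarith

theorem norm_le_one_of_halfDisc_growth {B : ℂ → ℂ} {C : ℝ}
    (hd : DiffContOnCl ℂ B {z | 0 < z.re}) (him : ∀ x : ℝ, ‖B (x * I)‖ ≤ 1)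
    (hstrip : ∀ z : ℂ, 0 < z.re → z.re ≤ 2 → 2 ≤ |z.im| → ‖B z‖ * z.re ≤ C * Real.exp (C * ‖z‖))
    (hright : ∀ z : ℂ, 3 / 2 ≤ z.re → ‖B z‖ ≤ C) {z : ℂ} (hz : 0 ≤ z.re) : ‖B z‖ ≤ 1 := by
  have hC : 0 ≤ C := (norm_nonneg _).trans (hright 2 (by norm_num))
  have hopen : IsOpen {z : ℂ | 0 < z.re} := isOpen_lt continuous_const continuous_re
  refine PhragmenLindelof.right_half_plane_of_bounded_on_real hd
    ⟨1, by norm_num, C, ?_⟩ ?_ him hz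
  · refine Asymptotics.IsBigO.of_bound (2 * C + 4 + 4 * C * Real.exp (2 * C)) ?_
    rw [eventually_inf_principal]
    filter_upwards [eventually_cobounded_le_norm (5 : ℝ)] with w hw hwre
    replace hwre : 0 < w.re := hwre
    have hexp1 : 1 ≤ Real.exp (C * ‖w‖) := Real.one_le_exp (by positivity)
    have hexp2 : 1 ≤ Real.exp (2 * C) := Real.one_le_exp (by positivity)
    have hpos : 0 < Real.exp (C * ‖w‖) := Real.exp_pos _
    simp only [Real.rpow_one, Real.norm_eq_abs, Real.abs_exp]
    rcases le_or_gt (3 / 2) w.re with h | h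
    · have : ‖B w‖ ≤ C := hright w h
      have h4 : C ≤ C * Real.exp (C * ‖w‖) := le_mul_of_one_le_right hC hexp1
      have : 0 ≤ (C + 4 + 4 * C * Real.exp (2 * C)) * Real.exp (C * ‖w‖) := by positivity
      nlinarith
    have him3 : 3 ≤ |w.im| := by
      have := norm_le_abs_re_add_abs_im w
      rw [abs_of_pos hwre] at this
      linarith
    rcases le_or_gt (1 / 2) w.re with h' | h'
    · have h3 := hstrip w hwre (by linarith) (by linarith)
      have h4 : ‖B w‖ * (1 / 2) ≤ ‖B w‖ * w.re := by gcongr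
      have : 0 ≤ (4 + 4 * C * Real.exp (2 * C)) * Real.exp (C * ‖w‖) := by positivity
      nlinarith
    -- the half disc of radius one around `w.im * I`
    set p : ℂ := w.im * I with hp
    set U : Set ℂ := Metric.ball p 1 ∩ {z | 0 < z.re} with hU
    set g : ℂ → ℂ := fun z => ((z - p) ^ 2 + 1) * B z with hg
    have hgd : DiffContOnCl ℂ g U := by
      have h1 : DiffContOnCl ℂ (fun z : ℂ => (z - p) ^ 2 + 1) U :=
        Differentiable.diffContOnCl (by fun_prop)
      exact h1.smul (hd.mono Set.inter_subset_right)
    have hbound : ∀ z ∈ frontier U, ‖g z‖ ≤ 2 + 2 * C * Real.exp (C * (‖w‖ + 2)) := by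
      intro z hzf
      have hzcl : z ∈ closure U := frontier_subset_closure hzf
      have hzU : z ∉ U := by
        have hUo : IsOpen U := Metric.isOpen_ball.inter hopen
        rw [hUo.frontier_eq] at hzf
        exact hzf.2
      have hz1 : ‖z - p‖ ≤ 1 := by
        have := closure_mono Set.inter_subset_left hzcl
        have := Metric.closure_ball_subset_closedBall this
        simpa [dist_eq_norm] using this
      have hz2 : 0 ≤ z.re := by
        have h := closure_mono (Set.inter_subset_right (s := Metric.ball p 1)) hzcl
        have h' : closure {z : ℂ | 0 < z.re} ⊆ {z : ℂ | 0 ≤ z.re} :=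
          closure_minimal (fun z (hz : 0 < z.re) => hz.le)
            (isClosed_le continuous_const continuous_re)
        exact h' h
      have hnonneg : 0 ≤ 2 * C * Real.exp (C * (‖w‖ + 2)) := by positivity
      rw [hg]
      simp only [norm_mul]
      rcases hz2.eq_or_lt with h0 | h0
      · have hzI : z = (z.im : ℝ) * I := by
          apply Complex.ext <;> simp [← h0]
        have hB : ‖B z‖ ≤ 1 := by rw [hzI]; exact him _
        have : ‖(z - p) ^ 2 + 1‖ ≤ 2 := by
          refine (norm_add_le _ _).trans ?_
          rw [norm_pow, norm_one]
          nlinarith [norm_nonneg (z - p)]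
        nlinarith [norm_nonneg (B z), norm_nonneg ((z - p) ^ 2 + 1)]
      · have hzs : ‖z - p‖ = 1 := by
          by_contra hne
          exact hzU ⟨by simpa [dist_eq_norm] using lt_of_le_of_ne hz1 hne, h0⟩
        have hpre : p.re = 0 := by simp [hp]
        have hpim : p.im = w.im := by simp [hp]
        have hsq : z.re ^ 2 + (z.im - w.im) ^ 2 = 1 := by
          have : ‖z - p‖ ^ 2 = 1 := by rw [hzs]; norm_num
          rw [← Complex.normSq_eq_norm_sq, Complex.normSq_apply] at this
          simp only [sub_re, sub_im, hpre, hpim] at this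
          nlinarith
        have hfac : ‖(z - p) ^ 2 + 1‖ = 2 * z.re := by
          have h1 : ‖(z - p) ^ 2 + 1‖ ^ 2 = (2 * z.re) ^ 2 := by
            rw [← Complex.normSq_eq_norm_sq, Complex.normSq_apply]
            simp only [sq, add_re, add_im, mul_re, mul_im, sub_re, sub_im, hpre, hpim, one_re,
              one_im]
            have : (z.im - w.im) ^ 2 = 1 - z.re ^ 2 := by linarith
            linear_combination ((z.im - w.im) ^ 2 + z.re ^ 2 - 1) * this
          exact (pow_left_inj₀ (norm_nonneg _) (by positivity) (by norm_num)).1 h1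
        have hre1 : z.re ≤ 1 := by nlinarith [sq_nonneg (z.im - w.im)]
        have hy1 : |z.im - w.im| ≤ 1 := by
          apply abs_le_of_sq_le_sq _ (by norm_num)
          nlinarith [sq_nonneg z.re]
        have him2 : 2 ≤ |z.im| := by
          have := abs_sub_abs_le_abs_sub w.im z.im
          rw [abs_sub_comm] at this
          linarith
        have hnz : ‖z‖ ≤ ‖w‖ + 2 := by
          calc ‖z‖ = ‖(z - p) + p‖ := by ring_nf
            _ ≤ 1 + |w.im| := by
              refine (norm_add_le _ _).trans ?_
              rw [hzs, hp]; simp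
            _ ≤ ‖w‖ + 2 := by linarith [abs_im_le_norm w]
        have h3 := hstrip z h0 (by linarith) him2
        have h4 : Real.exp (C * ‖z‖) ≤ Real.exp (C * (‖w‖ + 2)) := by gcongr
        rw [hfac]
        have : C * Real.exp (C * ‖z‖) ≤ C * Real.exp (C * (‖w‖ + 2)) := by gcongr
        nlinarith
    have hwp : w - p = w.re := by
      apply Complex.ext <;> simp [hp]
    have hwU : w ∈ U := by
      refine ⟨?_, hwre⟩
      rw [mem_ball_iff_norm, hwp, norm_real, Real.norm_eq_abs, abs_of_pos hwre]
      linarith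
    have hmax := norm_le_of_forall_mem_frontier_norm_le
      (Metric.isBounded_ball.subset Set.inter_subset_left) hgd hbound (subset_closure hwU)
    have hgw : ‖B w‖ ≤ ‖g w‖ := by
      rw [hg]; simp only [norm_mul, hwp]
      apply le_mul_of_one_le_left (norm_nonneg _)
      rw [← ofReal_pow, ← ofReal_one, ← ofReal_add, norm_real, Real.norm_eq_abs]
      exact le_trans (by nlinarith [sq_nonneg w.re]) (le_abs_self _)
    have hee : Real.exp (C * (‖w‖ + 2)) = Real.exp (2 * C) * Real.exp (C * ‖w‖) := by
      rw [← Real.exp_add]; ring_nf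
    rw [hee] at hmax
    have : 0 ≤ C * Real.exp (2 * C) * Real.exp (C * ‖w‖) := by positivity
    have : 0 ≤ C * Real.exp (C * ‖w‖) := by positivity
    nlinarith
  · refine isBoundedUnder_of_eventually_le (a := C) ?_
    filter_upwards [eventually_ge_atTop (3 / 2 : ℝ)] with x hx
    exact hright x (by simpa using hx)

theorem exists_diffContOnCl_eq_div {X Y : ℂ → ℂ} (hX : Differentiable ℂ X)
    (hY : Differentiable ℂ Y) (hY0 : ∀ z : ℂ, 0 < z.re → Y z ≠ 0)
    (him : ∀ x : ℝ, ‖X (x * I)‖ = ‖Y (x * I)‖) :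
    ∃ B : ℂ → ℂ, DiffContOnCl ℂ B {z | 0 < z.re} ∧ (∀ z : ℂ, 0 < z.re → B z = X z / Y z) ∧
      ∀ x : ℝ, ‖B (x * I)‖ ≤ 1 := by
  set Q : ℂ → ℂ := fun z => X z / Y z with hQ
  have hQmer : MeromorphicOn Q Set.univ := fun z _ =>
    (hX.analyticAt z).meromorphicAt.div (hY.analyticAt z).meromorphicAt
  have hopen : IsOpen {z : ℂ | 0 < z.re} := isOpen_lt continuous_const continuous_re
  set B := toMeromorphicNFOn Q Set.univ with hB
  have hnf : ∀ z, MeromorphicNFAt B z := fun z =>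
    meromorphicNFOn_toMeromorphicNFOn Q Set.univ (Set.mem_univ z)
  have hord : ∀ z, meromorphicOrderAt B z = meromorphicOrderAt Q z := fun z =>
    meromorphicOrderAt_toMeromorphicNFOn hQmer (Set.mem_univ z)
  have hQB : ∀ z, Q =ᶠ[nhdsWithin z {z}ᶜ] B := fun z =>
    (hQmer.toMeromorphicNFOn_eq_self_on_nhdsNE (Set.mem_univ z)).symm
  have haxis : ∀ x : ℝ, Tendsto (fun u : ℝ => (u : ℂ) * I)
      (nhdsWithin x {x}ᶜ) (nhdsWithin ((x : ℂ) * I) {(x : ℂ) * I}ᶜ) := by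
    intro x
    refine tendsto_nhdsWithin_of_tendsto_nhds_of_eventually_within _ ?_ ?_
    · exact (Continuous.tendsto (by fun_prop) x).mono_left nhdsWithin_le_nhds
    · filter_upwards [self_mem_nhdsWithin] with u hu h
      apply hu
      have := congrArg im h
      simpa using this
  have hQaxis : ∀ u : ℝ, ‖Q (u * I)‖ ≤ 1 := by
    intro u
    rw [hQ]; simp only [norm_div, him]
    exact div_self_le_one _
  have hanre : ∀ z : ℂ, 0 < z.re → AnalyticAt ℂ Q z := fun z hz =>
    (hX.analyticAt z).div (hY.analyticAt z) (hY0 z hz)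
  have han : ∀ z : ℂ, 0 ≤ z.re → AnalyticAt ℂ B z := by
    intro z hz
    rw [← (hnf z).meromorphicOrderAt_nonneg_iff_analyticAt, hord]
    rcases hz.eq_or_lt with h0 | h0
    · by_contra! hneg
      have hz' : z = (z.im : ℂ) * I := by apply Complex.ext <;> simp [← h0]
      have h1 := (tendsto_cobounded_iff_meromorphicOrderAt_neg (hQmer z (Set.mem_univ z))).2 hneg
      rw [hz'] at h1
      have h2 := tendsto_norm_cobounded_atTop.comp (h1.comp (haxis z.im))
      obtain ⟨u, hu⟩ := (h2.eventually_gt_atTop 1).exists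
      exact absurd (hQaxis u) (not_le.2 hu)
    · exact (hanre z h0).meromorphicOrderAt_nonneg
  refine ⟨B, ?_, ?_, ?_⟩
  · refine ⟨fun z (hz : 0 < z.re) => (han z hz.le).differentiableAt.differentiableWithinAt, ?_⟩
    have h' : closure {z : ℂ | 0 < z.re} ⊆ {z : ℂ | 0 ≤ z.re} :=
      closure_minimal (fun z (hz : 0 < z.re) => hz.le) (isClosed_le continuous_const continuous_re)
    exact fun z hz => (han z (h' hz)).continuousAt.continuousWithinAt
  · intro z hz
    have h1 : Tendsto B (nhdsWithin z {z}ᶜ) (nhds (B z)) :=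
      (han z hz.le).continuousAt.tendsto.mono_left nhdsWithin_le_nhds
    have h2 : Tendsto Q (nhdsWithin z {z}ᶜ) (nhds (Q z)) :=
      (hanre z hz).continuousAt.tendsto.mono_left nhdsWithin_le_nhds
    exact tendsto_nhds_unique h1 (h2.congr' (hQB z))
  · intro x
    have h1 : Tendsto B (nhdsWithin ((x : ℂ) * I) {(x : ℂ) * I}ᶜ) (nhds (B (x * I))) :=
      (han _ (by simp)).continuousAt.tendsto.mono_left nhdsWithin_le_nhds
    refine le_of_tendsto ((h1.congr' (hQB _).symm).comp (haxis x)).norm ?_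
    exact Eventually.of_forall fun u => hQaxis u

section EulerProduct

theorem Summable.ite_of_norm {M 𝕜 : Type*} [NormedField 𝕜] [CompleteSpace 𝕜] {f : M → 𝕜}
    (hf : Summable fun x => ‖f x‖) (P : M → Prop) [DecidablePred P] :
    Summable fun x => if P x then f x else 0 :=
  Summable.of_norm_bounded hf fun x => by
    by_cases h : P x
    · rw [if_pos h]
    · rw [if_neg h, norm_zero]; exact norm_nonneg _

open scoped Classical in
theorem prod_one_sub_mul_tsum {M : Type*} [CommMonoidWithZero M] [IsCancelMulZero M]
    [Subsingleton Mˣ] {𝕜 : Type*} [RCLike 𝕜] (f : M →*₀ 𝕜)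
    (hf : Summable fun x => ‖f x‖) (S : Finset M) (hS : ∀ p ∈ S, Prime p) :
    (∏ p ∈ S, (1 - f p)) * ∑' x, f x = ∑' x, if ∀ p ∈ S, ¬ p ∣ x then f x else 0 := by
  induction S using Finset.induction_on with
  | empty => simp
  | insert p S hpS ih =>
    have hp : Prime p := hS p (Finset.mem_insert_self _ _)
    have hS' : ∀ q ∈ S, Prime q := fun q hq => hS q (Finset.mem_insert_of_mem hq)
    rw [Finset.prod_insert hpS, mul_assoc, ih hS']
    set g : M → 𝕜 := fun x => if ∀ q ∈ S, ¬ q ∣ x then f x else 0 with hg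
    have hgs : Summable g := Summable.ite_of_norm hf _
    have hndvd : ∀ q ∈ S, ∀ x, q ∣ p * x ↔ q ∣ x := by
      intro q hq x
      refine ⟨fun h => ((hS' q hq).dvd_or_dvd h).resolve_left fun hqp => ?_,
        fun h => h.mul_left p⟩
      have := associated_iff_eq.1 ((hS' q hq).associated_of_dvd hp hqp)
      exact hpS (this ▸ hq)
    have hmul : ∑' x, (if p ∣ x then g x else 0) = f p * ∑' x, g x := by
      rw [← tsum_mul_left]
      have hinj : Function.Injective fun x : M => p * x := mul_right_injective₀ hp.ne_zero
      rw [← hinj.tsum_eq (f := fun x => if p ∣ x then g x else 0)]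
      · refine tsum_congr fun x => ?_
        simp only [dvd_mul_right, if_true, hg]
        by_cases h : ∀ q ∈ S, ¬ q ∣ x
        · rw [if_pos h, if_pos fun q hq => (hndvd q hq x).not.2 (h q hq), map_mul]
        · rw [if_neg h, if_neg, mul_zero]
          exact fun h' => h fun q hq => (hndvd q hq x).not.1 (h' q hq)
      · intro x hx
        by_contra hx'
        refine hx (if_neg ?_)
        rintro ⟨y, rfl⟩
        exact hx' ⟨y, rfl⟩
    have hpg : Summable fun x => if p ∣ x then g x else 0 :=
      Summable.ite_of_norm hgs.norm _
    rw [sub_mul, one_mul, ← hmul, ← hgs.tsum_sub hpg]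
    refine tsum_congr fun x => ?_
    simp only [hg, Finset.forall_mem_insert]
    by_cases h1 : p ∣ x <;> by_cases h2 : ∀ q ∈ S, ¬ q ∣ x <;> simp [h1, h2]

theorem one_le_norm_tsum_mul_tsum_norm {M : Type*} [CommMonoidWithZero M] [Subsingleton Mˣ]
    [UniqueFactorizationMonoid M] (f : M →*₀ ℂ)
    (hf : Summable fun x => ‖f x‖) (hlt : ∀ p, Prime p → ‖f p‖ < 1) :
    1 ≤ ‖∑' x, f x‖ * ∑' x, ‖f x‖ := by
  classical
  refine le_of_forall_pos_lt_add fun ε hε => ?_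
  obtain ⟨T, hT⟩ := ((tendsto_tsum_compl_atTop_zero fun x => ‖f x‖).eventually_lt_const hε).exists
  set S : Finset M := T.biUnion fun x =>
    if h : ∃ p, Prime p ∧ p ∣ x then {h.choose} else ∅ with hSdef
  have hS : ∀ p ∈ S, Prime p := by
    intro p hp
    obtain ⟨x, -, hx⟩ := Finset.mem_biUnion.1 hp
    split_ifs at hx with h
    · rw [Finset.mem_singleton.1 hx]; exact h.choose_spec.1
    · simp at hx
  have hST : ∀ x ∈ T, x ≠ 0 → x ≠ 1 → ∃ p ∈ S, p ∣ x := by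
    intro x hx h0 h1
    have h : ∃ p, Prime p ∧ p ∣ x := by
      obtain ⟨p, hp, hpx⟩ := WfDvdMonoid.exists_irreducible_factor
        (fun hu => h1 (isUnit_iff_eq_one.1 hu)) h0
      exact ⟨p, hp.prime, hpx⟩
    refine ⟨h.choose, Finset.mem_biUnion.2 ⟨x, hx, ?_⟩, h.choose_spec.2⟩
    rw [dif_pos h]; exact Finset.mem_singleton_self _
  have hone : ∀ p ∈ S, ¬ p ∣ 1 := fun p hp h => (hS p hp).not_isUnit (isUnit_of_dvd_one h)
  -- the partial product times the sum is close to one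
  have h1 := prod_one_sub_mul_tsum f hf S hS
  set g : M → ℂ := fun x => if ∀ p ∈ S, ¬ p ∣ x then f x else 0 with hg
  have hgs : Summable g := Summable.ite_of_norm hf _
  have hbound : 1 - ε < ‖∑' x, g x‖ := by
    have h2 : ‖(∑' x, g x) - 1‖ < ε := by
      have h3 : HasSum (fun x => if x = (1 : M) then (1 : ℂ) else 0) 1 := hasSum_ite_eq 1 1
      rw [← h3.tsum_eq, ← hgs.tsum_sub h3.summable]
      refine lt_of_le_of_lt ?_ hT
      refine le_trans ?_ (tsum_subtype {x | x ∉ T} fun x => ‖f x‖).ge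
      have hsi : Summable ({x | x ∉ T}.indicator fun x => ‖f x‖) := hf.indicator _
      refine tsum_of_norm_bounded hsi.hasSum fun x => ?_
      by_cases hx1 : x = 1
      · have : g x = 1 := by rw [hx1, hg]; simp only; rw [if_pos hone, map_one]
        rw [this, if_pos hx1, sub_self, norm_zero]
        exact Set.indicator_nonneg (fun _ _ => norm_nonneg _) _
      rw [if_neg hx1, sub_zero]
      by_cases hxT : x ∈ T
      · have : g x = 0 := by
          rcases eq_or_ne x 0 with rfl | hx0
          · simp [hg]
          · obtain ⟨p, hp, hpx⟩ := hST x hxT hx0 hx1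
            exact if_neg fun h => h p hp hpx
        rw [this, norm_zero]
        exact Set.indicator_nonneg (fun _ _ => norm_nonneg _) _
      · rw [Set.indicator_of_mem (by exact hxT)]
        simp only [hg]; split_ifs <;> simp
    have := norm_sub_norm_le (1 : ℂ) (1 - ∑' x, g x)
    rw [norm_sub_rev 1, norm_one, sub_sub_cancel] at this
    linarith
  rw [← h1, norm_mul] at hbound
  -- the partial product is bounded by the sum of the norms
  set F : M →*₀ ℝ := (normHom : ℂ →*₀ ℝ).comp f with hF
  have hFf : ∀ x, F x = ‖f x‖ := fun _ => rfl
  have hFs : Summable fun x => ‖F x‖ := by simpa only [hFf, norm_norm] using hf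
  have h4 := prod_one_sub_mul_tsum F hFs S hS
  have h5 : 1 ≤ ∑' x, if ∀ p ∈ S, ¬ p ∣ x then F x else 0 := by
    have hs : Summable fun x => if ∀ p ∈ S, ¬ p ∣ x then F x else 0 :=
      Summable.ite_of_norm hFs _
    have h6 := hs.le_tsum 1 (fun x _ => by
      split_ifs
      · exact norm_nonneg (f x)
      · exact le_rfl)
    rwa [if_pos hone, map_one] at h6
  rw [← h4] at h5
  have hpos : 0 < ∏ p ∈ S, (1 - F p) := Finset.prod_pos fun p hp => by
    have := hlt p (hS p hp)
    rw [hFf]; linarith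
  have h7 : ‖∏ p ∈ S, (1 - f p)‖ * ∏ p ∈ S, (1 - F p) ≤ 1 := by
    rw [norm_prod, ← Finset.prod_mul_distrib]
    refine Finset.prod_le_one (fun p hp => ?_) fun p hp => ?_
    · have := hlt p (hS p hp)
      have h8 : 0 ≤ 1 - F p := by rw [hFf]; linarith
      positivity
    · have := hlt p (hS p hp)
      have h8 : ‖1 - f p‖ ≤ 1 + ‖f p‖ := (norm_sub_le _ _).trans (by rw [norm_one])
      rw [hFf]
      nlinarith [norm_nonneg (f p)]
  have hFsum : ∑' x, F x = ∑' x, ‖f x‖ := rfl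
  rw [hFsum] at h5
  set A := ‖∏ p ∈ S, (1 - f p)‖
  set D := ∏ p ∈ S, (1 - F p)
  have hA : A ≤ ∑' x, ‖f x‖ := by
    have hA0 : 0 ≤ A := norm_nonneg _
    have : 0 ≤ ∑' x, ‖f x‖ := tsum_nonneg fun _ => norm_nonneg _
    nlinarith
  nlinarith [norm_nonneg (∑' x, f x)]

end EulerProduct

theorem summable_exp_neg_mul_add_sq {A : ℝ} (hA : 0 < A) (β : ℝ) :
    Summable fun n : ℤ => Real.exp (-Real.pi * A * (n + β) ^ 2) := by
  refine Summable.of_nonneg_of_le (fun _ => (Real.exp_pos _).le) (fun n => ?_)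
    (summable_pow_mul_jacobiTheta₂_term_bound (A * |β|) hA 0)
  rw [pow_zero, one_mul, Real.exp_le_exp]
  have h1 : -(|β| * |(n : ℝ)|) ≤ n * β := by
    rw [mul_comm |β|, ← abs_mul]; exact neg_abs_le _
  have h2 : A * (n : ℝ) ^ 2 - 2 * (A * |β|) * |(n : ℝ)| ≤ A * (n + β) ^ 2 := by
    nlinarith [mul_le_mul_of_nonneg_left h1 hA.le, mul_nonneg hA.le (sq_nonneg β)]
  push_cast
  nlinarith [mul_le_mul_of_nonneg_left h2 Real.pi_pos.le]

theorem abs_tsum_exp_neg_mul_add_sq_sub_le {A : ℝ} (hA : 0 < A) (β : ℝ) :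
    |∑' n : ℤ, Real.exp (-Real.pi * A * (n + β) ^ 2) - 1 / √A| ≤
      (∑' n : ℤ, 1 / (n : ℝ) ^ 2) * √A := by
  have hsum : Summable fun n : ℤ => 1 / (n : ℝ) ^ 2 := Real.summable_one_div_int_pow.2 one_lt_two
  have hA0 : (A : ℂ) ≠ 0 := by exact_mod_cast hA.ne'
  have hs0 : 0 < √A := Real.sqrt_pos.2 hA
  have hss : √A * √A = A := Real.mul_self_sqrt hA.le
  have key := Complex.tsum_exp_neg_quadratic (a := ((1 / A : ℝ) : ℂ))
    (by rw [ofReal_re]; positivity) (-I * β)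
  have hroot : (((1 / A : ℝ) : ℂ) ^ (1 / 2 : ℂ)) = ((1 / √A : ℝ) : ℂ) := by
    rw [show (1 / 2 : ℂ) = ((1 / 2 : ℝ) : ℂ) by push_cast; rfl, ← ofReal_cpow (by positivity),
      ← Real.sqrt_eq_rpow, Real.sqrt_div zero_le_one, Real.sqrt_one]
  have hR : ∀ n : ℤ, cexp (-Real.pi / ((1 / A : ℝ) : ℂ) * (n + I * (-I * β)) ^ 2) =
      ((Real.exp (-Real.pi * A * (n + β) ^ 2) : ℝ) : ℂ) := by
    intro n
    rw [ofReal_exp]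
    congr 1
    push_cast
    rw [show I * (-I * β) = -(I * I) * β by ring, I_mul_I]
    field_simp
  set G : ℤ → ℂ := fun n =>
    cexp (-Real.pi * ((1 / A : ℝ) : ℂ) * n ^ 2 + 2 * Real.pi * (-I * β) * n) with hG
  have hGn : ∀ n : ℤ, ‖G n‖ = Real.exp (-Real.pi * (1 / A) * n ^ 2) := by
    intro n
    rw [hG, Complex.norm_exp]
    congr 1
    have : (-Real.pi * ((1 / A : ℝ) : ℂ) * n ^ 2 + 2 * Real.pi * (-I * β) * n : ℂ) =
        ((-Real.pi * (1 / A) * n ^ 2 : ℝ) : ℂ) + ((-2 * Real.pi * β * n : ℝ) : ℂ) * I := by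
      push_cast; ring
    rw [this, add_re, ofReal_re, re_ofReal_mul, I_re, mul_zero, add_zero]
  have hG0 : G 0 = 1 := by simp [hG]
  have hGle : ∀ n : ℤ, n ≠ 0 → ‖G n‖ ≤ A * (1 / (n : ℝ) ^ 2) := by
    intro n hn
    have hn0 : 0 < (n : ℝ) ^ 2 := by positivity
    rw [hGn, show -Real.pi * (1 / A) * (n : ℝ) ^ 2 = -(Real.pi * (n ^ 2 / A)) by ring, Real.exp_neg]
    have h1 : (n : ℝ) ^ 2 / A ≤ Real.exp (Real.pi * (n ^ 2 / A)) := by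
      have h2 := Real.add_one_le_exp (Real.pi * ((n : ℝ) ^ 2 / A))
      have h3 : (n : ℝ) ^ 2 / A ≤ Real.pi * (n ^ 2 / A) :=
        le_mul_of_one_le_left (by positivity) (by linarith [Real.pi_gt_three])
      linarith
    have h4 := inv_anti₀ (by positivity) h1
    rw [inv_div] at h4
    exact h4.trans_eq (div_eq_mul_one_div _ _)
  have hGs : Summable G := by
    refine Summable.of_norm_bounded_eventually (g := fun n : ℤ => A * (1 / (n : ℝ) ^ 2))
      (hsum.mul_left A) ?_
    filter_upwards [(Set.finite_singleton (0 : ℤ)).compl_mem_cofinite] with n hn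
    exact hGle n hn
  have hGsum : ‖∑' n, G n - 1‖ ≤ A * ∑' n : ℤ, 1 / (n : ℝ) ^ 2 := by
    have h3 : HasSum (fun x : ℤ => if x = 0 then (1 : ℂ) else 0) 1 := hasSum_ite_eq 0 1
    rw [← h3.tsum_eq, ← hGs.tsum_sub h3.summable, ← tsum_mul_left]
    refine tsum_of_norm_bounded (hsum.mul_left A).hasSum fun n => ?_
    rcases eq_or_ne n 0 with rfl | hn
    · simp [hG0]
    · rw [if_neg hn, sub_zero]; exact hGle n hn
  rw [hroot] at key
  simp_rw [hR] at key
  rw [← ofReal_tsum] at key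
  set S := ∑' n : ℤ, Real.exp (-Real.pi * A * (n + β) ^ 2)
  have hS : ((S - 1 / √A : ℝ) : ℂ) = ((1 / √A : ℝ) : ℂ) * (∑' n, G n - 1) := by
    have hs0' : (√A : ℂ) ≠ 0 := by exact_mod_cast hs0.ne'
    change ∑' n, G n = _ at key
    rw [key]
    push_cast
    field_simp
  rw [← Real.norm_eq_abs, ← Complex.norm_real, hS, norm_mul, Complex.norm_real,
    Real.norm_of_nonneg (by positivity)]
  calc 1 / √A * ‖∑' n, G n - 1‖ ≤ 1 / √A * (A * ∑' n : ℤ, 1 / (n : ℝ) ^ 2) := by gcongr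
    _ = _ := by
      nth_rewrite 2 [← hss]
      field_simp

theorem summable_exp_neg_binary_quadratic {A D : ℝ} (hA : 0 < A) (hD : 0 < D) (β : ℝ) :
    Summable fun p : ℤ × ℤ =>
      Real.exp (-Real.pi * (A * (p.2 + β * p.1) ^ 2 + D * p.1 ^ 2)) := by
  have hsplit : ∀ n m : ℤ, Real.exp (-Real.pi * (A * (m + β * n) ^ 2 + D * n ^ 2)) =
      Real.exp (-Real.pi * D * (n + 0) ^ 2) * Real.exp (-Real.pi * A * (m + β * n) ^ 2) := by
    intro n m; rw [← Real.exp_add]; congr 1; ring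
  rw [summable_prod_of_nonneg fun _ => (Real.exp_pos _).le]
  simp only [hsplit, tsum_mul_left]
  refine ⟨fun n => (summable_exp_neg_mul_add_sq hA _).mul_left _, ?_⟩
  refine Summable.of_nonneg_of_le (fun n => ?_) (fun n => ?_)
    ((summable_exp_neg_mul_add_sq hD 0).mul_right
      (1 / √A + (∑' n : ℤ, 1 / (n : ℝ) ^ 2) * √A))
  · exact mul_nonneg (Real.exp_pos _).le (tsum_nonneg fun _ => (Real.exp_pos _).le)
  · have := (abs_le.1 (abs_tsum_exp_neg_mul_add_sq_sub_le hA (β * n))).2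
    gcongr
    linarith

theorem abs_tsum_exp_neg_binary_quadratic_sub_le {A D : ℝ} (hA : 0 < A) (hD : 0 < D) (β : ℝ) :
    ∃ C : ℝ, ∀ x : ℝ, 0 < x → x ≤ 1 →
      |∑' p : ℤ × ℤ, Real.exp (-Real.pi * x * (A * (p.2 + β * p.1) ^ 2 + D * p.1 ^ 2)) -
        1 / (√A * √D) / x| ≤ C := by
  set Z := ∑' n : ℤ, 1 / (n : ℝ) ^ 2 with hZ
  have hZ0 : 0 ≤ Z := tsum_nonneg fun _ => by positivity
  have ha : 0 < √A := Real.sqrt_pos.2 hA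
  have hd : 0 < √D := Real.sqrt_pos.2 hD
  refine ⟨Z * √D / √A + Z * √A / √D + Z * Z * √A * √D, fun x hx hx1 => ?_⟩
  have hr : 0 < √x := Real.sqrt_pos.2 hx
  have hrr : √x * √x = x := Real.mul_self_sqrt hx.le
  have hsplit : ∀ n m : ℤ,
      Real.exp (-Real.pi * x * (A * (m + β * n) ^ 2 + D * n ^ 2)) =
      Real.exp (-Real.pi * (x * D) * (n + 0) ^ 2) *
        Real.exp (-Real.pi * (x * A) * (m + β * n) ^ 2) := by
    intro n m; rw [← Real.exp_add]; congr 1; ring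
  have hsum : Summable fun p : ℤ × ℤ =>
      Real.exp (-Real.pi * x * (A * (p.2 + β * p.1) ^ 2 + D * p.1 ^ 2)) := by
    refine (summable_exp_neg_binary_quadratic (mul_pos hx hA) (mul_pos hx hD) β).congr fun p => ?_
    congr 1; ring
  rw [hsum.tsum_prod]
  simp only [hsplit, tsum_mul_left]
  have hT := abs_le.1 (abs_tsum_exp_neg_mul_add_sq_sub_le (mul_pos hx hD) 0)
  have hTs := summable_exp_neg_mul_add_sq (mul_pos hx hD) 0
  rw [Real.sqrt_mul hx.le] at hT
  set g : ℤ → ℝ := fun n => Real.exp (-Real.pi * (x * D) * (n + 0) ^ 2)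
  have hg : ∀ n, 0 < g n := fun n => Real.exp_pos _
  set T := ∑' n, g n with hTdef
  have hin : ∀ n : ℤ, |g n * ∑' m : ℤ, Real.exp (-Real.pi * (x * A) * (m + β * n) ^ 2) -
      g n * (1 / (√x * √A))| ≤ g n * (Z * (√x * √A)) := by
    intro n
    rw [← mul_sub, abs_mul, abs_of_pos (hg n), ← Real.sqrt_mul hx.le]
    exact mul_le_mul_of_nonneg_left (abs_tsum_exp_neg_mul_add_sq_sub_le (mul_pos hx hA) _) (hg n).le
  have hout : |(∑' n : ℤ, g n * ∑' m : ℤ, Real.exp (-Real.pi * (x * A) * (m + β * n) ^ 2)) -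
      T * (1 / (√x * √A))| ≤ T * (Z * (√x * √A)) := by
    have hs : Summable fun n : ℤ =>
        g n * ∑' m : ℤ, Real.exp (-Real.pi * (x * A) * (m + β * n) ^ 2) := by
      have := hsum.prod
      simpa only [hsplit, tsum_mul_left] using this
    rw [hTdef, ← tsum_mul_right, ← tsum_mul_right, ← hs.tsum_sub (hTs.mul_right _),
      ← Real.norm_eq_abs]
    exact tsum_of_norm_bounded (hTs.mul_right _).hasSum hin
  have hout' := abs_le.1 hout
  have e1 : 1 / (√x * √D) * (Z * (√x * √A)) = Z * √A / √D := by field_simp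
  have e2 : Z * (√x * √D) * (1 / (√x * √A)) = Z * √D / √A := by field_simp
  have e3 : 1 / (√x * √D) * (1 / (√x * √A)) = 1 / (√A * √D) / x := by
    nth_rewrite 3 [← hrr]; field_simp
  have e4 : Z * (√x * √D) * (Z * (√x * √A)) = x * (Z * Z * √A * √D) := by
    nth_rewrite 3 [← hrr]; ring
  have e5 : x * (Z * Z * √A * √D) ≤ Z * Z * √A * √D := mul_le_of_le_one_left (by positivity) hx1
  have p1 : 0 ≤ 1 / (√x * √A) := by positivity
  have p2 : 0 ≤ Z * (√x * √A) := by positivity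
  rw [abs_le]
  constructor <;>
    nlinarith [mul_le_mul_of_nonneg_right hT.1 p1, mul_le_mul_of_nonneg_right hT.2 p1,
      mul_le_mul_of_nonneg_right hT.2 p2]

theorem exists_norm_mellin_le {f : ℝ → ℂ} {u v : ℝ} (hu : MellinConvergent f u)
    (hv : MellinConvergent f v) :
    ∃ C, ∀ s : ℂ, u ≤ s.re → s.re ≤ v → ‖mellin f s‖ ≤ C := by
  refine ⟨∫ t in Set.Ioi (0 : ℝ),
    (‖(t : ℂ) ^ ((u : ℂ) - 1) • f t‖ + ‖(t : ℂ) ^ ((v : ℂ) - 1) • f t‖), fun s h1 h2 => ?_⟩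
  refine MeasureTheory.norm_integral_le_of_norm_le (hu.norm.add hv.norm) ?_
  refine (MeasureTheory.ae_restrict_iff' measurableSet_Ioi).2 (Eventually.of_forall fun t ht => ?_)
  replace ht : 0 < t := ht
  have hn : ∀ w : ℂ, ‖(t : ℂ) ^ (w - 1) • f t‖ = t ^ (w.re - 1) * ‖f t‖ := by
    intro w
    rw [norm_smul, Complex.norm_cpow_eq_rpow_re_of_pos ht, sub_re, one_re]
  rw [hn, hn, hn, ofReal_re, ofReal_re, ← add_mul]
  refine mul_le_mul_of_nonneg_right ?_ (norm_nonneg _)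
  rcases le_total t 1 with h | h
  · have := Real.rpow_le_rpow_of_exponent_ge ht h (sub_le_sub_right h1 1)
    have := Real.rpow_nonneg ht.le (v - 1)
    linarith
  · have := Real.rpow_le_rpow_of_exponent_le h (sub_le_sub_right h2 1)
    have := Real.rpow_nonneg ht.le (u - 1)
    linarith

theorem mellinConvergent_exp_neg {s : ℂ} (hs : 0 < s.re) :
    MellinConvergent (fun x : ℝ => ((Real.exp (-x) : ℝ) : ℂ)) s := by
  refine (GammaIntegral_convergent hs).congr_fun (fun x _ => ?_) measurableSet_Ioi
  simp only [smul_eq_mul]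
  ring

theorem mellin_exp_neg {s : ℂ} (hs : 0 < s.re) :
    mellin (fun x : ℝ => ((Real.exp (-x) : ℝ) : ℂ)) s = Gamma s := by
  rw [← GammaIntegral_eq_mellin, Gamma_eq_integral hs]

theorem exists_norm_Gamma_le {u v : ℝ} (hu : 0 < u) (hv : 0 < v) :
    ∃ C, ∀ s : ℂ, u ≤ s.re → s.re ≤ v → ‖Gamma s‖ ≤ C := by
  obtain ⟨C, hC⟩ := exists_norm_mellin_le (mellinConvergent_exp_neg (s := u) hu)
    (mellinConvergent_exp_neg (s := v) hv)
  refine ⟨C, fun s h1 h2 => ?_⟩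
  rw [← mellin_exp_neg (hu.trans_le h1)]
  exact hC s h1 h2

section Theta

variable {ι : Type*} {N : ι → ℝ} {c κ C : ℝ}

theorem continuousOn_tsum_exp_neg (hN : ∀ i, 1 ≤ N i) (hc : 0 < c)
    (hs : ∀ x : ℝ, 0 < x → Summable fun i => Real.exp (-(c * N i) * x)) :
    ContinuousOn (fun x => ∑' i, Real.exp (-(c * N i) * x)) (Set.Ioi 0) := by
  intro x hx
  replace hx : 0 < x := hx
  have : ContinuousOn (fun x => ∑' i, Real.exp (-(c * N i) * x)) (Set.Ioi (x / 2)) := by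
    refine continuousOn_tsum (fun i => by fun_prop) (hs (x / 2) (by linarith)) fun i y hy => ?_
    replace hy : x / 2 < y := hy
    rw [Real.norm_of_nonneg (Real.exp_pos _).le, Real.exp_le_exp]
    have : 0 < c * N i := mul_pos hc (by linarith [hN i])
    nlinarith
  exact (this.continuousAt (Ioi_mem_nhds (by linarith))).continuousWithinAt

theorem tsum_exp_neg_le (hN : ∀ i, 1 ≤ N i) (hc : 0 < c)
    (hs : ∀ x : ℝ, 0 < x → Summable fun i => Real.exp (-(c * N i) * x)) {x : ℝ} (hx : 1 ≤ x) :
    ∑' i, Real.exp (-(c * N i) * x) ≤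
      Real.exp c * (∑' i, Real.exp (-(c * N i) * 1)) * Real.exp (-c * x) := by
  rw [mul_right_comm, ← tsum_mul_left]
  refine (hs x (by linarith)).tsum_le_tsum (fun i => ?_) ((hs 1 one_pos).mul_left _)
  rw [← Real.exp_add, ← Real.exp_add, Real.exp_le_exp]
  nlinarith [mul_nonneg hc.le (mul_nonneg (sub_nonneg.2 (hN i)) (sub_nonneg.2 hx))]

theorem exists_mellin_continuation (hN : ∀ i, 1 ≤ N i) (hc : 0 < c)
    (hs : ∀ x : ℝ, 0 < x → Summable fun i => Real.exp (-(c * N i) * x))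
    (hθ : ∀ x : ℝ, 0 < x → x ≤ 1 → |∑' i, Real.exp (-(c * N i) * x) - κ / x| ≤ C) (s : ℂ)
    (hs0 : 0 < s.re) :
    let F : ℝ → ℂ := fun x =>
      ((∑' i, Real.exp (-(c * N i) * x) - κ / x * Real.exp (-x) : ℝ) : ℂ)
    MellinConvergent F s ∧ DifferentiableAt ℂ (mellin F) s := by
  intro F
  have hcont : ContinuousOn F (Set.Ioi 0) := by
    refine continuous_ofReal.comp_continuousOn ((continuousOn_tsum_exp_neg hN hc hs).sub ?_)
    refine (continuousOn_const.div continuousOn_id fun x hx => ?_).mul (by fun_prop)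
    exact ne_of_gt hx
  have hloc := hcont.locallyIntegrableOn (μ := MeasureTheory.volume) measurableSet_Ioi
  have htop : F =O[atTop] fun x : ℝ => x ^ (-(s.re + 1)) := by
    have h1 := (isLittleO_exp_neg_mul_rpow_atTop hc (-(s.re + 1))).isBigO
    have h2 := (isLittleO_exp_neg_mul_rpow_atTop one_pos (-(s.re + 1))).isBigO
    have h3 : F =O[atTop] fun x : ℝ => Real.exp (-c * x) + Real.exp (-1 * x) := by
      set T := Real.exp c * (∑' i, Real.exp (-(c * N i) * 1))
      have hT : 0 ≤ T := mul_nonneg (Real.exp_pos _).le (tsum_nonneg fun _ => (Real.exp_pos _).le)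
      refine Asymptotics.IsBigO.of_bound (T + |κ|) ?_
      filter_upwards [eventually_ge_atTop 1] with x hx
      have e1 := tsum_exp_neg_le hN hc hs hx
      have e2 : 0 ≤ ∑' i, Real.exp (-(c * N i) * x) := tsum_nonneg fun _ => (Real.exp_pos _).le
      have e3 : |κ / x * Real.exp (-x)| ≤ |κ| * Real.exp (-x) := by
        rw [abs_mul, abs_div, abs_of_pos (Real.exp_pos _), abs_of_pos (by linarith : 0 < x)]
        gcongr
        exact div_le_self (abs_nonneg _) hx
      rw [Complex.norm_real, Real.norm_eq_abs,
        Real.norm_of_nonneg (add_pos (Real.exp_pos _) (Real.exp_pos _)).le, neg_one_mul]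
      have e4 := abs_sub (∑' i, Real.exp (-(c * N i) * x)) (κ / x * Real.exp (-x))
      rw [abs_of_nonneg e2] at e4
      have := Real.exp_pos (-c * x)
      have := Real.exp_pos (-x)
      nlinarith [abs_nonneg κ, mul_nonneg hT (Real.exp_pos (-x)).le,
        mul_nonneg (abs_nonneg κ) (Real.exp_pos (-c * x)).le]
    exact h3.trans (h1.add h2)
  have hzero : F =O[nhdsWithin 0 (Set.Ioi 0)] fun x : ℝ => x ^ (-(0 : ℝ)) := by
    refine Asymptotics.IsBigO.of_bound (C + |κ|) ?_
    filter_upwards [Ioc_mem_nhdsGT (zero_lt_one' ℝ)] with x hx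
    rw [neg_zero, Real.rpow_zero, norm_one, mul_one, Complex.norm_real, Real.norm_eq_abs]
    have e1 := hθ x hx.1 hx.2
    have e2 : |κ / x - κ / x * Real.exp (-x)| ≤ |κ| := by
      rw [← mul_one_sub, abs_mul, abs_div, abs_of_pos hx.1, div_mul_eq_mul_div, div_le_iff₀ hx.1]
      refine mul_le_mul_of_nonneg_left ?_ (abs_nonneg _)
      rw [abs_le]
      have := Real.add_one_le_exp (-x)
      have : Real.exp (-x) ≤ 1 := Real.exp_le_one_iff.2 (by linarith [hx.1])
      constructor <;> linarith [hx.1]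
    have e3 := abs_add_le (∑' i, Real.exp (-(c * N i) * x) - κ / x)
      (κ / x - κ / x * Real.exp (-x))
    rw [sub_add_sub_cancel] at e3
    linarith
  exact ⟨mellinConvergent_of_isBigO_rpow hloc htop (by linarith) hzero hs0,
    mellin_differentiableAt_of_isBigO_rpow hloc htop (by linarith) hzero hs0⟩

theorem exists_norm_le_of_theta [Countable ι] (hN : ∀ i, 1 ≤ N i) (hc : 0 < c)
    (hs : ∀ x : ℝ, 0 < x → Summable fun i => Real.exp (-(c * N i) * x))
    (hθ : ∀ x : ℝ, 0 < x → x ≤ 1 → |∑' i, Real.exp (-(c * N i) * x) - κ / x| ≤ C)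
    (hsum : ∀ σ : ℝ, 1 < σ → Summable fun i => N i ^ (-σ)) {X : ℂ → ℂ} (hX : Differentiable ℂ X)
    (hXeq : ∀ s : ℂ, 1 < s.re → X s =
      s * (s - 1) * (((1 / c : ℝ) : ℂ) ^ s * Gamma s * ∑' i, (N i : ℂ) ^ (-s))) :
    ∃ B, 0 ≤ B ∧ ∀ s : ℂ, 1 / 2 ≤ s.re → s.re ≤ 2 → ‖X s‖ ≤ B * (1 + ‖s‖) ^ 2 := by
  set F : ℝ → ℂ := fun x =>
      ((∑' i, Real.exp (-(c * N i) * x) - κ / x * Real.exp (-x) : ℝ) : ℂ) with hF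
  have hcont := exists_mellin_continuation hN hc hs hθ
  have hright : ∀ s : ℂ, 1 < s.re → X s = s * (s - 1) * mellin F s + κ * s * Gamma s := by
    intro s hs1
    have hs0 : 0 < s.re := by linarith
    have hN0 : ∀ i, 0 < N i := fun i => by linarith [hN i]
    have hcN : ∀ i, 0 < c * N i := fun i => mul_pos hc (hN0 i)
    have hm := hasSum_mellin (a := fun _ : ι => 1) (p := fun i => c * N i)
      (F := fun x => ((∑' i, Real.exp (-(c * N i) * x) : ℝ) : ℂ)) (s := s)
      (fun i => Or.inr (hcN i)) hs0
      (fun t ht => by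
        simp only [one_mul]
        exact Complex.hasSum_ofReal.2 (hs t ht).hasSum)
      (by
        refine ((hsum s.re hs1).mul_left (c ^ (-s.re))).congr fun i => ?_
        rw [← Real.mul_rpow hc.le (hN0 i).le, Real.rpow_neg (hcN i).le, norm_one, one_div])
    have hg : HasMellin (fun x : ℝ => ((κ / x * Real.exp (-x) : ℝ) : ℂ)) s
        (κ * Gamma (s - 1)) := by
      have hs1' : 0 < (s - 1).re := by rw [sub_re, one_re]; linarith
      have h1 := mellinConvergent_exp_neg hs1'
      have h2 := mellin_exp_neg hs1'
      have hfun : ∀ x ∈ Set.Ioi (0 : ℝ), ((κ / x * Real.exp (-x) : ℝ) : ℂ) =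
          (κ : ℂ) • ((x : ℂ) ^ (-1 : ℂ) • ((Real.exp (-x) : ℝ) : ℂ)) := by
        intro x _
        rw [cpow_neg_one, smul_eq_mul, smul_eq_mul]
        push_cast
        ring
      rw [sub_eq_add_neg] at h1 h2
      have h3 := (MellinConvergent.cpow_smul.2 h1).const_smul (κ : ℂ)
      constructor
      · refine h3.congr_fun (fun x hx => ?_) measurableSet_Ioi
        simp only [hfun x hx]
      · have h4 : mellin (fun x : ℝ => ((κ / x * Real.exp (-x) : ℝ) : ℂ)) s = mellin
          (fun x : ℝ => (κ : ℂ) • ((x : ℂ) ^ (-1 : ℂ) • ((Real.exp (-x) : ℝ) : ℂ))) s :=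
          MeasureTheory.setIntegral_congr_fun measurableSet_Ioi fun x hx => by
            simp only [hfun x hx]
        rw [h4, mellin_const_smul, mellin_cpow_smul, h2, smul_eq_mul, sub_eq_add_neg]
    have hFg : F = fun x => ((∑' i, Real.exp (-(c * N i) * x) : ℝ) : ℂ) -
        ((κ / x * Real.exp (-x) : ℝ) : ℂ) := by
      funext x; rw [hF]; push_cast; rfl
    have hθc : MellinConvergent (fun x => ((∑' i, Real.exp (-(c * N i) * x) : ℝ) : ℂ)) s := by
      refine ((hcont s hs0).1.add hg.1).congr_fun (fun x _ => ?_) measurableSet_Ioi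
      simp only [Pi.add_apply, ← smul_add]
      congr 1
      push_cast
      ring
    have hsub := (hasMellin_sub hθc hg.1).2
    rw [← hFg] at hsub
    have hG : Gamma s = (s - 1) * Gamma (s - 1) := by
      have := Gamma_add_one (s - 1) (fun h => by
        have h' := congrArg re h
        rw [sub_re, one_re, zero_re] at h'; linarith)
      rwa [sub_add_cancel] at this
    rw [hXeq s hs1, hsub, hg.2, ← hm.tsum_eq, mul_assoc _ (Gamma s), ← tsum_mul_left,
      ← tsum_mul_left, mul_sub]
    have : ∀ i, ((1 / c : ℝ) : ℂ) ^ s * (Gamma s * (N i : ℂ) ^ (-s)) =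
        Gamma s * 1 / ((c * N i : ℝ) : ℂ) ^ s := by
      intro i
      rw [ofReal_mul, mul_cpow_ofReal_nonneg hc.le (hN0 i).le, cpow_neg, one_div, ofReal_inv,
        inv_cpow _ _ (by rw [arg_ofReal_of_nonneg hc.le]; exact Real.pi_pos.ne)]
      field_simp
    simp_rw [this]
    linear_combination -(κ * s) * hG
  have hext : ∀ s : ℂ, 0 < s.re → X s = s * (s - 1) * mellin F s + κ * s * Gamma s := by
    have hopen : IsOpen {s : ℂ | 0 < s.re} := isOpen_lt continuous_const continuous_re
    have hdiff : DifferentiableOn ℂ (fun s => s * (s - 1) * mellin F s + κ * s * Gamma s)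
        {s : ℂ | 0 < s.re} := by
      intro s hs0
      replace hs0 : 0 < s.re := hs0
      have h1 := (hcont s hs0).2
      have h2 : DifferentiableAt ℂ Gamma s := differentiableAt_Gamma s fun m h => by
        rw [h] at hs0
        simp only [neg_re, natCast_re] at hs0
        linarith [(Nat.cast_nonneg m : (0 : ℝ) ≤ m)]
      exact (((differentiableAt_id.mul (differentiableAt_id.sub_const 1)).mul h1).add
        ((differentiableAt_id.const_mul _).mul h2)).differentiableWithinAt
    have := (hX.differentiableOn.analyticOnNhd hopen).eqOn_of_preconnected_of_eventuallyEq
      (hdiff.analyticOnNhd hopen) (convex_halfSpace_re_gt 0).isPreconnected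
      (z₀ := 2) (by simp) (by
        filter_upwards [(isOpen_lt continuous_const continuous_re).mem_nhds
          (show (2 : ℂ) ∈ {s : ℂ | 1 < s.re} by simp)] with s hs1
        exact hright s hs1)
    exact fun s hs0 => this hs0
  obtain ⟨M, hM⟩ := exists_norm_mellin_le (u := 1 / 2) (v := 2)
    (hcont ((1 / 2 : ℝ) : ℂ) (by rw [ofReal_re]; norm_num)).1
    (hcont ((2 : ℝ) : ℂ) (by rw [ofReal_re]; norm_num)).1
  obtain ⟨G, hG⟩ := exists_norm_Gamma_le (u := 1 / 2) (v := 2) (by norm_num) (by norm_num)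
  have hM0 : 0 ≤ M := (norm_nonneg _).trans (hM 1 (by norm_num) (by norm_num))
  have hG0 : 0 ≤ G := (norm_nonneg _).trans (hG 1 (by norm_num) (by norm_num))
  refine ⟨M + |κ| * G, by positivity, fun s h1 h2 => ?_⟩
  rw [hext s (by linarith)]
  have hs := norm_nonneg s
  have e1 : ‖s - 1‖ ≤ 1 + ‖s‖ := (norm_sub_le _ _).trans (by rw [norm_one]; linarith)
  calc ‖s * (s - 1) * mellin F s + κ * s * Gamma s‖
      ≤ ‖s‖ * ‖s - 1‖ * ‖mellin F s‖ + |κ| * ‖s‖ * ‖Gamma s‖ := by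
        refine (norm_add_le _ _).trans (le_of_eq ?_)
        rw [norm_mul, norm_mul, norm_mul, norm_mul, Complex.norm_real, Real.norm_eq_abs]
    _ ≤ (1 + ‖s‖) * (1 + ‖s‖) * M + |κ| * (1 + ‖s‖) ^ 2 * G := by
        have : ‖s‖ ≤ (1 + ‖s‖) ^ 2 := by nlinarith
        have := hM s h1 h2
        have := hG s h1 h2
        gcongr
        linarith
    _ = _ := by ring

end Theta

theorem exists_equiv_absNorm_eq_binary_quadratic (K : Type*) [Field K] [NumberField K]
    (hdeg : Module.finrank ℚ K = 2) (himag : ∀ v : InfinitePlace K, v.IsComplex) :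
    ∃ (e : ℤ × ℤ ≃+ 𝓞 K) (A D β : ℝ), 0 < A ∧ 0 < D ∧ ∀ p : ℤ × ℤ,
      (Ideal.absNorm (Ideal.span {e p}) : ℝ) = A * (p.2 + β * p.1) ^ 2 + D * p.1 ^ 2 := by
  obtain ⟨w⟩ : Nonempty (InfinitePlace K) := inferInstance
  have : IsTotallyComplex K := ⟨himag⟩
  have hcard : Fintype.card (InfinitePlace K) = 1 := by
    have h1 := InfinitePlace.card_eq_nrRealPlaces_add_nrComplexPlaces K
    have h2 := IsTotallyComplex.finrank K
    have h3 := nrRealPlaces_eq_zero_iff.2 this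
    omega
  have hsub : ∀ v : InfinitePlace K, v = w := fun v =>
    (Fintype.card_le_one_iff_subsingleton.1 hcard.le).elim v w
  set φ : K →+* ℂ := w.embedding
  have hnorm : ∀ x : 𝓞 K, (Ideal.absNorm (Ideal.span {x}) : ℝ) = ‖φ x‖ ^ 2 := by
    intro x
    have h1 := InfinitePlace.prod_eq_abs_norm (x : K)
    rw [Fintype.prod_eq_single w fun v hv => absurd (hsub v) hv,
      InfinitePlace.mult_isComplex ⟨w, himag w⟩, ← InfinitePlace.norm_embedding_eq] at h1
    rw [h1, Ideal.absNorm_span_singleton, ← Algebra.coe_norm_int, Nat.cast_natAbs]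
    push_cast
    rfl
  have hrank : Module.finrank ℤ (𝓞 K) = 2 := (RingOfIntegers.rank K).trans hdeg
  let b := Module.finBasisOfFinrankEq ℤ (𝓞 K) hrank
  let e : ℤ × ℤ ≃+ 𝓞 K :=
    ((LinearEquiv.finTwoArrow ℤ ℤ).symm.trans b.equivFun.symm).toAddEquiv
  have he : ∀ p : ℤ × ℤ, e p = p.1 • b 0 + p.2 • b 1 := by
    intro p
    simp [e, Module.Basis.equivFun_symm_apply, LinearEquiv.finTwoArrow]
  set u := φ (b 1)
  set v := φ (b 0)
  have hφe : ∀ p : ℤ × ℤ, φ (e p) = p.1 * v + p.2 * u := by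
    intro p
    rw [he]
    simp [u, v]
  have hu : u ≠ 0 := by
    intro h
    have h1 := b.ne_zero 1
    exact h1 (RingOfIntegers.coe_eq_zero_iff.1 ((map_eq_zero φ).1 h))
  have him : (v / u).im ≠ 0 := by
    intro h
    obtain ⟨γ, hγ⟩ : ∃ γ : ℝ, v = γ * u := ⟨(v / u).re, by
      have : ((v / u).re : ℂ) = v / u := Complex.ext (by simp) (by simp [h])
      rw [this, div_mul_cancel₀ _ hu]⟩
    have hall : ∀ x : 𝓞 K, ∃ t : ℝ, φ x = t * u := by
      intro x
      obtain ⟨p, rfl⟩ := e.surjective x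
      refine ⟨p.1 * γ + p.2, ?_⟩
      rw [hφe, hγ]
      push_cast
      ring
    obtain ⟨t, ht⟩ := hall 1
    have ht1 : (t : ℂ) * u = 1 := by rw [← ht]; simp
    have ht0 : (t : ℂ) ≠ 0 := left_ne_zero_of_mul_eq_one ht1
    have hreal : ∀ x : 𝓞 K, (starRingEnd ℂ) (φ x) = φ x := by
      intro x
      obtain ⟨y, hy⟩ := hall x
      have hur : u = ((t⁻¹ : ℝ) : ℂ) := by
        rw [ofReal_inv]; exact eq_inv_of_mul_eq_one_right ht1
      rw [hy, hur, ← ofReal_mul, conj_ofReal]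
    refine InfinitePlace.isComplex_iff.1 (himag w) (ComplexEmbedding.isReal_iff.2 ?_)
    ext x
    obtain ⟨y, z, -, rfl⟩ := IsFractionRing.div_surjective (𝓞 K) x
    rw [ComplexEmbedding.conjugate_coe_eq, map_div₀, map_div₀]
    change starRingEnd ℂ (φ y) / starRingEnd ℂ (φ z) = φ y / φ z
    rw [hreal, hreal]
  refine ⟨e, ‖u‖ ^ 2, ‖u‖ ^ 2 * (v / u).im ^ 2, (v / u).re, by positivity, by positivity, ?_⟩
  intro p
  have h1 : φ (e p) = u * ((p.2 + (v / u).re * p.1 : ℝ) + ((v / u).im * p.1 : ℝ) * I) := by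
    rw [hφe]
    have h2 := re_add_im (v / u)
    have h3 : v = u * (v / u) := by field_simp
    nth_rewrite 1 [h3, ← h2]
    push_cast
    ring
  rw [hnorm, h1, norm_mul, mul_pow, ← normSq_eq_norm_sq (_ + _ * I), normSq_add_mul_I]
  ring

theorem Ideal.exists_card_mul_tsum_eq {R : Type*} [CommRing R] [IsDomain R]
    [IsPrincipalIdealRing R] {G : Ideal R → ℝ} (hG : ∀ I, 0 < G I)
    (hs : Summable fun x : R => G (Ideal.span {x})) :
    Summable (fun I : {I : Ideal R // I ≠ ⊥} => G I) ∧
      0 < Nat.card Rˣ ∧ Nat.card Rˣ * ∑' I : {I : Ideal R // I ≠ ⊥}, G I =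
        ∑' x : R, G (Ideal.span {x}) - G ⊥ := by
  classical
  set gen : {I : Ideal R // I ≠ ⊥} → R := fun I => Submodule.IsPrincipal.generator I.1
  have hgen : ∀ I, Ideal.span {gen I} = I.1 := fun I => Ideal.span_singleton_generator I.1
  have hgen0 : ∀ I, gen I ≠ 0 := fun I h => I.2 (by rw [← hgen, h, Ideal.span_singleton_eq_bot])
  set f : {I : Ideal R // I ≠ ⊥} × Rˣ → R := fun p => gen p.1 * p.2
  have hf : ∀ p, Ideal.span {f p} = p.1.1 := fun p => by
    rw [Ideal.span_singleton_mul_right_unit p.2.isUnit, hgen]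
  have hinj : Function.Injective f := by
    rintro ⟨I, u⟩ ⟨J, v⟩ h
    have hIJ : I = J := Subtype.ext (by rw [← hf (I, u), h, hf])
    subst hIJ
    exact Prod.ext rfl (Units.ext (mul_left_cancel₀ (hgen0 I) h))
  have hrange : ∀ x : R, x ≠ 0 → x ∈ Set.range f := by
    intro x hx
    have hI : Ideal.span {x} ≠ ⊥ := fun h => hx (Ideal.span_singleton_eq_bot.1 h)
    obtain ⟨u, hu⟩ := Ideal.span_singleton_eq_span_singleton.1 (hgen ⟨_, hI⟩)
    exact ⟨(⟨_, hI⟩, u), hu⟩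
  have hf0 : ∀ p, f p ≠ 0 := fun p => mul_ne_zero (hgen0 _) p.2.ne_zero
  have hprod : Summable fun p : {I : Ideal R // I ≠ ⊥} × Rˣ => G p.1 :=
    (hs.comp_injective hinj).congr fun p => by simp only [Function.comp, hf]
  have hfin : Finite Rˣ := by
    by_contra h
    rw [not_finite_iff_infinite] at h
    have := hprod.prod_factor ⟨⊤, top_ne_bot⟩
    dsimp only at this
    rw [summable_const_iff] at this
    exact (hG _).ne' this
  have hI : Summable (fun I : {I : Ideal R // I ≠ ⊥} => G I) :=
    (hprod.comp_injective (Prod.mk_left_injective (1 : Rˣ)))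
  refine ⟨hI, Nat.card_pos, ?_⟩
  rw [← tsum_mul_left]
  have h1 : ∑' p : {I : Ideal R // I ≠ ⊥} × Rˣ, G p.1 =
      ∑' I : {I : Ideal R // I ≠ ⊥}, Nat.card Rˣ * G I := by
    rw [hprod.tsum_prod]
    refine tsum_congr fun I => ?_
    dsimp only
    rw [tsum_const, nsmul_eq_mul]
  rw [← h1, hs.tsum_eq_add_tsum_ite 0, Ideal.span_singleton_zero, add_sub_cancel_left,
    ← hinj.tsum_eq (f := fun x => if x = 0 then 0 else G (Ideal.span {x}))]
  · refine tsum_congr fun p => ?_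
    rw [if_neg (hf0 p), hf]
  · intro x hx
    refine hrange x fun h => hx ?_
    simp [h]

theorem exists_idealTheta_sub_le (K : Type*) [Field K] [NumberField K]
    (hdeg : Module.finrank ℚ K = 2) (himag : ∀ v : InfinitePlace K, v.IsComplex)
    (hclass : classNumber K = 1) {c : ℝ} (hc : 0 < c) :
    (∀ x : ℝ, 0 < x → Summable fun I : {I : Ideal (𝓞 K) // I ≠ ⊥} =>
      Real.exp (-(c * Ideal.absNorm I.1) * x)) ∧
    ∃ κ C : ℝ, ∀ x : ℝ, 0 < x → x ≤ 1 →
      |∑' I : {I : Ideal (𝓞 K) // I ≠ ⊥}, Real.exp (-(c * Ideal.absNorm I.1) * x) - κ / x| ≤ C := by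
  have := classNumber_eq_one_iff.1 hclass
  obtain ⟨e, A, D, β, hA, hD, hQ⟩ := exists_equiv_absNorm_eq_binary_quadratic K hdeg himag
  have hπ := Real.pi_pos
  have hA' : 0 < c / Real.pi * A := by positivity
  have hD' : 0 < c / Real.pi * D := by positivity
  have hexp : ∀ (x : ℝ) (p : ℤ × ℤ),
      Real.exp (-(c * Ideal.absNorm (Ideal.span {e p})) * x) = Real.exp (-Real.pi * x *
        (c / Real.pi * A * (p.2 + β * p.1) ^ 2 + c / Real.pi * D * p.1 ^ 2)) := by
    intro x p
    rw [hQ]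
    congr 1
    field_simp
  have hs : ∀ x : ℝ, 0 < x → Summable fun y : 𝓞 K =>
      Real.exp (-(c * Ideal.absNorm (Ideal.span {y})) * x) := by
    intro x hx
    rw [← e.toEquiv.summable_iff]
    refine (summable_exp_neg_binary_quadratic (mul_pos hx hA') (mul_pos hx hD') β).congr
      fun p => ?_
    refine Eq.trans ?_ (hexp x p).symm
    congr 1
    ring
  have key := fun (x : ℝ) (hx : 0 < x) => Ideal.exists_card_mul_tsum_eq
    (G := fun I : Ideal (𝓞 K) => Real.exp (-(c * Ideal.absNorm I) * x))
    (fun I => Real.exp_pos _) (hs x hx)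
  refine ⟨fun x hx => (key x hx).1, ?_⟩
  obtain ⟨C, hC⟩ := abs_tsum_exp_neg_binary_quadratic_sub_le hA' hD' β
  set W := Nat.card (𝓞 K)ˣ
  refine ⟨1 / (√(c / Real.pi * A) * √(c / Real.pi * D)) / W, C + 1, fun x hx hx1 => ?_⟩
  obtain ⟨-, hW, h2⟩ := key x hx
  have hW1 : (1 : ℝ) ≤ W := by exact_mod_cast hW
  have h3 : ∑' y : 𝓞 K, Real.exp (-(c * Ideal.absNorm (Ideal.span {y})) * x) =
      ∑' p : ℤ × ℤ, Real.exp (-Real.pi * x *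
        (c / Real.pi * A * (p.2 + β * p.1) ^ 2 + c / Real.pi * D * p.1 ^ 2)) := by
    rw [← e.toEquiv.tsum_eq]
    exact tsum_congr (hexp x)
  rw [h3, Ideal.absNorm_bot, Nat.cast_zero, mul_zero, neg_zero, zero_mul, Real.exp_zero] at h2
  have h4 := hC x hx hx1
  set S := ∑' p : ℤ × ℤ, Real.exp (-Real.pi * x *
        (c / Real.pi * A * (p.2 + β * p.1) ^ 2 + c / Real.pi * D * p.1 ^ 2))
  set k := 1 / (√(c / Real.pi * A) * √(c / Real.pi * D))
  set θ := ∑' I : {I : Ideal (𝓞 K) // I ≠ ⊥}, Real.exp (-(c * Ideal.absNorm I.1) * x)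
  have h5 : (W : ℝ) * |θ - k / W / x| ≤ C + 1 := by
    have h6 : (W : ℝ) * |θ - k / W / x| = |S - k / x - 1| := by
      rw [← abs_of_nonneg (by linarith : (0 : ℝ) ≤ W), ← abs_mul,
        abs_of_nonneg (by linarith : (0 : ℝ) ≤ W), mul_sub, h2]
      congr 1
      field_simp
      ring
    rw [h6]
    refine (abs_sub _ _).trans ?_
    rw [abs_one]
    linarith
  nlinarith [abs_nonneg (θ - k / W / x)]

/-- The value at a real point `σ > 1` of the Dedekind zeta function, as a real number. -/
noncomputable def realDedekindZetaSum (K : Type*) [Field K] [NumberField K] (σ : ℝ) : ℝ :=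
  ∑' I : {I : Ideal (𝓞 K) // I ≠ ⊥}, (Ideal.absNorm I.1 : ℝ) ^ (-σ)

section CompletedZeta

variable {K : Type*} [Field K] [NumberField K]

theorem one_le_absNorm_of_ne_bot (I : {I : Ideal (𝓞 K) // I ≠ ⊥}) :
    (1 : ℝ) ≤ Ideal.absNorm I.1 := by
  have : Ideal.absNorm I.1 ≠ 0 := fun h => I.2 (Ideal.absNorm_eq_zero_iff.1 h)
  exact_mod_cast Nat.one_le_iff_ne_zero.2 this

theorem norm_absNorm_cpow_neg (I : {I : Ideal (𝓞 K) // I ≠ ⊥}) (s : ℂ) :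
    ‖(Ideal.absNorm I.1 : ℂ) ^ (-s)‖ = (Ideal.absNorm I.1 : ℝ) ^ (-s.re) := by
  have := one_le_absNorm_of_ne_bot I
  rw [Complex.norm_natCast_cpow_of_pos (by exact_mod_cast zero_lt_one.trans_le this), neg_re]

theorem norm_dedekindZetaSum_le {s : ℂ}
    (hs : Summable fun I : {I : Ideal (𝓞 K) // I ≠ ⊥} => (Ideal.absNorm I.1 : ℝ) ^ (-s.re)) :
    ‖dedekindZetaSum K s‖ ≤ realDedekindZetaSum K s.re :=
  tsum_of_norm_bounded hs.hasSum fun I => (norm_absNorm_cpow_neg I s).le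

theorem realDedekindZetaSum_le_of_le {σ τ : ℝ} (h : σ ≤ τ)
    (hσ : Summable fun I : {I : Ideal (𝓞 K) // I ≠ ⊥} => (Ideal.absNorm I.1 : ℝ) ^ (-σ))
    (hτ : Summable fun I : {I : Ideal (𝓞 K) // I ≠ ⊥} => (Ideal.absNorm I.1 : ℝ) ^ (-τ)) :
    realDedekindZetaSum K τ ≤ realDedekindZetaSum K σ :=
  hτ.tsum_le_tsum (fun I =>
    Real.rpow_le_rpow_of_exponent_le (one_le_absNorm_of_ne_bot I) (neg_le_neg h)) hσ

theorem one_le_norm_dedekindZetaSum_mul {s : ℂ} (hs1 : 1 < s.re)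
    (hs : Summable fun I : {I : Ideal (𝓞 K) // I ≠ ⊥} => (Ideal.absNorm I.1 : ℝ) ^ (-s.re)) :
    1 ≤ ‖dedekindZetaSum K s‖ * realDedekindZetaSum K s.re := by
  have hs0 : -s ≠ 0 := fun h => by
    have := congrArg re h
    rw [neg_re, zero_re] at this; linarith
  set f : Ideal (𝓞 K) →*₀ ℂ :=
    { toFun := fun I => (Ideal.absNorm I : ℂ) ^ (-s)
      map_zero' := by
        rw [Ideal.zero_eq_bot, Ideal.absNorm_bot, Nat.cast_zero, zero_cpow hs0]
      map_one' := by rw [map_one, Nat.cast_one, one_cpow]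
      map_mul' := fun I J => by rw [map_mul, Nat.cast_mul, natCast_mul_natCast_cpow] } with hf
  have hfI : ∀ I, f I = (Ideal.absNorm I : ℂ) ^ (-s) := fun _ => rfl
  have hf0 : f ⊥ = 0 := f.map_zero
  have hsupp : Function.support f ⊆ {I | I ≠ ⊥} := fun I hI h => hI (by rw [h, hf0])
  have hsupp' : Function.support (fun I => ‖f I‖) ⊆ {I | I ≠ ⊥} := fun I hI h =>
    hI (by simp only [h, hf0, norm_zero])
  have e1 : dedekindZetaSum K s = ∑' I, f I := tsum_subtype_eq_of_support_subset hsupp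
  have e2 : realDedekindZetaSum K s.re = ∑' I, ‖f I‖ := by
    rw [← tsum_subtype_eq_of_support_subset hsupp']
    exact tsum_congr fun I => (norm_absNorm_cpow_neg I s).symm
  rw [e1, e2]
  refine one_le_norm_tsum_mul_tsum_norm f ?_ fun p hp => ?_
  · rw [← Set.indicator_eq_self.2 hsupp', ← summable_subtype_iff_indicator]
    exact hs.congr fun I => (norm_absNorm_cpow_neg I s).symm
  · have hp0 : p ≠ ⊥ := hp.ne_zero
    have h1 : Ideal.absNorm p ≠ 1 := fun h =>
      hp.not_isUnit (Ideal.isUnit_iff.2 (Ideal.absNorm_eq_one_iff.1 h))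
    have h2 := one_le_absNorm_of_ne_bot ⟨p, hp0⟩
    have h3 : (1 : ℝ) < Ideal.absNorm p :=
      lt_of_le_of_ne h2 fun h => h1 (by exact_mod_cast h.symm)
    rw [hfI, norm_absNorm_cpow_neg ⟨p, hp0⟩]
    exact Real.rpow_lt_one_of_one_lt_of_neg h3 (by linarith)

theorem dedekindZetaSum_conj (s : ℂ) :
    dedekindZetaSum K (starRingEnd ℂ s) = starRingEnd ℂ (dedekindZetaSum K s) := by
  unfold dedekindZetaSum
  rw [conj_tsum]
  refine tsum_congr fun I => ?_
  rw [← map_neg, cpow_conj _ _ (by rw [natCast_arg]; exact Real.pi_pos.ne), conj_natCast]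

theorem sqrt_discr_div_two_pi_pos (K : Type*) [Field K] [NumberField K] :
    0 < √|(discr K : ℝ)| / (2 * Real.pi) := by
  have : (discr K : ℝ) ≠ 0 := by exact_mod_cast discr_ne_zero K
  have := Real.pi_pos
  positivity

variable {ΛK ξK : ℂ → ℂ}

theorem IsCompletedDedekindZeta.xi_one_ne_zero (hΛ : IsCompletedDedekindZeta K ΛK)
    (hξ : Differentiable ℂ ξK)
    (hξeq : ∀ s : ℂ, s ≠ 0 → s ≠ 1 → ξK s = s * (s - 1) * ΛK s) : ξK 1 ≠ 0 := by
  obtain ⟨r, hr, hlim⟩ := hΛ.simple_pole_at_one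
  have h1 : Tendsto ξK (nhdsWithin 1 {(1 : ℂ)}ᶜ) (nhds (ξK 1)) :=
    hξ.continuous.continuousAt.tendsto.mono_left nhdsWithin_le_nhds
  have h2 : Tendsto (fun s : ℂ => s * ((s - 1) * ΛK s)) (nhdsWithin 1 {(1 : ℂ)}ᶜ)
      (nhds (1 * r)) := (tendsto_id.mono_left nhdsWithin_le_nhds).mul hlim
  have h3 : (fun s : ℂ => s * ((s - 1) * ΛK s)) =ᶠ[nhdsWithin 1 {(1 : ℂ)}ᶜ] ξK := by
    filter_upwards [self_mem_nhdsWithin,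
      mem_nhdsWithin_of_mem_nhds (isOpen_ne.mem_nhds one_ne_zero)] with s hs1 hs0
    rw [hξeq s hs0 hs1, mul_assoc]
  rw [tendsto_nhds_unique h1 (h2.congr' h3), one_mul]
  exact hr

theorem IsCompletedDedekindZeta.xi_one_sub (hΛ : IsCompletedDedekindZeta K ΛK)
    (hξ : Differentiable ℂ ξK)
    (hξeq : ∀ s : ℂ, s ≠ 0 → s ≠ 1 → ξK s = s * (s - 1) * ΛK s) (s : ℂ) :
    ξK (1 - s) = ξK s := by
  have hd : Dense ({0, 1}ᶜ : Set ℂ) := (Set.toFinite _).countable.dense_compl ℂ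
  have := Continuous.ext_on hd (f := fun s => ξK (1 - s)) (g := ξK)
    (hξ.continuous.comp (continuous_const.sub continuous_id)) hξ.continuous fun z hz => by
      have hz0 : z ≠ 0 := fun h => hz (by simp [h])
      have hz1 : z ≠ 1 := fun h => hz (by simp [h])
      simp only
      rw [hξeq z hz0 hz1, hξeq (1 - z) (sub_ne_zero.2 hz1.symm) (by simpa using hz0),
        hΛ.functional_equation z]
      ring
  exact congrFun this s

theorem IsCompletedDedekindZeta.xi_eq (hΛ : IsCompletedDedekindZeta K ΛK)
    (hξeq : ∀ s : ℂ, s ≠ 0 → s ≠ 1 → ξK s = s * (s - 1) * ΛK s) {s : ℂ} (hs : 1 < s.re) :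
    ξK s = s * (s - 1) * (((√|(discr K : ℝ)| / (2 * Real.pi) : ℝ) : ℂ) ^ s * Gamma s *
      dedekindZetaSum K s) := by
  rw [hξeq s, hΛ.eq_on_gt_one s hs]
  · rintro rfl; rw [zero_re] at hs; linarith
  · rintro rfl; rw [one_re] at hs; linarith

theorem IsCompletedDedekindZeta.summable (hΛ : IsCompletedDedekindZeta K ΛK)
    (hξ : Differentiable ℂ ξK)
    (hξeq : ∀ s : ℂ, s ≠ 0 → s ≠ 1 → ξK s = s * (s - 1) * ΛK s) {σ : ℝ} (hσ : 1 < σ) :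
    Summable fun I : {I : Ideal (𝓞 K) // I ≠ ⊥} => (Ideal.absNorm I.1 : ℝ) ^ (-σ) := by
  by_contra hns
  have hzero : ∀ τ : ℝ, τ ∈ Set.Ioc 1 σ → ξK τ = 0 := by
    intro τ hτ
    rw [hΛ.xi_eq hξeq (by rw [ofReal_re]; exact hτ.1), dedekindZetaSum,
      tsum_eq_zero_of_not_summable, mul_zero, mul_zero]
    intro h
    refine hns (Summable.of_nonneg_of_le (fun I => by positivity) (fun I => ?_) h.norm)
    rw [norm_absNorm_cpow_neg, ofReal_re]
    exact Real.rpow_le_rpow_of_exponent_le (one_le_absNorm_of_ne_bot I) (neg_le_neg hτ.2)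
  have h1 : Tendsto (fun τ : ℝ => ξK τ) (nhdsWithin 1 (Set.Ioi 1)) (nhds (ξK (1 : ℝ))) :=
    ((hξ.continuous.comp continuous_ofReal).continuousAt (x := 1)).tendsto.mono_left
      nhdsWithin_le_nhds
  have h2 : (fun _ : ℝ => (0 : ℂ)) =ᶠ[nhdsWithin 1 (Set.Ioi 1)] fun τ : ℝ => ξK τ := by
    filter_upwards [Ioc_mem_nhdsGT hσ] with τ hτ
    exact (hzero τ hτ).symm
  have h3 := tendsto_nhds_unique h1 (tendsto_const_nhds.congr' h2)
  rw [ofReal_one] at h3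
  exact hΛ.xi_one_ne_zero hξ hξeq h3

theorem IsCompletedDedekindZeta.xi_conj (hΛ : IsCompletedDedekindZeta K ΛK)
    (hξ : Differentiable ℂ ξK)
    (hξeq : ∀ s : ℂ, s ≠ 0 → s ≠ 1 → ξK s = s * (s - 1) * ΛK s) (s : ℂ) :
    ξK (starRingEnd ℂ s) = starRingEnd ℂ (ξK s) := by
  have hd : Differentiable ℂ (starRingEnd ℂ ∘ ξK ∘ starRingEnd ℂ) := fun z => by
    have := (hξ (starRingEnd ℂ z)).conj_conj
    rwa [conj_conj] at this
  have hq := sqrt_discr_div_two_pi_pos K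
  have heq : (starRingEnd ℂ ∘ ξK ∘ starRingEnd ℂ) = ξK := by
    refine AnalyticOnNhd.eq_of_eventuallyEq (𝕜 := ℂ) (z₀ := 2)
      (fun z _ => hd.analyticAt z) (fun z _ => hξ.analyticAt z) ?_
    filter_upwards [(isOpen_lt continuous_const continuous_re).mem_nhds
      (show (2 : ℂ) ∈ {s : ℂ | 1 < s.re} by simp)] with z hz
    replace hz : 1 < z.re := hz
    have hz' : 1 < (starRingEnd ℂ z).re := by rwa [conj_re]
    simp only [Function.comp]
    rw [hΛ.xi_eq hξeq hz, hΛ.xi_eq hξeq hz', Gamma_conj, dedekindZetaSum_conj,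
      cpow_conj _ _ (by rw [arg_ofReal_of_nonneg hq.le]; exact Real.pi_pos.ne), conj_ofReal]
    simp only [map_mul, map_sub, map_one, conj_conj]
  have := congrFun heq s
  simp only [Function.comp] at this
  rw [← this, conj_conj]

theorem IsCompletedDedekindZeta.norm_xi_imaginary (hΛ : IsCompletedDedekindZeta K ΛK)
    (hξ : Differentiable ℂ ξK)
    (hξeq : ∀ s : ℂ, s ≠ 0 → s ≠ 1 → ξK s = s * (s - 1) * ΛK s) (x : ℝ) :
    ‖ξK (x * I)‖ = ‖ξK (1 + x * I)‖ := by
  have h : 1 - (x : ℂ) * I = starRingEnd ℂ (1 + x * I) := by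
    rw [map_add, map_one, map_mul, conj_ofReal, conj_I]; ring
  rw [← hΛ.xi_one_sub hξ hξeq (x * I), h, hΛ.xi_conj hξ hξeq, norm_conj]

theorem IsCompletedDedekindZeta.xi_ne_zero (hΛ : IsCompletedDedekindZeta K ΛK)
    (hξ : Differentiable ℂ ξK)
    (hξeq : ∀ s : ℂ, s ≠ 0 → s ≠ 1 → ξK s = s * (s - 1) * ΛK s) {s : ℂ} (hs : 1 < s.re) :
    ξK s ≠ 0 := by
  have h1 := one_le_norm_dedekindZetaSum_mul hs (hΛ.summable hξ hξeq hs)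
  have h2 : dedekindZetaSum K s ≠ 0 := fun h => by
    rw [h, norm_zero, zero_mul] at h1; linarith
  have hq : ((√|(discr K : ℝ)| / (2 * Real.pi) : ℝ) : ℂ) ≠ 0 :=
    ofReal_ne_zero.2 (sqrt_discr_div_two_pi_pos K).ne'
  rw [hΛ.xi_eq hξeq hs]
  refine mul_ne_zero (mul_ne_zero ?_ (sub_ne_zero.2 ?_)) (mul_ne_zero (mul_ne_zero
    (by rw [Ne, cpow_eq_zero_iff]; exact fun h => hq h.1)
    (Gamma_ne_zero_of_re_pos (by linarith))) h2)
  · rintro rfl; rw [zero_re] at hs; linarith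
  · rintro rfl; rw [one_re] at hs; linarith

theorem IsCompletedDedekindZeta.exists_realDedekindZetaSum_le (hΛ : IsCompletedDedekindZeta K ΛK)
    (hξ : Differentiable ℂ ξK)
    (hξeq : ∀ s : ℂ, s ≠ 0 → s ≠ 1 → ξK s = s * (s - 1) * ΛK s) :
    ∃ C, 0 ≤ C ∧ ∀ σ : ℝ, 0 < σ → σ ≤ 2 → realDedekindZetaSum K (1 + σ) * σ ≤ C := by
  set q := √|(discr K : ℝ)| / (2 * Real.pi) with hqdef
  have hq : 0 < q := sqrt_discr_div_two_pi_pos K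
  obtain ⟨M, hM⟩ := (isCompact_Icc (a := (1 : ℝ)) (b := 3)).exists_bound_of_continuousOn
    (f := fun σ : ℝ => ξK σ) (hξ.continuous.comp continuous_ofReal).continuousOn
  have hG : ContinuousOn (fun x : ℝ => q ^ x * Real.Gamma x) (Set.Icc 1 3) := by
    refine ((Real.continuous_const_rpow hq.ne').continuousOn).mul fun x hx => ?_
    exact (Real.differentiableAt_Gamma fun m h => by
      have := hx.1
      have : (0 : ℝ) ≤ m := Nat.cast_nonneg m
      linarith).continuousAt.continuousWithinAt
  obtain ⟨y, hy, hymin⟩ := (isCompact_Icc (a := (1 : ℝ)) (b := 3)).exists_isMinOn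
    ⟨1, by norm_num⟩ hG
  set m := q ^ y * Real.Gamma y with hm
  have hm0 : 0 < m := mul_pos (Real.rpow_pos_of_pos hq _)
    (Real.Gamma_pos_of_pos (by linarith [hy.1]))
  have hM0 : 0 ≤ M := (norm_nonneg _).trans (hM 1 (by norm_num))
  refine ⟨M / m, by positivity, fun σ h0 h2 => ?_⟩
  have hmem : 1 + σ ∈ Set.Icc (1 : ℝ) 3 := ⟨by linarith, by linarith⟩
  have h3 := hM (1 + σ) hmem
  have h4 : m ≤ q ^ (1 + σ) * Real.Gamma (1 + σ) := hymin hmem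
  have hZ : dedekindZetaSum K ((1 + σ : ℝ) : ℂ) = (realDedekindZetaSum K (1 + σ) : ℂ) := by
    rw [dedekindZetaSum, realDedekindZetaSum, ofReal_tsum]
    refine tsum_congr fun I => ?_
    rw [ofReal_cpow (Nat.cast_nonneg _), ofReal_natCast, ofReal_neg]
  have hZ0 : 0 ≤ realDedekindZetaSum K (1 + σ) := tsum_nonneg fun I => by positivity
  rw [hΛ.xi_eq hξeq (by rw [ofReal_re]; linarith), hZ, ← hqdef, Gamma_ofReal, ← ofReal_cpow hq.le,
    ← ofReal_one, ← ofReal_sub, ← ofReal_mul, ← ofReal_mul, ← ofReal_mul, ← ofReal_mul,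
    norm_real, Real.norm_eq_abs, add_sub_cancel_left] at h3
  rw [le_div_iff₀ hm0]
  have h5 := (le_abs_self _).trans h3
  set Z := realDedekindZetaSum K (1 + σ)
  set P := q ^ (1 + σ) * Real.Gamma (1 + σ)
  calc Z * σ * m ≤ Z * σ * P := by gcongr
    _ ≤ (1 + σ) * (Z * σ * P) :=
        le_mul_of_one_le_left (mul_nonneg (by positivity) (hm0.le.trans h4)) (by linarith)
    _ = (1 + σ) * σ * (P * Z) := by ring
    _ ≤ M := h5

end CompletedZeta

theorem norm_sin_le_exp_norm (z : ℂ) : ‖Complex.sin z‖ ≤ Real.exp ‖z‖ := by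
  rw [Complex.sin, norm_div, norm_mul, norm_I, mul_one, Complex.norm_two, div_le_iff₀ two_pos]
  have h1 := norm_exp_le_exp_norm (-z * I)
  have h2 := norm_exp_le_exp_norm (z * I)
  rw [norm_mul, norm_I, mul_one, norm_neg] at h1
  rw [norm_mul, norm_I, mul_one] at h2
  linarith [norm_sub_le (cexp (-z * I)) (cexp (z * I))]

theorem exists_norm_inv_Gamma_one_add_le :
    ∃ C, 0 ≤ C ∧ ∀ t : ℂ, 0 ≤ t.re → t.re ≤ 2 → 2 ≤ |t.im| →
      ‖(Gamma (1 + t))⁻¹‖ ≤ C * Real.exp (Real.pi * ‖t‖) := by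
  obtain ⟨G, hG⟩ := exists_norm_Gamma_le (u := 1) (v := 3) one_pos (by norm_num)
  have hG0 : 0 ≤ G := (norm_nonneg _).trans (hG 1 (by norm_num) (by norm_num))
  have hπ := Real.pi_pos
  refine ⟨G * Real.exp Real.pi, by positivity, fun t h0 h2 him => ?_⟩
  have hbig : ∀ x : ℝ, 1 ≤ ‖(x : ℂ) - t‖ := by
    intro x
    have := abs_im_le_norm ((x : ℂ) - t)
    rw [sub_im, ofReal_im, zero_sub, abs_neg] at this
    linarith
  have hne : ∀ x : ℝ, (x : ℂ) - t ≠ 0 := fun x h => by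
    have := hbig x
    rw [h, norm_zero] at this
    linarith
  have g0 := Gamma_add_one (((0 : ℝ) : ℂ) - t) (hne 0)
  have g1 := Gamma_add_one (((1 : ℝ) : ℂ) - t) (hne 1)
  have g2 := Gamma_add_one (((2 : ℝ) : ℂ) - t) (hne 2)
  have b0 := hbig 0
  have b1 := hbig 1
  have b2 := hbig 2
  push_cast at g0 g1 g2 b0 b1 b2
  rw [show (0 : ℂ) - t + 1 = 1 - t by ring] at g0
  rw [show (1 : ℂ) - t + 1 = 2 - t by ring, g0] at g1
  rw [show (2 : ℂ) - t + 1 = 3 - t by ring, g1, zero_sub] at g2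
  rw [zero_sub] at b0
  have h3 : ‖Gamma (-t)‖ ≤ G := by
    have h4 := hG (3 - t) (by rw [sub_re, re_ofNat]; linarith) (by rw [sub_re, re_ofNat]; linarith)
    rw [g2, norm_mul, norm_mul, norm_mul] at h4
    have hn := norm_nonneg (Gamma (-t))
    have e1 : 1 * ‖Gamma (-t)‖ ≤ ‖-t‖ * ‖Gamma (-t)‖ := mul_le_mul_of_nonneg_right b0 hn
    have e2 : 1 * (‖-t‖ * ‖Gamma (-t)‖) ≤ ‖1 - t‖ * (‖-t‖ * ‖Gamma (-t)‖) :=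
      mul_le_mul_of_nonneg_right b1 (by positivity)
    have e3 : 1 * (‖1 - t‖ * (‖-t‖ * ‖Gamma (-t)‖)) ≤
        ‖2 - t‖ * (‖1 - t‖ * (‖-t‖ * ‖Gamma (-t)‖)) :=
      mul_le_mul_of_nonneg_right b2 (by positivity)
    linarith
  have hrefl := Complex.Gamma_mul_Gamma_one_sub (1 + t)
  rw [show (1 : ℂ) - (1 + t) = -t by ring] at hrefl
  have hΓ : Gamma (1 + t) ≠ 0 := Gamma_ne_zero_of_re_pos (by rw [add_re, one_re]; linarith)
  have hΓ' : Gamma (-t) ≠ 0 := by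
    intro h
    have hz : Gamma (3 - t) = 0 := by rw [g2, h]; ring
    exact Gamma_ne_zero_of_re_pos (by rw [sub_re, re_ofNat]; linarith) hz
  have hsin : Complex.sin (Real.pi * (1 + t)) ≠ 0 := by
    intro h
    rw [h, div_zero] at hrefl
    exact mul_ne_zero hΓ hΓ' hrefl
  have hπ0 : (Real.pi : ℂ) ≠ 0 := ofReal_ne_zero.2 hπ.ne'
  have hinv : (Gamma (1 + t))⁻¹ = Gamma (-t) * Complex.sin (Real.pi * (1 + t)) / Real.pi := by
    rw [eq_div_iff hsin] at hrefl
    rw [eq_div_iff hπ0, inv_mul_eq_iff_eq_mul₀ hΓ]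
    linear_combination -hrefl
  rw [hinv, norm_div, norm_mul, norm_real, Real.norm_of_nonneg hπ.le]
  have hs := norm_sin_le_exp_norm (Real.pi * (1 + t))
  have ht : ‖(Real.pi : ℂ) * (1 + t)‖ ≤ Real.pi + Real.pi * ‖t‖ := by
    rw [norm_mul, norm_real, Real.norm_of_nonneg hπ.le, ← mul_one_add]
    gcongr
    exact (norm_add_le _ _).trans_eq (by rw [norm_one])
  calc ‖Gamma (-t)‖ * ‖Complex.sin (Real.pi * (1 + t))‖ / Real.pi
      ≤ ‖Gamma (-t)‖ * ‖Complex.sin (Real.pi * (1 + t))‖ :=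
        div_le_self (by positivity) (by linarith [Real.pi_gt_three])
    _ ≤ G * Real.exp (Real.pi + Real.pi * ‖t‖) := by
        gcongr
        exact hs.trans (Real.exp_le_exp.2 ht)
    _ = _ := by rw [Real.exp_add]; ring

section CompletedZeta

variable {K : Type*} [Field K] [NumberField K] {ΛK ξK : ℂ → ℂ}

theorem IsCompletedDedekindZeta.exists_norm_xi_le (hΛ : IsCompletedDedekindZeta K ΛK)
    (hdeg : Module.finrank ℚ K = 2) (himag : ∀ v : InfinitePlace K, v.IsComplex)
    (hclass : classNumber K = 1) (hξ : Differentiable ℂ ξK)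
    (hξeq : ∀ s : ℂ, s ≠ 0 → s ≠ 1 → ξK s = s * (s - 1) * ΛK s) :
    ∃ B, 0 ≤ B ∧ ∀ s : ℂ, 0 ≤ s.re → s.re ≤ 2 → ‖ξK s‖ ≤ B * (2 + ‖s‖) ^ 2 := by
  have hq := sqrt_discr_div_two_pi_pos K
  set q := √|(discr K : ℝ)| / (2 * Real.pi) with hqdef
  have hc : 0 < 1 / q := by positivity
  obtain ⟨hs, κ, C, hθ⟩ := exists_idealTheta_sub_le K hdeg himag hclass hc
  have : Countable {I : Ideal (𝓞 K) // I ≠ ⊥} := by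
    have h1 := (hs 1 one_pos).countable_support
    rw [Function.support_eq_univ (fun I => (Real.exp_pos _).ne')] at h1
    exact Set.countable_univ_iff.1 h1
  obtain ⟨B, hB0, hB⟩ := exists_norm_le_of_theta (X := ξK) one_le_absNorm_of_ne_bot hc hs hθ
    (fun σ hσ => hΛ.summable hξ hξeq hσ) hξ fun s hs1 => by
      rw [hΛ.xi_eq hξeq hs1, one_div_one_div]
      simp only [ofReal_natCast, dedekindZetaSum, hqdef]
  refine ⟨B, hB0, fun s h0 h2 => ?_⟩
  have hn := norm_nonneg s
  rcases le_total (1 / 2) s.re with h | h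
  · refine (hB s h h2).trans ?_
    gcongr
    norm_num
  · rw [← hΛ.xi_one_sub hξ hξeq]
    refine (hB (1 - s) (by rw [sub_re, one_re]; linarith)
      (by rw [sub_re, one_re]; linarith)).trans ?_
    have := norm_sub_le 1 s
    rw [norm_one] at this
    exact mul_le_mul_of_nonneg_left (pow_le_pow_left₀ (by positivity) (by linarith) 2) hB0

theorem IsCompletedDedekindZeta.exists_xi_ratio (hΛ : IsCompletedDedekindZeta K ΛK)
    (hdeg : Module.finrank ℚ K = 2) (himag : ∀ v : InfinitePlace K, v.IsComplex)
    (hclass : classNumber K = 1) (hξ : Differentiable ℂ ξK)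
    (hξeq : ∀ s : ℂ, s ≠ 0 → s ≠ 1 → ξK s = s * (s - 1) * ΛK s) :
    ∃ B : ℂ → ℂ, DifferentiableOn ℂ B {z | 0 < z.re} ∧
      (∀ z, 0 < z.re → B z = ξK z / ξK (1 + z)) ∧ ∀ z, 0 < z.re → ‖B z‖ ≤ 1 := by
  have hne : ∀ z : ℂ, 0 < z.re → ξK (1 + z) ≠ 0 := fun z hz =>
    hΛ.xi_ne_zero hξ hξeq (by rw [add_re, one_re]; linarith)
  obtain ⟨B, hBd, hBeq, hBim⟩ := exists_diffContOnCl_eq_div hξ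
    (Y := fun z => ξK (1 + z)) (hξ.comp (differentiable_id.const_add 1)) hne
    (hΛ.norm_xi_imaginary hξ hξeq)
  obtain ⟨C₁, hC₁, hstrip⟩ := hΛ.exists_norm_xi_le hdeg himag hclass hξ hξeq
  obtain ⟨C₂, hC₂, hZ⟩ := hΛ.exists_realDedekindZetaSum_le hξ hξeq
  obtain ⟨C₃, hC₃, hΓ⟩ := exists_norm_inv_Gamma_one_add_le
  set q := √|(discr K : ℝ)| / (2 * Real.pi) with hqdef
  have hq : 0 < q := sqrt_discr_div_two_pi_pos K
  have hqc : (q : ℂ) ≠ 0 := ofReal_ne_zero.2 hq.ne'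
  have hπ := Real.pi_pos
  obtain ⟨m, hm0, hm⟩ : ∃ m : ℝ, 0 ≤ m ∧ ∀ σ : ℝ, 1 ≤ σ → σ ≤ 3 → q ^ (-σ) ≤ m := by
    refine ⟨q ^ (-1 : ℝ) + q ^ (-3 : ℝ), by positivity, fun σ h1 h3 => ?_⟩
    have := Real.rpow_pos_of_pos hq (-1)
    have := Real.rpow_pos_of_pos hq (-3)
    rcases le_total q 1 with h | h
    · linarith [Real.rpow_le_rpow_of_exponent_ge hq h (neg_le_neg h3)]
    · linarith [Real.rpow_le_rpow_of_exponent_le h (neg_le_neg h1)]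
  -- estimates for the value of the zeta function at `1 + z`
  have hinvζ : ∀ z : ℂ, 0 < z.re →
      ‖(dedekindZetaSum K (1 + z))⁻¹‖ ≤ realDedekindZetaSum K (1 + z.re) := by
    intro z hz
    have hz1 : 1 < (1 + z).re := by rw [add_re, one_re]; linarith
    have h1 := one_le_norm_dedekindZetaSum_mul hz1 (hΛ.summable hξ hξeq hz1)
    have h2 : 0 < ‖dedekindZetaSum K (1 + z)‖ := by
      rcases (norm_nonneg (dedekindZetaSum K (1 + z))).eq_or_lt with h | h
      · rw [← h, zero_mul] at h1; linarith
      · exact h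
    rw [add_re, one_re] at h1
    rw [norm_inv, inv_le_iff_one_le_mul₀ h2, mul_comm]
    exact h1
  have hz0 : ∀ z : ℂ, 0 < z.re → z ≠ 0 := fun z hz h => by
    rw [h, zero_re] at hz; exact lt_irrefl _ hz
  have hz1 : ∀ z : ℂ, 0 < z.re → (1 : ℝ) ≤ ‖1 + z‖ := fun z hz => by
    have := re_le_norm (1 + z)
    rw [add_re, one_re] at this
    linarith
  set W := realDedekindZetaSum K (3 / 2) with hW
  have hW0 : 0 ≤ W := tsum_nonneg fun I => by positivity
  set K₁ := C₁ * m * C₃ * C₂ * Real.exp 4 with hK₁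
  set K₂ := W * W / q with hK₂
  have hK₁0 : 0 ≤ K₁ := by positivity
  have hK₂0 : 0 ≤ K₂ := by positivity
  refine ⟨B, hBd.differentiableOn, hBeq, fun z hz =>
    norm_le_one_of_halfDisc_growth (C := K₁ + K₂ + 2 + Real.pi) hBd hBim ?_ ?_ hz.le⟩
  · intro t h0 h2 him
    have ht1 : 1 ≤ ‖t‖ := by
      have := abs_im_le_norm t
      linarith
    have hX := hstrip t h0.le h2
    have hr : 1 < (1 + t).re := by rw [add_re, one_re]; linarith
    have hinv : ‖(ξK (1 + t))⁻¹‖ ≤ m * (C₃ * Real.exp (Real.pi * ‖t‖)) *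
        realDedekindZetaSum K (1 + t.re) := by
      rw [hΛ.xi_eq hξeq hr, ← hqdef, mul_inv ((1 + t) * (1 + t - 1)),
        mul_inv ((q : ℂ) ^ (1 + t) * _), mul_inv ((q : ℂ) ^ (1 + t)), norm_mul, norm_mul, norm_mul]
      have e1 : ‖((1 + t) * (1 + t - 1))⁻¹‖ ≤ 1 := by
        rw [add_sub_cancel_left, norm_inv, norm_mul]
        exact inv_le_one_of_one_le₀ (one_le_mul_of_one_le_of_one_le (hz1 t h0) ht1)
      have e2 : ‖((q : ℂ) ^ (1 + t))⁻¹‖ ≤ m := by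
        rw [← cpow_neg, norm_cpow_eq_rpow_re_of_pos hq, neg_re]
        exact hm _ hr.le (by rw [add_re, one_re]; linarith)
      have e3 := hΓ t h0.le h2 him
      have e4 := hinvζ t h0
      calc _ ≤ 1 * (m * (C₃ * Real.exp (Real.pi * ‖t‖)) *
            realDedekindZetaSum K (1 + t.re)) := by gcongr
        _ = _ := one_mul _
    have hpoly : (2 + ‖t‖) ^ 2 ≤ Real.exp 4 * Real.exp (2 * ‖t‖) := by
      have := Real.add_one_le_exp (1 + ‖t‖)
      calc (2 + ‖t‖) ^ 2 ≤ (Real.exp (1 + ‖t‖)) ^ 2 := by gcongr; linarith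
        _ = Real.exp (2 + 2 * ‖t‖) := by rw [← Real.exp_nat_mul]; congr 1; push_cast; ring
        _ ≤ Real.exp (4 + 2 * ‖t‖) := Real.exp_le_exp.2 (by linarith)
        _ = _ := Real.exp_add _ _
    rw [hBeq t h0, div_eq_mul_inv, norm_mul]
    have hZ' := hZ t.re h0 h2
    have hZ0 : 0 ≤ realDedekindZetaSum K (1 + t.re) := tsum_nonneg fun I => by positivity
    calc ‖ξK t‖ * ‖(ξK (1 + t))⁻¹‖ * t.re
        ≤ (C₁ * (Real.exp 4 * Real.exp (2 * ‖t‖))) * (m * (C₃ * Real.exp (Real.pi * ‖t‖)) *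
          realDedekindZetaSum K (1 + t.re)) * t.re := by
          gcongr
          exact hX.trans (by gcongr)
      _ = C₁ * m * C₃ * Real.exp 4 * (Real.exp (2 * ‖t‖) * Real.exp (Real.pi * ‖t‖)) *
          (realDedekindZetaSum K (1 + t.re) * t.re) := by ring
      _ ≤ C₁ * m * C₃ * Real.exp 4 * (Real.exp (2 * ‖t‖) * Real.exp (Real.pi * ‖t‖)) * C₂ := by
          gcongr
      _ = K₁ * Real.exp ((2 + Real.pi) * ‖t‖) := by rw [← Real.exp_add, add_mul, hK₁]; ring
      _ ≤ _ := by
          gcongr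
          · linarith
          · linarith
  · intro t ht
    have ht0 : 0 < t.re := by linarith
    have ht1 : 1 < t.re := by linarith
    have hr : 1 < (1 + t).re := by rw [add_re, one_re]; linarith
    have htn := hz0 t ht0
    have hΓt : Gamma t ≠ 0 := Gamma_ne_zero_of_re_pos ht0
    have h1t : 1 + t ≠ 0 := fun h => by
      have := hz1 t ht0
      rw [h, norm_zero] at this
      linarith
    have hζ0 : dedekindZetaSum K (1 + t) ≠ 0 := by
      intro h
      have h1 := hne t ht0
      rw [hΛ.xi_eq hξeq hr, h, mul_zero, mul_zero] at h1
      exact h1 rfl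
    have hqt : (q : ℂ) ^ t ≠ 0 := by rw [Ne, cpow_eq_zero_iff]; exact fun h => hqc h.1
    have hB : B t = (t - 1) / (1 + t) * (t⁻¹ * ((q : ℂ)⁻¹ *
        (dedekindZetaSum K t * (dedekindZetaSum K (1 + t))⁻¹))) := by
      rw [hBeq t ht0, hΛ.xi_eq hξeq hr, hΛ.xi_eq hξeq ht1, ← hqdef, cpow_add _ _ hqc, cpow_one,
        add_comm 1 t, Gamma_add_one t htn, add_sub_cancel_right, add_comm t 1]
      field_simp
    have e1 : ‖(t - 1) / (1 + t)‖ ≤ 1 := by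
      rw [norm_div, div_le_one (by linarith [hz1 t ht0])]
      rw [← sq_le_sq₀ (norm_nonneg _) (norm_nonneg _), ← normSq_eq_norm_sq, ← normSq_eq_norm_sq,
        normSq_apply, normSq_apply, sub_re, sub_im, add_re, add_im, one_re, one_im]
      nlinarith
    have e2 : ‖t⁻¹‖ ≤ 1 := by
      rw [norm_inv]
      exact inv_le_one_of_one_le₀ (ht1.le.trans (re_le_norm t))
    have e3 : ‖(q : ℂ)⁻¹‖ = q⁻¹ := by rw [norm_inv, norm_real, Real.norm_of_nonneg hq.le]
    have hs32 := hΛ.summable hξ hξeq (σ := 3 / 2) (by norm_num)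
    have e4 : ‖dedekindZetaSum K t‖ ≤ W :=
      (norm_dedekindZetaSum_le (hΛ.summable hξ hξeq ht1)).trans
        (realDedekindZetaSum_le_of_le ht hs32 (hΛ.summable hξ hξeq ht1))
    have e5 : ‖(dedekindZetaSum K (1 + t))⁻¹‖ ≤ W :=
      (hinvζ t ht0).trans (realDedekindZetaSum_le_of_le (by linarith) hs32
        (hΛ.summable hξ hξeq (by linarith)))
    rw [hB, norm_mul, norm_mul, norm_mul, norm_mul, e3]
    calc _ ≤ 1 * (1 * (q⁻¹ * (W * W))) := by gcongr
      _ = K₂ := by rw [hK₂]; ring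
      _ ≤ _ := by linarith

theorem IsCompletedDedekindZeta.ratio_eq_of_phiK_eq_zero
    (hξeq : ∀ s : ℂ, s ≠ 0 → s ≠ 1 → ξK s = s * (s - 1) * ΛK s) {a t : ℝ} (ha : 0 < a)
    (ht : t ∈ Set.Ioo (0 : ℝ) 1) (hne : ξK (1 + t) ≠ 0) (hφ : phiK ΛK a ((1 + t : ℝ) : ℂ) = 0) :
    ξK t / ξK (1 + t) = (a ^ (2 * t) * ((1 - t) / (1 + t)) : ℝ) := by
  have ht0 : (t : ℂ) ≠ 0 := ofReal_ne_zero.2 ht.1.ne'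
  have ht1 : (t : ℂ) ≠ 1 := fun h => ht.2.ne (by exact_mod_cast h)
  have h1t : (1 + t : ℂ) ≠ 0 := by
    exact_mod_cast (by linarith [ht.1] : (1 + t : ℝ) ≠ 0)
  have hac : (a : ℂ) ≠ 0 := ofReal_ne_zero.2 ha.ne'
  have e2 := hξeq (1 + t) h1t (by simpa using ht0)
  rw [add_sub_cancel_left] at e2
  rw [hξeq t ht0 ht1, div_eq_iff hne, e2]
  unfold phiK at hφ
  push_cast at hφ
  rw [add_sub_cancel_left, show (2 : ℂ) - (1 + t) = 1 + t - (2 * t : ℝ) by push_cast; ring,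
    cpow_sub _ _ hac, ← ofReal_cpow ha.le] at hφ
  have hp : (a : ℂ) ^ (1 + t : ℂ) ≠ 0 := by rw [Ne, cpow_eq_zero_iff]; exact fun h => hac h.1
  have hp2 : ((a ^ (2 * t) : ℝ) : ℂ) ≠ 0 := ofReal_ne_zero.2 (Real.rpow_pos_of_pos ha _).ne'
  have h3 : ΛK t = -((a ^ (2 * t) : ℝ) : ℂ) * ΛK (1 + t) := by
    field_simp at hφ
    have h4 : (a : ℂ) ^ (1 + t : ℂ) * (ΛK (1 + t) * ((a ^ (2 * t) : ℝ) : ℂ) + ΛK t) = 0 := by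
      linear_combination hφ
    have h5 := (mul_eq_zero.1 h4).resolve_left hp
    linear_combination h5
  rw [h3, ofReal_mul, ofReal_div, ofReal_sub, ofReal_add, ofReal_one]
  field_simp
  ring

end CompletedZeta

theorem le_exp_inv_of_rpow_mul_le_one {a t : ℝ} (ha : 0 < a) (ht : t ∈ Set.Ioo (0 : ℝ) 1)
    (h : a ^ (2 * t) * ((1 - t) / (1 + t)) ≤ 1) : a ≤ Real.exp (1 / (1 - t)) := by
  have ht1 : 0 < 1 - t := by linarith [ht.2]
  have ht0 := ht.1
  have h1 : a ^ (2 * t) ≤ Real.exp (1 / (1 - t)) ^ (2 * t) := by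
    rw [mul_div_assoc', div_le_one (by linarith)] at h
    rw [← Real.exp_mul]
    have h2 := Real.add_one_le_exp (1 / (1 - t) * (2 * t))
    refine le_trans ?_ h2
    rw [show 1 / (1 - t) * (2 * t) + 1 = (1 + t) / (1 - t) by field_simp; ring,
      le_div_iff₀ ht1]
    exact h
  exact (Real.rpow_le_rpow_iff ha.le (Real.exp_pos _).le (by linarith)).1 h1

/-- The off-line real zero `ρ_a ∈ (1,2)` of `φ_K(a,·)` is a nondecreasing function of
`a > max(a*_K, 1)`, and it tends to `2` as `a → ∞`; here
`a*_K = exp(1 + ξ_K′(0)/ξ_K(0))` with `ξ_K(s) = s(s-1)Λ_K(s)` extended to an entire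
function. -/
theorem phiK_real_zero_monotone_tendsto_two (K : Type*) [Field K] [NumberField K]
    (hdeg : Module.finrank ℚ K = 2)
    (himag : ∀ v : NumberField.InfinitePlace K, v.IsComplex)
    (hclass : NumberField.classNumber K = 1)
    (ΛK : ℂ → ℂ) (hΛ : IsCompletedDedekindZeta K ΛK)
    (ξK : ℂ → ℂ) (hξdiff : Differentiable ℂ ξK)
    (hξeq : ∀ s : ℂ, s ≠ 0 → s ≠ 1 → ξK s = s * (s - 1) * ΛK s)
    (r : ℝ) (hr : (r : ℂ) = deriv ξK 0 / ξK 0) :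
    (∀ a a' : ℝ, max (Real.exp (1 + r)) 1 < a → a ≤ a' → ∀ ρ ρ' : ℝ,
      ρ ∈ Set.Ioo (1 : ℝ) 2 → ρ' ∈ Set.Ioo (1 : ℝ) 2 →
      phiK ΛK a ρ = 0 → phiK ΛK a' ρ' = 0 → ρ ≤ ρ') ∧
    (∀ ε : ℝ, 0 < ε → ∃ A : ℝ, max (Real.exp (1 + r)) 1 < A ∧ ∀ a : ℝ, A < a →
      ∀ ρ : ℝ, ρ ∈ Set.Ioo (1 : ℝ) 2 → phiK ΛK a ρ = 0 → 2 - ε < ρ) := by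
  obtain ⟨B, hBd, hBeq, hB⟩ := hΛ.exists_xi_ratio hdeg himag hclass hξdiff hξeq
  have hBzero : ∀ a : ℝ, 0 < a → ∀ ρ : ℝ, ρ ∈ Set.Ioo (1 : ℝ) 2 → phiK ΛK a ρ = 0 →
      B ((ρ - 1 : ℝ) : ℂ) =
        (a ^ (2 * (ρ - 1)) * ((1 - (ρ - 1)) / (1 + (ρ - 1))) : ℝ) := by
    intro a ha ρ hρ hφ
    have ht : ρ - 1 ∈ Set.Ioo (0 : ℝ) 1 := ⟨by linarith [hρ.1], by linarith [hρ.2]⟩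
    rw [hBeq _ (by rw [ofReal_re]; exact ht.1)]
    refine IsCompletedDedekindZeta.ratio_eq_of_phiK_eq_zero hξeq ha ht
      (hΛ.xi_ne_zero hξdiff hξeq ?_) (by rwa [add_sub_cancel])
    rw [add_re, one_re, ofReal_re]
    linarith [ht.1]
  constructor
  · intro a a' ha haa' ρ ρ' hρ hρ' hφ hφ'
    have ha1 : 1 < a := (le_max_right _ _).trans_lt ha
    have hB1 : B 1 ≠ 0 := by
      rw [hBeq 1 (by simp)]
      exact div_ne_zero (hΛ.xi_one_ne_zero hξdiff hξeq)
        (hΛ.xi_ne_zero hξdiff hξeq (by rw [add_re, one_re]; norm_num))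
    have := le_of_halfPlane_contraction hBd hB hB1 ha1 haa'
      (t := ρ - 1) (t' := ρ' - 1) ⟨by linarith [hρ.1], by linarith [hρ.2]⟩
      ⟨by linarith [hρ'.1], by linarith [hρ'.2]⟩ (hBzero a (by linarith) ρ hρ hφ)
      (hBzero a' (by linarith) ρ' hρ' hφ')
    linarith
  · intro ε hε
    refine ⟨max (Real.exp (1 / ε)) (max (Real.exp (1 + r)) 1) + 1,
      lt_of_le_of_lt (le_max_right _ _) (lt_add_one _), fun a ha ρ hρ hφ => ?_⟩
    have hmax := (lt_add_one _).trans ha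
    have ha1 : 1 < a := ((le_max_right _ _).trans (le_max_right _ _)).trans_lt hmax
    have haε : Real.exp (1 / ε) < a := (le_max_left _ _).trans_lt hmax
    have ht : ρ - 1 ∈ Set.Ioo (0 : ℝ) 1 := ⟨by linarith [hρ.1], by linarith [hρ.2]⟩
    by_contra! hle
    have h1 := hB ((ρ - 1 : ℝ) : ℂ) (by rw [ofReal_re]; exact ht.1)
    rw [hBzero a (by linarith) ρ hρ hφ, norm_real] at h1
    have h2 := le_exp_inv_of_rpow_mul_le_one (by linarith) ht ((le_abs_self _).trans h1)
    have h3 : Real.exp (1 / (1 - (ρ - 1))) ≤ Real.exp (1 / ε) :=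
      Real.exp_le_exp.2 (one_div_le_one_div_of_le hε (by linarith))
    linarith
end

section
/- For every prime number p and every real number a ≥ 1, the set of zeros off the critical line of the product F₊(a,·)·F₋(a,·) is either empty or consists of a pair of real zeros symmetric about 1/2: if S := { s ∈ ℂ : s ∉ {0, 1/2, 1}, Re(s) ≠ 1/2, F₊(a,s)·F₋(a,s) = 0 }, then either S = ∅ or S = {ρ, 1-ρ} for some ρ ∈ (1/2, 1); moreover, for every ε > 0 there exists A ≥ 1 such that for all a > A every such zero ρ ∈ (1/2, 1) satisfies ρ > 1 - ε. -/
open Complex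

/-- The function `F_ε(a,s) = a^s (p^s + ε) Λ(2s) + a^{1-s} (p^{1-s} + ε) Λ(2s-1)`
arising from the scattering determinant of the Hecke group `Γ₀(p)`, where `Λ` is the
completed Riemann zeta function. -/
noncomputable def heckeF (p : ℕ) (ε : ℂ) (a : ℝ) (s : ℂ) : ℂ :=
  (a : ℂ) ^ s * ((p : ℂ) ^ s + ε) * completedRiemannZeta (2 * s) +
    (a : ℂ) ^ (1 - s) * ((p : ℂ) ^ (1 - s) + ε) * completedRiemannZeta (2 * s - 1)

theorem riemannZeta₁_conj (s : ℂ) :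
    riemannZeta₁ ((starRingEnd ℂ) s) = (starRingEnd ℂ) (riemannZeta₁ s) := by
  rcases eq_or_ne s 1 with rfl | hs
  · simp
  · have h : (starRingEnd ℂ) s ≠ 1 := by
      intro h; apply hs; have := congrArg (starRingEnd ℂ) h; simpa using this
    have e : ∀ w : ℂ, w ≠ 1 → riemannZeta₁ w = (w - 1) * riemannZeta w := by
      intro w hw
      rw [riemannZeta_eq_inv_sub_mul hw, mul_inv_cancel_left₀ (sub_ne_zero.mpr hw)]
    rw [e _ h, e _ hs, riemannZeta_conj]
    simp

/-- The terms of the Euler–Maclaurin expansion of `(w - 1) ζ(w)`. -/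
noncomputable def zetaCorrection (n : ℕ) (w : ℂ) : ℂ :=
  (w - 1) * ((n + 1 : ℝ) : ℂ) ^ (-w) +
    (((n + 2 : ℝ) : ℂ) ^ (1 - w) - ((n + 1 : ℝ) : ℂ) ^ (1 - w))

theorem hasDerivAt_ofReal_cpow_real (r : ℂ) {x : ℝ} (hx : 0 < x) :
    HasDerivAt (fun y : ℝ ↦ (y : ℂ) ^ r) (r * (x : ℂ) ^ (r - 1)) x := by
  have := (hasDerivAt_id (x : ℂ)).cpow_const (c := r) (by simp [hx])
  simpa using this.comp_ofReal

theorem norm_cpow_neg_sub_cpow_neg_le {w : ℂ} (hw : 0 < w.re) {b x : ℝ} (hb : 0 < b)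
    (hx : b ≤ x) :
    ‖(x : ℂ) ^ (-w) - (b : ℂ) ^ (-w)‖ ≤ ‖w‖ * b ^ (-(w.re + 1)) * (x - b) := by
  refine norm_image_sub_le_of_norm_deriv_le_segment' (f := fun y : ℝ ↦ (y : ℂ) ^ (-w))
    (f' := fun y ↦ (-w) * (y : ℂ) ^ (-w - 1)) (b := x) ?_ ?_ x ⟨hx, le_rfl⟩
  · intro y hy
    exact (hasDerivAt_ofReal_cpow_real _ (hb.trans_le hy.1)).hasDerivWithinAt
  · intro y hy
    have hy0 : 0 < y := hb.trans_le hy.1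
    rw [norm_mul, norm_neg, Complex.norm_cpow_eq_rpow_re_of_pos hy0]
    gcongr
    have : (-w - 1).re = -(w.re + 1) := by simp; ring
    rw [this]
    exact Real.rpow_le_rpow_of_nonpos hb hy.1 (by linarith)

theorem norm_zetaCorrection_le (n : ℕ) {w : ℂ} (hw : 0 < w.re) :
    ‖zetaCorrection n w‖ ≤ ‖w - 1‖ * ‖w‖ * (n + 1 : ℝ) ^ (-(w.re + 1)) := by
  set b : ℝ := n + 1 with hb
  have hb0 : 0 < b := by positivity
  have key := norm_image_sub_le_of_norm_deriv_le_segment'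
    (f := fun y : ℝ ↦ (w - 1) * (b : ℂ) ^ (-w) * (y : ℂ) + (y : ℂ) ^ (1 - w))
    (f' := fun y ↦ (w - 1) * (b : ℂ) ^ (-w) * 1 + (1 - w) * (y : ℂ) ^ (1 - w - 1))
    (a := b) (b := b + 1) (C := ‖w - 1‖ * (‖w‖ * b ^ (-(w.re + 1)))) ?_ ?_ (b + 1)
      ⟨by linarith, le_rfl⟩
  · have e : zetaCorrection n w = (w - 1) * (b : ℂ) ^ (-w) * ((b + 1 : ℝ) : ℂ) +
        ((b + 1 : ℝ) : ℂ) ^ (1 - w) - ((w - 1) * (b : ℂ) ^ (-w) * (b : ℂ) + (b : ℂ) ^ (1 - w)) := by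
      have : (n + 2 : ℝ) = b + 1 := by rw [hb]; ring
      rw [zetaCorrection, this, ← hb]
      push_cast
      ring
    rw [e]
    refine key.trans_eq ?_
    ring
  · intro y hy
    have h1 : HasDerivAt (fun y : ℝ ↦ (y : ℂ)) 1 y := Complex.ofRealCLM.hasDerivAt
    exact ((h1.const_mul _).add
      (hasDerivAt_ofReal_cpow_real _ (hb0.trans_le hy.1))).hasDerivWithinAt
  · intro y hy
    have e : (w - 1) * (b : ℂ) ^ (-w) * 1 + (1 - w) * (y : ℂ) ^ (1 - w - 1) =
        -((w - 1) * ((y : ℂ) ^ (-w) - (b : ℂ) ^ (-w))) := by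
      rw [show 1 - w - 1 = -w by ring]; ring
    rw [e, norm_neg, norm_mul]
    gcongr
    refine (norm_cpow_neg_sub_cpow_neg_le hw hb0 hy.1).trans ?_
    refine mul_le_of_le_one_right (by positivity) ?_
    linarith [hy.2]

theorem hasSum_rpow_neg_le {σ : ℝ} (hσ : 0 < σ) :
    Summable (fun n : ℕ ↦ (n + 1 : ℝ) ^ (-(σ + 1))) ∧
      ∑' n : ℕ, (n + 1 : ℝ) ^ (-(σ + 1)) ≤ 1 + 1 / σ := by
  have e : (fun n : ℕ ↦ (n + 1 : ℝ) ^ (-(σ + 1))) = fun n : ℕ ↦ 1 / (n + 1 : ℝ) ^ (σ + 1) := by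
    funext n
    rw [Real.rpow_neg (by positivity), one_div]
  rw [e]
  constructor
  · have := (summable_nat_add_iff 1).mpr (Real.summable_one_div_nat_rpow.mpr (show 1 < σ + 1 by linarith))
    simpa using this
  · have h := ZetaAsymptotics.zeta_limit_aux1 (show 1 < σ + 1 by linarith)
    have h2 : 0 ≤ ZetaAsymptotics.termTSum (σ + 1) :=
      tsum_nonneg fun n ↦ ZetaAsymptotics.term_nonneg _ _
    have h3 : 0 ≤ (σ + 1) * ZetaAsymptotics.termTSum (σ + 1) := by positivity
    rw [add_sub_cancel_right] at h
    linarith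

theorem differentiableOn_tsum_zetaCorrection :
    DifferentiableOn ℂ (fun w ↦ ∑' n, zetaCorrection n w) {w | 0 < w.re} := by
  intro w hw
  have hw : 0 < w.re := hw
  set U : Set ℂ := {z | w.re / 2 < z.re} ∩ Metric.ball 0 (‖w‖ + 1)
  have hU : IsOpen U := (isOpen_lt continuous_const continuous_re).inter Metric.isOpen_ball
  have hwU : w ∈ U := ⟨by simp; linarith, by simp⟩
  have hd : DifferentiableOn ℂ (fun w ↦ ∑' n, zetaCorrection n w) U := by
    refine differentiableOn_tsum_of_summable_norm (u := fun n : ℕ ↦ (‖w‖ + 2) * (‖w‖ + 1) *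
      (n + 1 : ℝ) ^ (-(w.re / 2 + 1))) ((hasSum_rpow_neg_le (by linarith)).1.mul_left _) ?_ hU ?_
    · intro n z hz
      have h1 : ((n + 1 : ℝ) : ℂ) ≠ 0 := by
        rw [Complex.ofReal_ne_zero]; positivity
      have h2 : ((n + 2 : ℝ) : ℂ) ≠ 0 := by
        rw [Complex.ofReal_ne_zero]; positivity
      unfold zetaCorrection
      have d1 : DifferentiableAt ℂ (fun w : ℂ ↦ ((n + 1 : ℝ) : ℂ) ^ (-w)) z :=
        DifferentiableAt.const_cpow (by fun_prop) (Or.inl h1)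
      have d2 : DifferentiableAt ℂ (fun w : ℂ ↦ ((n + 1 : ℝ) : ℂ) ^ (1 - w)) z :=
        DifferentiableAt.const_cpow (by fun_prop) (Or.inl h1)
      have d3 : DifferentiableAt ℂ (fun w : ℂ ↦ ((n + 2 : ℝ) : ℂ) ^ (1 - w)) z :=
        DifferentiableAt.const_cpow (by fun_prop) (Or.inl h2)
      have d4 : DifferentiableAt ℂ (fun w : ℂ ↦ w - 1) z := by fun_prop
      exact ((d4.mul d1).add (d3.sub d2)).differentiableWithinAt
    · rintro n z ⟨hz1, hz2⟩
      have hz1 : w.re / 2 < z.re := hz1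
      have hz2 : ‖z‖ < ‖w‖ + 1 := by simpa using hz2
      refine (norm_zetaCorrection_le n (by linarith)).trans ?_
      have : ‖z - 1‖ ≤ ‖w‖ + 2 := (norm_sub_le _ _).trans (by simp; linarith)
      gcongr
      linarith
  exact (hd.differentiableAt (hU.mem_nhds hwU)).differentiableWithinAt

theorem tsum_zetaCorrection_of_one_lt_re {w : ℂ} (hw : 1 < w.re) :
    riemannZeta₁ w = 1 + ∑' n, zetaCorrection n w := by
  have hw1 : w ≠ 1 := by rintro rfl; simp at hw
  have hs : Summable fun n ↦ zetaCorrection n w :=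
    Summable.of_norm_bounded ((hasSum_rpow_neg_le (by linarith)).1.mul_left _)
      fun n ↦ norm_zetaCorrection_le n (by linarith)
  have hz : HasSum (fun n : ℕ ↦ (w - 1) * ((n + 1 : ℝ) : ℂ) ^ (-w)) (riemannZeta₁ w) := by
    have h1 : riemannZeta₁ w = (w - 1) * riemannZeta w := by
      rw [riemannZeta_eq_inv_sub_mul hw1, mul_inv_cancel_left₀ (sub_ne_zero.mpr hw1)]
    rw [h1, zeta_eq_tsum_one_div_nat_add_one_cpow hw]
    have h2 : (fun n : ℕ ↦ (w - 1) * ((n + 1 : ℝ) : ℂ) ^ (-w)) =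
        fun n : ℕ ↦ (w - 1) * (1 / (n + 1 : ℂ) ^ w) := by
      funext n
      rw [Complex.cpow_neg, one_div]
      push_cast
      rfl
    rw [h2]
    refine HasSum.mul_left _ (Summable.hasSum ?_)
    have := (summable_nat_add_iff 1).mpr (Complex.summable_one_div_nat_cpow.mpr hw)
    simpa using this
  have hdiff := hs.hasSum.sub hz
  have ht := hdiff.tendsto_sum_nat
  have e : ∀ N : ℕ, ∑ n ∈ Finset.range N,
      (zetaCorrection n w - (w - 1) * ((n + 1 : ℝ) : ℂ) ^ (-w)) = ((N + 1 : ℝ) : ℂ) ^ (1 - w) - 1 := by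
    intro N
    have := Finset.sum_range_sub (fun n : ℕ ↦ ((n + 1 : ℝ) : ℂ) ^ (1 - w)) N
    simp only [Nat.cast_zero, zero_add, Complex.ofReal_one, Complex.one_cpow] at this
    rw [← this]
    refine Finset.sum_congr rfl fun n _ ↦ ?_
    rw [zetaCorrection, add_sub_cancel_left]
    push_cast
    ring_nf
  simp only [e] at ht
  have hlim : Filter.Tendsto (fun N : ℕ ↦ ((N + 1 : ℝ) : ℂ) ^ (1 - w) - 1) Filter.atTop (nhds (0 - 1)) := by
    refine Filter.Tendsto.sub_const ?_ _
    rw [tendsto_zero_iff_norm_tendsto_zero]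
    have e2 : (fun N : ℕ ↦ ‖((N + 1 : ℝ) : ℂ) ^ (1 - w)‖) = fun N : ℕ ↦ (N + 1 : ℝ) ^ (-(w.re - 1)) := by
      funext N
      rw [Complex.norm_cpow_eq_rpow_re_of_pos (by positivity)]
      simp
    rw [e2]
    exact (tendsto_rpow_neg_atTop (by linarith)).comp
      (Filter.tendsto_atTop_add_const_right _ _ tendsto_natCast_atTop_atTop)
  have := tendsto_nhds_unique ht hlim
  linear_combination -this

theorem riemannZeta₁_eq_tsum_zetaCorrection {w : ℂ} (hw : 0 < w.re) :
    riemannZeta₁ w = 1 + ∑' n, zetaCorrection n w := by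
  have hopen : IsOpen {w : ℂ | 0 < w.re} := isOpen_lt continuous_const continuous_re
  have h1 : AnalyticOnNhd ℂ riemannZeta₁ {w | 0 < w.re} :=
    differentiable_riemannZeta₁.differentiableOn.analyticOnNhd hopen
  have h2 : AnalyticOnNhd ℂ (fun w ↦ 1 + ∑' n, zetaCorrection n w) {w | 0 < w.re} :=
    ((differentiableOn_const _).add differentiableOn_tsum_zetaCorrection).analyticOnNhd hopen
  refine h1.eqOn_of_preconnected_of_eventuallyEq h2 (convex_halfSpace_re_gt 0).isPreconnected
    (z₀ := 2) (by simp) ?_ hw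
  have : {w : ℂ | 1 < w.re} ∈ nhds (2 : ℂ) :=
    (isOpen_lt continuous_const continuous_re).mem_nhds (by simp)
  filter_upwards [this] with z hz using tsum_zetaCorrection_of_one_lt_re hz

theorem norm_riemannZeta₁_le {w : ℂ} (hw : 0 < w.re) :
    ‖riemannZeta₁ w‖ ≤ 1 + ‖w - 1‖ * ‖w‖ * (1 + 1 / w.re) := by
  rw [riemannZeta₁_eq_tsum_zetaCorrection hw]
  refine (norm_add_le _ _).trans ?_
  rw [norm_one]
  gcongr
  have hs := hasSum_rpow_neg_le hw
  refine (tsum_of_norm_bounded (hs.1.hasSum.mul_left (‖w - 1‖ * ‖w‖))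
    fun n ↦ norm_zetaCorrection_le n hw).trans ?_
  gcongr
  exact hs.2

theorem norm_inv_riemannZeta_le {w : ℂ} (hw : 1 < w.re) :
    ‖(riemannZeta w)⁻¹‖ ≤ 1 + 1 / (w.re - 1) := by
  have h := LSeries_one_mul_Lseries_moebius hw
  rw [LSeries_one_eq_riemannZeta hw] at h
  rw [← eq_inv_of_mul_eq_one_right h]
  have hs := hasSum_rpow_neg_le (show 0 < w.re - 1 by linarith)
  rw [sub_add_cancel] at hs
  have hs' : HasSum (fun n : ℕ ↦ if n = 0 then (0 : ℝ) else (n : ℝ) ^ (-w.re))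
      (∑' n : ℕ, (n + 1 : ℝ) ^ (-w.re)) := by
    rw [← hasSum_nat_add_iff' 1]
    simpa using hs.1.hasSum
  refine (tsum_of_norm_bounded hs' fun n ↦ ?_).trans hs.2
  rw [LSeries.norm_term_eq]
  split_ifs with hn
  · exact le_rfl
  · rw [Real.rpow_neg (by positivity), ← one_div]
    gcongr
    rw [Complex.norm_intCast]
    exact_mod_cast ArithmeticFunction.abs_moebius_le_one

theorem norm_betaIntegral_half_le {u : ℂ} (hu : 1 ≤ u.re) : ‖betaIntegral u (1 / 2)‖ ≤ 2 := by
  have hv : (0 : ℝ) < ((1 / 2 : ℂ)).re := by norm_num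
  have h1 : betaIntegral 1 (1 / 2) = 2 := by
    rw [← betaIntegral_symm, betaIntegral_eval_one_right hv]; norm_num
  have h2 : ‖betaIntegral u (1 / 2)‖ ≤ ∫ x : ℝ in 0..1, (1 - x) ^ (-(1 / 2) : ℝ) := by
    unfold betaIntegral
    have hi := (betaIntegral_convergent (u := 1) (v := 1 / 2) (by simp) hv).norm
    have hcong : ∀ x ∈ Set.Ioo (0 : ℝ) 1, ‖(x : ℂ) ^ ((1 : ℂ) - 1) * (1 - (x : ℂ)) ^ ((1 / 2 : ℂ) - 1)‖ =
      (1 - x) ^ (-(1 / 2) : ℝ) := by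
      intro x hx
      rw [sub_self, cpow_zero, one_mul, show (1 - (x : ℂ)) = ((1 - x : ℝ) : ℂ) by push_cast; rfl,
        norm_cpow_eq_rpow_re_of_pos (by linarith [hx.2])]
      norm_num
    refine intervalIntegral.norm_integral_le_of_norm_le zero_le_one ?_ ?_
    · have : ∀ᵐ x : ℝ, x ≠ 1 := by simp [MeasureTheory.ae_iff]
      filter_upwards [this] with x hx1 hx
      have hx' : x ∈ Set.Ioo (0 : ℝ) 1 := ⟨hx.1, lt_of_le_of_ne hx.2 hx1⟩
      rw [← hcong x hx', norm_mul, norm_mul]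
      gcongr
      rw [sub_self, cpow_zero, norm_one, norm_cpow_eq_rpow_re_of_pos hx.1]
      exact Real.rpow_le_one hx.1.le hx.2 (by simpa using hu)
    · refine hi.congr_ae ?_
      have : ∀ᵐ x : ℝ, x ≠ 1 := by simp [MeasureTheory.ae_iff]
      rw [Set.uIoc_of_le zero_le_one, Filter.EventuallyEq, MeasureTheory.ae_restrict_iff' measurableSet_Ioc]
      filter_upwards [this] with x hx1 hx
      exact hcong x ⟨hx.1, lt_of_le_of_ne hx.2 hx1⟩
  refine h2.trans ?_
  rw [intervalIntegral.integral_comp_sub_left (fun x : ℝ ↦ x ^ (-(1 / 2) : ℝ)) 1,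
    integral_rpow (by norm_num)]
  norm_num

/-- Riemann's entire function `w (w - 1) Λ(w)`. -/
noncomputable def xiEntire (w : ℂ) : ℂ := w * (w - 1) * completedRiemannZeta₀ w + 1

theorem differentiable_xiEntire : Differentiable ℂ xiEntire := by
  unfold xiEntire
  have := differentiable_completedZeta₀
  fun_prop

theorem xiEntire_one_sub (w : ℂ) : xiEntire (1 - w) = xiEntire w := by
  unfold xiEntire
  rw [completedRiemannZeta₀_one_sub]
  ring

theorem xiEntire_eq_mul_completedRiemannZeta {w : ℂ} (h0 : w ≠ 0) (h1 : w ≠ 1) :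
    xiEntire w = w * (w - 1) * completedRiemannZeta w := by
  have : 1 - w ≠ 0 := sub_ne_zero.mpr h1.symm
  rw [xiEntire, completedRiemannZeta_eq]
  field_simp
  ring

theorem xiEntire_eq_mul_riemannZeta₁ {w : ℂ} (hw : 0 < w.re) :
    xiEntire w = w * Gammaℝ w * riemannZeta₁ w := by
  have h0 : w ≠ 0 := by rintro rfl; simp at hw
  rcases eq_or_ne w 1 with rfl | h1
  · simp [xiEntire, Gammaℝ_one]
  · rw [xiEntire_eq_mul_completedRiemannZeta h0 h1,
      show riemannZeta₁ w = (w - 1) * riemannZeta w by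
        rw [riemannZeta_eq_inv_sub_mul h1, mul_inv_cancel_left₀ (sub_ne_zero.mpr h1)],
      riemannZeta_def_of_ne_zero h0]
    have := Gammaℝ_ne_zero_of_re_pos hw
    field_simp

theorem Gammaℝ_conj (s : ℂ) : Gammaℝ ((starRingEnd ℂ) s) = (starRingEnd ℂ) (Gammaℝ s) := by
  rw [Gammaℝ_def, Gammaℝ_def, map_mul, ← Gamma_conj]
  have : ((Real.pi : ℂ)).arg ≠ Real.pi := by
    rw [arg_ofReal_of_nonneg Real.pi_pos.le]; exact Real.pi_pos.ne
  have h2 : (starRingEnd ℂ) 2 = 2 := map_ofNat _ 2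
  rw [show -(starRingEnd ℂ) s / 2 = (starRingEnd ℂ) (-s / 2) by simp [h2], cpow_conj _ _ this]
  simp [h2]

theorem xiEntire_conj {w : ℂ} (hw : 0 < w.re) :
    xiEntire ((starRingEnd ℂ) w) = (starRingEnd ℂ) (xiEntire w) := by
  rw [xiEntire_eq_mul_riemannZeta₁ hw, xiEntire_eq_mul_riemannZeta₁ (by simpa using hw),
    Gammaℝ_conj, riemannZeta₁_conj]
  simp

theorem xiEntire_ne_zero {w : ℂ} (hw : 1 ≤ w.re) : xiEntire w ≠ 0 := by
  rcases eq_or_ne w 1 with rfl | h1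
  · simp [xiEntire]
  · have h0 : w ≠ 0 := by rintro rfl; simp at hw; linarith
    rw [xiEntire_eq_mul_riemannZeta₁ (by linarith)]
    refine mul_ne_zero (mul_ne_zero h0 (Gammaℝ_ne_zero_of_re_pos (by linarith))) ?_
    intro h
    apply riemannZeta_ne_zero_of_one_le_re hw
    rw [riemannZeta_eq_inv_sub_mul h1, h, mul_zero]

open scoped ComplexOrder in
theorem xiEntire_ofReal_pos {x : ℝ} (hx : 1 < x) : ∃ r : ℝ, 0 < r ∧ xiEntire x = r := by
  have h1 := riemannZeta_pos_of_one_lt hx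
  obtain ⟨hr, him⟩ := Complex.pos_iff.mp h1
  set r : ℝ := (riemannZeta x).re
  have hr' : (r : ℂ) = riemannZeta x := Complex.ext (by simp [r]) (by simpa using him)
  refine ⟨x * (Real.pi ^ (-x / 2) * Real.Gamma (x / 2)) * ((x - 1) * r), ?_, ?_⟩
  · have := Real.Gamma_pos_of_pos (show 0 < x / 2 by linarith)
    have : 0 < x - 1 := by linarith
    positivity
  · have hx1 : (x : ℂ) ≠ 1 := by exact_mod_cast hx.ne'
    rw [xiEntire_eq_mul_riemannZeta₁ (by simp; linarith),
      show riemannZeta₁ x = (x - 1) * riemannZeta x by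
        rw [riemannZeta_eq_inv_sub_mul hx1, mul_inv_cancel_left₀ (sub_ne_zero.mpr hx1)], ← hr',
      Gammaℝ_def]
    push_cast
    rw [← Complex.Gamma_ofReal, Complex.ofReal_cpow Real.pi_pos.le]
    push_cast
    rfl

theorem Gammaℝ_two_mul_div {z : ℂ} (hz : 0 < z.re) :
    Gammaℝ (2 * z) / Gammaℝ (2 * z + 1) = (z + 1 / 2) / z * betaIntegral (z + 1) (1 / 2) := by
  have hz0 : z ≠ 0 := by rintro rfl; simp at hz
  have hz2 : 0 < (z + 1 / 2).re := by simp; linarith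
  have hz3 : z + 1 / 2 ≠ 0 := by intro h; rw [h] at hz2; simp at hz2
  have hG := Gamma_ne_zero_of_re_pos hz2
  have hpi : (Real.pi : ℂ) ≠ 0 := by exact_mod_cast Real.pi_ne_zero
  have hp := Gamma_mul_Gamma_eq_betaIntegral (s := z + 1) (t := 1 / 2) (by simp; linarith) (by norm_num)
  rw [Gamma_add_one _ hz0, Complex.Gamma_one_half_eq,
    show z + 1 + 1 / 2 = (z + 1 / 2) + 1 by ring, Gamma_add_one _ hz3] at hp
  rw [Gammaℝ_def, Gammaℝ_def, show 2 * z / 2 = z by ring, show (2 * z + 1) / 2 = z + 1 / 2 by ring,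
    show -(2 * z) / 2 = -(2 * z + 1) / 2 + 1 / 2 by ring, cpow_add _ _ hpi]
  have hpp : (Real.pi : ℂ) ^ (-(2 * z + 1) / 2) ≠ 0 := by simp [hpi]
  generalize Gamma (z + 1 / 2) = G at *
  generalize (Real.pi : ℂ) ^ (-(2 * z + 1) / 2) = P at *
  generalize (Real.pi : ℂ) ^ (1 / 2 : ℂ) = R at *
  generalize betaIntegral (z + 1) (1 / 2) = B at *
  field_simp
  linear_combination 2 * hp

theorem eqOn_id_of_two_fixed_points {T : ℂ → ℂ}
    (hd : DifferentiableOn ℂ T {u | 0 < u.re})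
    (hm : ∀ u : ℂ, 0 < u.re → 0 < (T u).re)
    {b c : ℂ} (hb : 0 < b.re) (hc : 0 < c.re) (hTb : T b = b) (hTc : T c = c) (hbc : b ≠ c) :
    ∀ u : ℂ, 0 < u.re → T u = u := by
  set φ : ℂ → ℂ := fun u ↦ (u - b) / (u + (starRingEnd ℂ) b) with hφ
  set ψ : ℂ → ℂ := fun z ↦ (b + (starRingEnd ℂ) b * z) / (1 - z) with hψ
  have hden : ∀ u : ℂ, 0 < u.re → u + (starRingEnd ℂ) b ≠ 0 := by
    intro u hu h
    have := congrArg Complex.re h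
    simp at this
    linarith
  have hz1 : ∀ z : ℂ, ‖z‖ < 1 → 1 - z ≠ 0 := by
    intro z hz h
    rw [← sub_eq_zero.mp h] at hz
    simp at hz
  have hbb : b + (starRingEnd ℂ) b ≠ 0 := hden b hb
  have hφlt : ∀ u : ℂ, 0 < u.re → ‖φ u‖ < 1 := by
    intro u hu
    rw [hφ]
    simp only [norm_div]
    rw [div_lt_one (norm_pos_iff.mpr (hden u hu)), ← sq_lt_sq₀ (norm_nonneg _) (norm_nonneg _),
      Complex.sq_norm, Complex.sq_norm, Complex.normSq_apply, Complex.normSq_apply]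
    simp
    nlinarith [mul_pos hu hb]
  have hψre : ∀ z : ℂ, ‖z‖ < 1 → 0 < (ψ z).re := by
    intro z hz
    have h1 : ψ z = (b + (starRingEnd ℂ) b * z) * (starRingEnd ℂ) (1 - z) / (normSq (1 - z) : ℂ) := by
      rw [hψ, Complex.normSq_eq_conj_mul_self, mul_comm ((starRingEnd ℂ) (1 - z)),
        mul_div_mul_right]
      exact (map_ne_zero _).mpr (hz1 z hz)
    rw [h1, Complex.div_ofReal_re]
    refine div_pos ?_ (Complex.normSq_pos.mpr (hz1 z hz))
    have h2 : z.re * z.re + z.im * z.im < 1 := by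
      rw [← Complex.normSq_apply, ← Complex.sq_norm]
      nlinarith [norm_nonneg z]
    simp
    nlinarith
  have hφψ : ∀ z : ℂ, ‖z‖ < 1 → φ (ψ z) = z := by
    intro z hz
    have := hz1 z hz
    have h2 := hden _ (hψre z hz)
    simp only [hφ] at *
    rw [div_eq_iff h2]
    simp only [hψ]
    field_simp
    ring
  have hψφ : ∀ u : ℂ, 0 < u.re → ψ (φ u) = u := by
    intro u hu
    have h1 := hden u hu
    have h2 := hz1 _ (hφlt u hu)
    simp only [hψ]
    rw [div_eq_iff h2]
    simp only [hφ]
    field_simp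
    ring
  have hφd : DifferentiableOn ℂ φ {u | 0 < u.re} := by
    intro u hu
    have := hden u hu
    have d1 : DifferentiableAt ℂ (fun u ↦ u - b) u := by fun_prop
    have d2 : DifferentiableAt ℂ (fun u ↦ u + (starRingEnd ℂ) b) u := by fun_prop
    exact (d1.div d2 this).differentiableWithinAt
  have hψd : DifferentiableOn ℂ ψ (Metric.ball 0 1) := by
    intro z hz
    have := hz1 z (by simpa using hz)
    exact (DifferentiableAt.div (by fun_prop) (by fun_prop) this).differentiableWithinAt
  set g : ℂ → ℂ := fun z ↦ φ (T (ψ z)) with hg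
  have hψm : Set.MapsTo ψ (Metric.ball 0 1) {u | 0 < u.re} := fun z hz ↦ hψre z (by simpa using hz)
  have hgd : DifferentiableOn ℂ g (Metric.ball 0 1) :=
    hφd.comp (hd.comp hψd hψm) (fun z hz ↦ hm _ (hψm hz))
  have hg0 : g 0 = 0 := by simp [hg, hψ, hTb, hφ]
  have hgm : Set.MapsTo g (Metric.ball 0 1) (Metric.closedBall (g 0) 1) := by
    intro z hz
    simpa [hg0] using (hφlt _ (hm _ (hψm hz))).le
  have hw : φ c ∈ Metric.ball (0 : ℂ) 1 := by simpa using hφlt c hc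
  have hgw : g (φ c) = φ c := by simp only [hg]; rw [hψφ c hc, hTc]
  have hw0 : φ c ≠ 0 := div_ne_zero (sub_ne_zero.mpr hbc.symm) (hden c hc)
  have hds : dslope g 0 (φ c) = 1 := by
    rw [dslope_of_ne _ hw0, slope_def_field, hg0, hgw, sub_zero, div_self hw0]
  have haff := affine_of_mapsTo_ball_of_norm_dslope_eq_div hgd hgm hw (by simp [hds])
  intro u hu
  have h3 := haff (show φ u ∈ Metric.ball (0 : ℂ) 1 by simpa using hφlt u hu)
  rw [hds, hg0] at h3
  simp only [hg, hψφ u hu, sub_zero, zero_add, smul_eq_mul, mul_one] at h3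
  have h4 := congrArg ψ h3
  simpa [hψφ _ (hm u hu), hψφ u hu] using h4

theorem norm_riemannZeta_le {w : ℂ} (hw : 1 < w.re) :
    ‖riemannZeta w‖ ≤ 1 + 1 / (w.re - 1) := by
  rw [zeta_eq_tsum_one_div_nat_add_one_cpow hw]
  have hs := hasSum_rpow_neg_le (show 0 < w.re - 1 by linarith)
  rw [sub_add_cancel] at hs
  refine (tsum_of_norm_bounded hs.1.hasSum fun n ↦ ?_).trans hs.2
  rw [one_div, ← cpow_neg, show ((n : ℂ) + 1) = ((n + 1 : ℝ) : ℂ) by push_cast; rfl,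
    norm_cpow_eq_rpow_re_of_pos (by positivity), neg_re]

/-- The ratio of values of `xiEntire` at `2 z` and `2 z + 1`. -/
noncomputable def xiRatio (z : ℂ) : ℂ := xiEntire (2 * z) / xiEntire (2 * z + 1)

theorem xiRatio_eq {z : ℂ} (hz : 0 < z.re) :
    xiRatio z = (2 * z)⁻¹ * betaIntegral (z + 1) (1 / 2) *
      riemannZeta₁ (2 * z) * (riemannZeta (2 * z + 1))⁻¹ := by
  have hz0 : z ≠ 0 := by rintro rfl; simp at hz
  have h2 : 2 * z + 1 ≠ 0 := by
    intro h; have := congrArg Complex.re h; simp at this; linarith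
  have hG : Gammaℝ (2 * z + 1) ≠ 0 := Gammaℝ_ne_zero_of_re_pos (by simp; linarith)
  have hζ : riemannZeta (2 * z + 1) ≠ 0 := riemannZeta_ne_zero_of_one_le_re (by simp; linarith)
  have h21 : 2 * z + 1 ≠ 1 := by simpa using hz0
  have h3 := Gammaℝ_two_mul_div hz
  rw [div_eq_iff hG] at h3
  rw [xiRatio, xiEntire_eq_mul_riemannZeta₁ (by simpa using hz),
    xiEntire_eq_mul_riemannZeta₁ (by simp; linarith), h3,
    show riemannZeta₁ (2 * z + 1) = (2 * z + 1 - 1) * riemannZeta (2 * z + 1) by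
      rw [riemannZeta_eq_inv_sub_mul h21, mul_inv_cancel_left₀ (sub_ne_zero.mpr h21)],
    add_sub_cancel_right]
  field_simp

theorem norm_xiRatio_le {z : ℂ} (hz : 0 < z.re) :
    ‖xiRatio z‖ ≤ (5 + 4 * ‖z‖) * (1 + 1 / z.re) ^ 2 := by
  have hz0 : z ≠ 0 := by rintro rfl; simp at hz
  have hn : 0 < ‖z‖ := norm_pos_iff.mpr hz0
  have hzn : z.re ≤ ‖z‖ := (le_abs_self _).trans (abs_re_le_norm z)
  have h1 := norm_betaIntegral_half_le (u := z + 1) (by simp; linarith)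
  have h2 := norm_riemannZeta₁_le (w := 2 * z) (by simpa using hz)
  have h3 := norm_inv_riemannZeta_le (w := 2 * z + 1) (by simp; linarith)
  have e1 : (2 * z).re = 2 * z.re := by simp
  have e2 : (2 * z + 1).re = 2 * z.re + 1 := by simp
  rw [e1] at h2
  rw [e2, add_sub_cancel_right] at h3
  have h4 : ‖2 * z - 1‖ ≤ 2 * ‖z‖ + 1 := (norm_sub_le _ _).trans (by simp)
  have h5 : 1 / (2 * z.re) ≤ 1 / z.re := by gcongr; linarith
  have h6 : 1 / ‖z‖ ≤ 1 / z.re := by gcongr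
  set q := 1 / z.re
  have hq : 0 < q := by positivity
  rw [xiRatio_eq hz, norm_mul, norm_mul, norm_mul, norm_inv, norm_mul, Complex.norm_ofNat]
  rw [norm_mul, Complex.norm_ofNat] at h2
  calc (2 * ‖z‖)⁻¹ * ‖betaIntegral (z + 1) (1 / 2)‖ * ‖riemannZeta₁ (2 * z)‖ *
        ‖(riemannZeta (2 * z + 1))⁻¹‖
      ≤ (2 * ‖z‖)⁻¹ * 2 * (1 + (2 * ‖z‖ + 1) * (2 * ‖z‖) * (1 + q)) * (1 + q) := by
        gcongr
        · exact h2.trans (by gcongr)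
        · exact h3.trans (by gcongr)
    _ = (1 / ‖z‖ + 2 * (2 * ‖z‖ + 1) * (1 + q)) * (1 + q) := by field_simp
    _ ≤ ((1 + q) + 2 * (2 * ‖z‖ + 1) * (1 + q)) * (1 + q) := by gcongr; linarith
    _ ≤ (5 + 4 * ‖z‖) * (1 + q) ^ 2 := by nlinarith [sq_nonneg (1 + q)]

theorem norm_xiRatio_le_of_one_le_re {z : ℂ} (hz : 1 ≤ z.re) : ‖xiRatio z‖ ≤ 12 := by
  have hz0 : z ≠ 0 := by rintro rfl; simp at hz; linarith
  have hn : 0 < ‖z‖ := norm_pos_iff.mpr hz0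
  have hzn : 1 ≤ ‖z‖ := hz.trans ((le_abs_self _).trans (abs_re_le_norm z))
  have h1 := norm_betaIntegral_half_le (u := z + 1) (by simp; linarith)
  have h2 := norm_riemannZeta_le (w := 2 * z) (by simp; linarith)
  have h3 := norm_inv_riemannZeta_le (w := 2 * z + 1) (by simp; linarith)
  have e1 : (2 * z).re = 2 * z.re := by simp
  have e2 : (2 * z + 1).re = 2 * z.re + 1 := by simp
  rw [e1] at h2
  rw [e2, add_sub_cancel_right] at h3
  have h2' : ‖riemannZeta (2 * z)‖ ≤ 2 := h2.trans (by
    have : 1 / (2 * z.re - 1) ≤ 1 / 1 := by gcongr; linarith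
    linarith)
  have h3' : ‖(riemannZeta (2 * z + 1))⁻¹‖ ≤ 2 := h3.trans (by
    have : 1 / (2 * z.re) ≤ 1 / 1 := by gcongr; linarith
    linarith)
  have h4 : ‖2 * z - 1‖ ≤ 3 * ‖z‖ := (norm_sub_le _ _).trans (by simp; linarith)
  have h21 : 2 * z ≠ 1 := by
    intro h; have := congrArg Complex.re h; simp at this; linarith
  rw [xiRatio_eq (by linarith),
    show riemannZeta₁ (2 * z) = (2 * z - 1) * riemannZeta (2 * z) by
      rw [riemannZeta_eq_inv_sub_mul h21, mul_inv_cancel_left₀ (sub_ne_zero.mpr h21)],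
    norm_mul, norm_mul, norm_mul, norm_mul, norm_inv, norm_mul, Complex.norm_ofNat]
  calc (2 * ‖z‖)⁻¹ * ‖betaIntegral (z + 1) (1 / 2)‖ * (‖2 * z - 1‖ * ‖riemannZeta (2 * z)‖) *
        ‖(riemannZeta (2 * z + 1))⁻¹‖
      ≤ (2 * ‖z‖)⁻¹ * 2 * ((3 * ‖z‖) * 2) * 2 := by gcongr
    _ = 12 := by field_simp; norm_num

theorem norm_xiRatio_of_re_eq_zero {z : ℂ} (hz : z.re = 0) : ‖xiRatio z‖ = 1 := by
  have h : xiEntire (2 * z) = (starRingEnd ℂ) (xiEntire (2 * z + 1)) := by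
    rw [← xiEntire_conj (by simp [hz]), ← xiEntire_one_sub]
    congr 1
    apply Complex.ext <;> simp [hz]
  rw [xiRatio, h, norm_div, RCLike.norm_conj, div_self]
  exact norm_ne_zero_iff.mpr (xiEntire_ne_zero (by simp [hz]))

theorem differentiableAt_xiRatio {z : ℂ} (hz : 0 ≤ z.re) : DifferentiableAt ℂ xiRatio z := by
  have h := differentiable_xiEntire
  have d1 : DifferentiableAt ℂ (fun z ↦ xiEntire (2 * z)) z := by fun_prop
  have d2 : DifferentiableAt ℂ (fun z ↦ xiEntire (2 * z + 1)) z := by fun_prop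
  exact d1.div d2 (xiEntire_ne_zero (by simpa using hz))

/-- Polynomial growth of `xiRatio` in the strip `0 < re z ≤ 1`, by the maximum principle on a
square with the singularities of the bound at the boundary killed by double zeros at the corners. -/
theorem norm_xiRatio_le_of_re_le_one {z : ℂ} (hz0 : 0 ≤ z.re) (hz1 : z.re ≤ 1) :
    ‖xiRatio z‖ ≤ 100 * (17 + 4 * ‖z‖) := by
  set M : ℝ := 100 * (17 + 4 * ‖z‖) with hM
  set y := z.im with hy
  set c₁ : ℂ := ⟨0, y - 1⟩ with hc₁
  set c₂ : ℂ := ⟨0, y + 1⟩ with hc₂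
  set g : ℂ → ℂ := fun w ↦ xiRatio w * (w - c₁) ^ 2 * (w - c₂) ^ 2 with hg
  set U : Set ℂ := Set.Ioo (0 : ℝ) 1 ×ℂ Set.Ioo (y - 1) (y + 1) with hU
  have hcl : closure U = Set.Icc (0 : ℝ) 1 ×ℂ Set.Icc (y - 1) (y + 1) := by
    rw [hU, closure_reProdIm, closure_Ioo (by norm_num), closure_Ioo (by linarith)]
  have hb : Bornology.IsBounded U := (Metric.isBounded_Ioo _ _).reProdIm (Metric.isBounded_Ioo _ _)
  have hd : DiffContOnCl ℂ g U := by
    apply DifferentiableOn.diffContOnCl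
    rw [hcl]
    intro w hw
    have h1 := differentiableAt_xiRatio (z := w) hw.1.1
    exact DifferentiableAt.differentiableWithinAt (by fun_prop)
  have sqn : ∀ (w : ℂ) (t : ℝ), ‖w - ⟨0, t⟩‖ ^ 2 = w.re ^ 2 + (w.im - t) ^ 2 := by
    intro w t
    rw [Complex.sq_norm, Complex.normSq_apply]
    simp
    ring
  have hfront : ∀ w ∈ frontier U, ‖g w‖ ≤ M := by
    intro w hw
    have hwc : w ∈ closure U := frontier_subset_closure hw
    have hwU : w ∉ U := by
      rw [frontier, IsOpen.interior_eq (isOpen_Ioo.reProdIm isOpen_Ioo)] at hw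
      exact hw.2
    rw [hcl] at hwc
    obtain ⟨⟨hx0, hx1⟩, hy0, hy1⟩ := hwc
    have hgn : ‖g w‖ = ‖xiRatio w‖ * (w.re ^ 2 + (w.im - (y - 1)) ^ 2) *
        (w.re ^ 2 + (w.im - (y + 1)) ^ 2) := by
      rw [hg]
      simp only [norm_mul, norm_pow]
      rw [hc₁, hc₂, sqn, sqn]
    have hw5 : w.re ^ 2 ≤ 1 := by nlinarith
    have hA : w.re ^ 2 + (w.im - (y - 1)) ^ 2 ≤ 5 := by nlinarith
    have hB : w.re ^ 2 + (w.im - (y + 1)) ^ 2 ≤ 5 := by nlinarith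
    have hA0 : 0 ≤ w.re ^ 2 + (w.im - (y - 1)) ^ 2 := by positivity
    have hB0 : 0 ≤ w.re ^ 2 + (w.im - (y + 1)) ^ 2 := by positivity
    have hwn : ‖w‖ ≤ ‖z‖ + 3 := by
      have : ‖w - z‖ ≤ 3 := by
        refine (Complex.norm_le_abs_re_add_abs_im _).trans ?_
        have i1 : |(w - z).re| ≤ 1 := by rw [sub_re, abs_le]; constructor <;> linarith
        have i2 : |(w - z).im| ≤ 1 := by rw [sub_im, abs_le]; constructor <;> linarith
        linarith
      calc ‖w‖ = ‖z + (w - z)‖ := by congr 1; ring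
        _ ≤ _ := (norm_add_le _ _).trans (by linarith)
    rcases hx0.eq_or_lt with hx | hx
    · rw [hgn, norm_xiRatio_of_re_eq_zero hx.symm, one_mul]
      calc _ ≤ (5 : ℝ) * 5 := by gcongr
        _ ≤ M := by rw [hM]; nlinarith [norm_nonneg z]
    · have hf := norm_xiRatio_le hx
      have hx2 : (1 + 1 / w.re) ^ 2 * w.re ^ 2 ≤ 4 := by
        rw [← mul_pow, add_mul, one_div, inv_mul_cancel₀ hx.ne']
        nlinarith
      have hcase : w.re = 1 ∨ w.im = y - 1 ∨ w.im = y + 1 := by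
        by_contra! hcon
        exact hwU ⟨⟨hx, lt_of_le_of_ne hx1 hcon.1⟩, lt_of_le_of_ne hy0 hcon.2.1.symm,
          lt_of_le_of_ne hy1 hcon.2.2⟩
      have hmain : ‖xiRatio w‖ * w.re ^ 2 ≤ (5 + 4 * ‖w‖) * 4 := by
        calc _ ≤ (5 + 4 * ‖w‖) * (1 + 1 / w.re) ^ 2 * w.re ^ 2 := by gcongr
          _ = (5 + 4 * ‖w‖) * ((1 + 1 / w.re) ^ 2 * w.re ^ 2) := by ring
          _ ≤ _ := by gcongr
      have hfin : (5 + 4 * ‖w‖) * 4 * 25 ≤ M := by rw [hM]; linarith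
      rw [hgn]
      rcases hcase with h | h | h
      · rw [h, one_pow, mul_one] at hmain
        calc _ ≤ (5 + 4 * ‖w‖) * 4 * 5 * 5 := by gcongr
          _ ≤ M := by linarith
      · rw [h] at hB ⊢
        rw [sub_self, zero_pow two_ne_zero, add_zero]
        calc _ ≤ (5 + 4 * ‖w‖) * 4 * 5 := by gcongr
          _ ≤ M := by linarith [norm_nonneg w]
      · rw [h] at hA ⊢
        rw [sub_self, zero_pow two_ne_zero, add_zero, mul_right_comm]
        calc _ ≤ (5 + 4 * ‖w‖) * 4 * 5 := by gcongr
          _ ≤ M := by linarith [norm_nonneg w]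
  have hzcl : z ∈ closure U := by
    rw [hcl]; exact ⟨⟨hz0, hz1⟩, by linarith, by linarith⟩
  have hres := norm_le_of_forall_mem_frontier_norm_le hb hd hfront hzcl
  refine le_trans ?_ hres
  simp only [hg, norm_mul, norm_pow]
  rw [hc₁, hc₂, sqn, sqn, mul_assoc]
  refine le_mul_of_one_le_right (norm_nonneg _) ?_
  have h1 : 1 ≤ z.re ^ 2 + (z.im - (y - 1)) ^ 2 := by nlinarith
  have h2 : 1 ≤ z.re ^ 2 + (z.im - (y + 1)) ^ 2 := by nlinarith
  exact one_le_mul_of_one_le_of_one_le h1 h2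

theorem norm_xiRatio_le_one {z : ℂ} (hz : 0 ≤ z.re) : ‖xiRatio z‖ ≤ 1 := by
  have hgrow : ∀ z : ℂ, 0 < z.re → ‖xiRatio z‖ ≤ 1700 * Real.exp (1 * ‖z‖ ^ (1 : ℝ)) := by
    intro z hz
    have h1 : ‖xiRatio z‖ ≤ 100 * (17 + 4 * ‖z‖) := by
      rcases le_total z.re 1 with h | h
      · exact norm_xiRatio_le_of_re_le_one hz.le h
      · exact (norm_xiRatio_le_of_one_le_re h).trans (by linarith [norm_nonneg z])
    refine h1.trans ?_
    rw [Real.rpow_one, one_mul]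
    linarith [Real.add_one_le_exp ‖z‖, norm_nonneg z]
  refine PhragmenLindelof.right_half_plane_of_bounded_on_real ?_ ⟨1, by norm_num, 1, ?_⟩ ?_ ?_ hz
  · apply DifferentiableOn.diffContOnCl
    rw [Complex.closure_setOfPred_lt_re]
    intro w hw
    exact (differentiableAt_xiRatio hw).differentiableWithinAt
  · refine Asymptotics.IsBigO.of_bound 1700 ?_
    refine Filter.Eventually.filter_mono inf_le_right ?_
    rw [Filter.eventually_principal]
    intro w hw
    rw [Real.norm_of_nonneg (Real.exp_pos _).le]
    exact hgrow w hw
  · refine Filter.isBoundedUnder_of_eventually_le (a := 12) ?_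
    filter_upwards [Filter.eventually_ge_atTop 1] with x hx
    exact norm_xiRatio_le_of_one_le_re (by simpa using hx)
  · intro x
    exact (norm_xiRatio_of_re_eq_zero (by simp)).le

theorem norm_xiEntire_two_mul_sub_one_le {s : ℂ} (hs : 1 / 2 ≤ s.re) :
    ‖xiEntire (2 * s - 1)‖ ≤ ‖xiEntire (2 * s)‖ := by
  have h := norm_xiRatio_le_one (z := s - 1 / 2) (by simp at hs ⊢; linarith)
  rw [xiRatio, show 2 * (s - 1 / 2) = 2 * s - 1 by ring, sub_add_cancel, norm_div] at h
  refine (div_le_one (norm_pos_iff.mpr (xiEntire_ne_zero ?_))).mp h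
  simp at hs ⊢; linarith

theorem norm_div_add_lt_norm_add {q : ℝ} (hq : 1 < q) {ε z : ℂ} (hε : ε = 1 ∨ ε = -1)
    (hz : q < normSq z) : ‖(q : ℂ) / z + ε‖ < ‖z + ε‖ := by
  have hz0 : z ≠ 0 := by
    rintro rfl
    simp at hz
    linarith
  have hn : 0 < ‖z‖ := norm_pos_iff.mpr hz0
  have e : (q : ℂ) / z + ε = (q + ε * z) / z := by field_simp
  rw [e, norm_div, div_lt_iff₀ hn, ← norm_mul, ← sq_lt_sq₀ (norm_nonneg _) (norm_nonneg _),
    ← normSq_eq_norm_sq, ← normSq_eq_norm_sq, normSq_mul]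
  simp only [normSq_apply] at hz
  obtain rfl | rfl := hε
  · simp only [normSq_apply, add_re, mul_re, add_im, mul_im, one_re, one_im, ofReal_re, ofReal_im]
    have h : 0 < z.re * z.re + z.im * z.im + q + 2 * z.re := by
      nlinarith [sq_nonneg (z.re + 1), sq_nonneg z.im]
    nlinarith [mul_pos (sub_pos.mpr hz) h]
  · simp only [normSq_apply, add_re, mul_re, add_im, mul_im, one_re, one_im, ofReal_re, ofReal_im,
      neg_re, neg_im]
    have h : 0 < z.re * z.re + z.im * z.im + q - 2 * z.re := by
      nlinarith [sq_nonneg (z.re - 1), sq_nonneg z.im]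
    nlinarith [mul_pos (sub_pos.mpr hz) h]

theorem norm_natCast_cpow_one_sub_add_lt {p : ℕ} (hp : 1 < p) {ε s : ℂ} (hε : ε = 1 ∨ ε = -1)
    (hs : 1 / 2 < s.re) : ‖(p : ℂ) ^ (1 - s) + ε‖ < ‖(p : ℂ) ^ s + ε‖ := by
  have hp0 : (p : ℂ) ≠ 0 := by exact_mod_cast (by lia : p ≠ 0)
  have hp1 : (1 : ℝ) < p := by exact_mod_cast hp
  rw [cpow_sub _ _ hp0, cpow_one]
  refine norm_div_add_lt_norm_add (q := p) hp1 hε ?_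
  rw [normSq_eq_norm_sq, norm_natCast_cpow_of_pos (by lia), ← Real.rpow_natCast,
    ← Real.rpow_mul (by positivity)]
  conv_lhs => rw [← Real.rpow_one (p : ℝ)]
  refine Real.rpow_lt_rpow_of_exponent_lt hp1 ?_
  push_cast
  linarith

/-- The entire function `a^s (p^s + ε) ξ(2 s)`, the numerator of the first term of `heckeF`. -/
noncomputable def heckeXi (p : ℕ) (ε : ℂ) (a : ℝ) (s : ℂ) : ℂ :=
  (a : ℂ) ^ s * ((p : ℂ) ^ s + ε) * xiEntire (2 * s)

section

variable {p : ℕ} {ε : ℂ} {a : ℝ} {s : ℂ}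

theorem heckeXi_one_sub : heckeXi p ε a (1 - s) =
    (a : ℂ) ^ (1 - s) * ((p : ℂ) ^ (1 - s) + ε) * xiEntire (2 * s - 1) := by
  rw [heckeXi, ← xiEntire_one_sub (2 * s - 1)]
  ring_nf

theorem differentiable_heckeXi (hp : 1 < p) (ha : 1 ≤ a) : Differentiable ℂ (heckeXi p ε a) := by
  have hp0 : (p : ℂ) ≠ 0 := by exact_mod_cast (by lia : p ≠ 0)
  have ha0 : (a : ℂ) ≠ 0 := by exact_mod_cast (by linarith : a ≠ 0)
  have hX := differentiable_xiEntire
  intro s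
  have h1 : DifferentiableAt ℂ (fun s : ℂ ↦ (a : ℂ) ^ s) s :=
    differentiableAt_id.const_cpow (Or.inl ha0)
  have h2 : DifferentiableAt ℂ (fun s : ℂ ↦ (p : ℂ) ^ s) s :=
    differentiableAt_id.const_cpow (Or.inl hp0)
  have h3 : DifferentiableAt ℂ (fun s : ℂ ↦ xiEntire (2 * s)) s :=
    (hX (2 * s)).comp s (by fun_prop)
  exact (h1.mul (h2.add_const ε)).mul h3

theorem heckeXi_ne_zero (hp : 1 < p) (hε : ε = 1 ∨ ε = -1) (ha : 1 ≤ a) (hs : 1 / 2 < s.re) :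
    heckeXi p ε a s ≠ 0 := by
  have ha0 : (a : ℂ) ≠ 0 := by exact_mod_cast (by linarith : a ≠ 0)
  refine mul_ne_zero (mul_ne_zero (by simp [cpow_eq_zero_iff, ha0]) ?_) (xiEntire_ne_zero ?_)
  · exact norm_pos_iff.mp
      ((norm_nonneg _).trans_lt (norm_natCast_cpow_one_sub_add_lt hp hε hs))
  · simp
    linarith

theorem norm_heckeXi_one_sub_mul_lt (hp : 1 < p) (hε : ε = 1 ∨ ε = -1) (ha : 1 ≤ a)
    (hs : 1 / 2 < s.re) :
    ‖heckeXi p ε a (1 - s)‖ * a ^ (2 * s.re - 1) < ‖heckeXi p ε a s‖ := by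
  have ha0 : 0 < a := by linarith
  have hX : 0 < ‖xiEntire (2 * s)‖ := norm_pos_iff.mpr (xiEntire_ne_zero (by simp; linarith))
  rw [heckeXi_one_sub, heckeXi, norm_mul, norm_mul, norm_mul, norm_mul,
    norm_cpow_eq_rpow_re_of_pos ha0, norm_cpow_eq_rpow_re_of_pos ha0]
  have e : a ^ s.re = a ^ (1 - s).re * a ^ (2 * s.re - 1) := by
    rw [← Real.rpow_add ha0]
    congr 1
    simp
    ring
  have h := mul_lt_mul_of_pos_right (norm_natCast_cpow_one_sub_add_lt hp hε hs) hX
  have h' := mul_le_mul_of_nonneg_left (norm_xiEntire_two_mul_sub_one_le hs.le)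
    (norm_nonneg ((p : ℂ) ^ (1 - s) + ε))
  have h3 := mul_lt_mul_of_pos_left (h'.trans_lt h) (Real.rpow_pos_of_pos ha0 s.re)
  rw [e] at h3 ⊢
  linarith

theorem norm_heckeXi_one_sub_lt (hp : 1 < p) (hε : ε = 1 ∨ ε = -1) (ha : 1 ≤ a)
    (hs : 1 / 2 < s.re) : ‖heckeXi p ε a (1 - s)‖ < ‖heckeXi p ε a s‖ := by
  refine lt_of_le_of_lt ?_ (norm_heckeXi_one_sub_mul_lt hp hε ha hs)
  exact le_mul_of_one_le_right (norm_nonneg _) (Real.one_le_rpow ha (by linarith))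

theorem norm_heckeXi_ratio_three (hp : 1 < p) (hε : ε = 1 ∨ ε = -1) (ha : 1 ≤ a) :
    3 * ‖heckeXi p ε a (1 - 3)‖ < 2 * ‖heckeXi p ε a 3‖ := by
  have ha0 : 0 < a := by linarith
  have hp2 : (2 : ℝ) ≤ p := by exact_mod_cast hp
  have hε1 : ‖ε‖ = 1 := by
    obtain rfl | rfl := hε <;> simp
  have hX : 0 < ‖xiEntire (2 * 3)‖ := norm_pos_iff.mpr (xiEntire_ne_zero (by norm_num))
  have hXle := norm_xiEntire_two_mul_sub_one_le (s := 3) (by norm_num)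
  have hA : a ^ (1 - 3 : ℝ) ≤ a ^ (3 : ℝ) := Real.rpow_le_rpow_of_exponent_le ha (by norm_num)
  have hP1 : ‖(p : ℂ) ^ (1 - 3 : ℂ) + ε‖ ≤ 2 := by
    refine (norm_add_le _ _).trans ?_
    rw [hε1, norm_natCast_cpow_of_pos (by lia)]
    have := Real.rpow_le_one_of_one_le_of_nonpos (x := p) (z := (1 - 3 : ℂ).re) (by linarith)
      (by norm_num)
    linarith
  have hP2 : 7 ≤ ‖(p : ℂ) ^ (3 : ℂ) + ε‖ := by
    have h := norm_sub_le_norm_add ((p : ℂ) ^ (3 : ℂ)) ε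
    rw [hε1, norm_natCast_cpow_of_pos (by lia)] at h
    have h8 : (8 : ℝ) ≤ (p : ℝ) ^ (3 : ℂ).re := by
      have : (2 : ℝ) ^ 3 ≤ (p : ℝ) ^ 3 := by gcongr
      norm_num at this ⊢
      exact_mod_cast this
    linarith
  rw [heckeXi_one_sub, heckeXi, norm_mul, norm_mul, norm_mul, norm_mul,
    norm_cpow_eq_rpow_re_of_pos ha0, norm_cpow_eq_rpow_re_of_pos ha0]
  have e1 : (1 - 3 : ℂ).re = (1 - 3 : ℝ) := by simp
  have e2 : (3 : ℂ).re = (3 : ℝ) := by simp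
  rw [e1, e2]
  have hpos : 0 < a ^ (3 : ℝ) * ‖xiEntire (2 * 3)‖ := mul_pos (Real.rpow_pos_of_pos ha0 _) hX
  calc 3 * (a ^ (1 - 3 : ℝ) * ‖(p : ℂ) ^ (1 - 3 : ℂ) + ε‖ * ‖xiEntire (2 * 3 - 1)‖)
      ≤ 3 * (a ^ (3 : ℝ) * 2 * ‖xiEntire (2 * 3)‖) := by gcongr
    _ < 2 * (a ^ (3 : ℝ) * 7 * ‖xiEntire (2 * 3)‖) := by linarith
    _ ≤ _ := by gcongr

theorem heckeF_eq_zero_iff (h0 : s ≠ 0) (h1 : s ≠ 1) (h2 : s ≠ 1 / 2) :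
    heckeF p ε a s = 0 ↔ (s - 1) * heckeXi p ε a s + s * heckeXi p ε a (1 - s) = 0 := by
  have hd : 2 * s - 1 ≠ 0 := fun h ↦ h2 (by linear_combination h / 2)
  have hs1 : s - 1 ≠ 0 := sub_ne_zero.mpr h1
  have e : (s - 1) * heckeXi p ε a s + s * heckeXi p ε a (1 - s) =
      2 * s * (2 * s - 1) * (s - 1) * heckeF p ε a s := by
    rw [heckeXi_one_sub, heckeXi, heckeF,
      xiEntire_eq_mul_completedRiemannZeta (w := 2 * s) (by simpa using h0)
        (fun h ↦ hd (by rw [h, sub_self])),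
      xiEntire_eq_mul_completedRiemannZeta (w := 2 * s - 1) hd
        (fun h ↦ hs1 (by linear_combination h / 2))]
    ring
  rw [e]
  simp [h0, hd, hs1]

theorem heckeF_one_sub : heckeF p ε a (1 - s) = heckeF p ε a s := by
  rw [heckeF, heckeF, ← completedRiemannZeta_one_sub (2 * s),
    ← completedRiemannZeta_one_sub (2 * s - 1)]
  ring_nf

theorem heckeXi_conj (ha : 1 ≤ a) (hε : ε = 1 ∨ ε = -1) (hs : 0 < s.re) :
    heckeXi p ε a ((starRingEnd ℂ) s) = (starRingEnd ℂ) (heckeXi p ε a s) := by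
  have hε' : (starRingEnd ℂ) ε = ε := by
    obtain rfl | rfl := hε <;> simp
  have h1 := cpow_conj (a : ℂ) s (by rw [arg_ofReal_of_nonneg (by linarith)]; exact Real.pi_pos.ne)
  have h2 := cpow_conj (p : ℂ) s (by rw [natCast_arg]; exact Real.pi_pos.ne)
  have h3 := xiEntire_conj (w := 2 * s) (by simpa using hs)
  simp only [conj_ofReal, conj_natCast, map_mul, map_ofNat] at h1 h2 h3
  rw [heckeXi, heckeXi, h1, h2, h3]
  simp [hε']

theorem heckeXi_one_sub_conj (ha : 1 ≤ a) (hε : ε = 1 ∨ ε = -1) (hs : 1 / 2 < s.re) :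
    heckeXi p ε a (1 - (starRingEnd ℂ) s) = (starRingEnd ℂ) (heckeXi p ε a (1 - s)) := by
  have hε' : (starRingEnd ℂ) ε = ε := by
    obtain rfl | rfl := hε <;> simp
  have h1 := cpow_conj (a : ℂ) (1 - s)
    (by rw [arg_ofReal_of_nonneg (by linarith)]; exact Real.pi_pos.ne)
  have h2 := cpow_conj (p : ℂ) (1 - s) (by rw [natCast_arg]; exact Real.pi_pos.ne)
  have h3 := xiEntire_conj (w := 2 * s - 1) (by simp; linarith)
  simp only [conj_ofReal, conj_natCast, map_mul, map_ofNat, map_sub, map_one] at h1 h2 h3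
  rw [heckeXi_one_sub, heckeXi_one_sub, h1, h2, h3]
  simp [hε']

theorem eq_of_heckeXi_eq_zero (hp : 1 < p) (hε : ε = 1 ∨ ε = -1) (ha : 1 ≤ a) {t : ℂ}
    (hs : 1 / 2 < s.re) (ht : 1 / 2 < t.re)
    (hs0 : (s - 1) * heckeXi p ε a s + s * heckeXi p ε a (1 - s) = 0)
    (ht0 : (t - 1) * heckeXi p ε a t + t * heckeXi p ε a (1 - t) = 0) : s = t := by
  by_contra hst
  have hne : ∀ {u : ℂ}, 0 < u.re →
      heckeXi p ε a (u + 1 / 2) + heckeXi p ε a (1 - (u + 1 / 2)) ≠ 0 := by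
    intro u hu h
    have := norm_heckeXi_one_sub_lt (s := u + 1 / 2) hp hε ha (by simpa using hu)
    rw [eq_neg_of_add_eq_zero_left h, norm_neg] at this
    exact this.false
  set T : ℂ → ℂ := fun u ↦ heckeXi p ε a (u + 1 / 2) /
    (heckeXi p ε a (u + 1 / 2) + heckeXi p ε a (1 - (u + 1 / 2))) - 1 / 2 with hT
  have hfix : ∀ {u : ℂ}, 0 < u.re → (T u = u ↔
      (u + 1 / 2 - 1) * heckeXi p ε a (u + 1 / 2) +
        (u + 1 / 2) * heckeXi p ε a (1 - (u + 1 / 2)) = 0) := by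
    intro u hu
    rw [hT]
    dsimp only
    rw [sub_eq_iff_eq_add, div_eq_iff (hne hu)]
    constructor <;> intro h <;> linear_combination -h
  have hX := differentiable_heckeXi (ε := ε) hp ha
  have hid := eqOn_id_of_two_fixed_points (T := T) (b := s - 1 / 2) (c := t - 1 / 2) ?_ ?_
    (by simp; linarith) (by simp; linarith)
    ((hfix (by simp; linarith)).mpr (by simpa using hs0))
    ((hfix (by simp; linarith)).mpr (by simpa using ht0)) (by simpa using hst)
  · have h := (hfix (u := 3 - 1 / 2) (by norm_num)).mp (hid _ (by norm_num))
    rw [sub_add_cancel] at h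
    have h' := congrArg norm (eq_neg_of_add_eq_zero_left h)
    rw [norm_neg, norm_mul, norm_mul] at h'
    norm_num at h'
    have := norm_heckeXi_ratio_three hp hε ha
    norm_num at this
    linarith
  · intro u hu
    have h1 : DifferentiableAt ℂ (fun u : ℂ ↦ heckeXi p ε a (u + 1 / 2)) u :=
      (hX _).comp u (by fun_prop)
    have h2 : DifferentiableAt ℂ (fun u : ℂ ↦ heckeXi p ε a (1 - (u + 1 / 2))) u :=
      (hX _).comp u (by fun_prop)
    exact ((h1.div (h1.add h2) (hne hu)).sub_const _).differentiableWithinAt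
  · intro u hu
    have h1 := norm_heckeXi_one_sub_lt (s := u + 1 / 2) hp hε ha (by simpa using hu)
    have h2 := hne hu
    set x := heckeXi p ε a (u + 1 / 2) with hx
    set y := heckeXi p ε a (1 - (u + 1 / 2)) with hy
    have e : T u = (x - y) / (2 * (x + y)) := by
      simp only [hT, ← hx, ← hy]
      field_simp
      ring
    have hn : 0 < normSq (2 * (x + y)) := normSq_pos.mpr (mul_ne_zero two_ne_zero h2)
    rw [e, div_re, ← add_div]
    refine div_pos ?_ hn
    rw [← sq_lt_sq₀ (norm_nonneg _) (norm_nonneg _), ← normSq_eq_norm_sq, ← normSq_eq_norm_sq,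
      normSq_apply, normSq_apply] at h1
    simp
    nlinarith

theorem heckeF_neg_one_ne_zero (hp : 1 < p) (ha : 1 ≤ a) (hs : 1 / 2 < s.re) (hs1 : s ≠ 1) :
    heckeF p (-1) a s ≠ 0 := by
  intro h
  rw [heckeF_eq_zero_iff (by rintro rfl; norm_num at hs) hs1
    (by rintro rfl; norm_num at hs)] at h
  refine hs1 (eq_of_heckeXi_eq_zero hp (Or.inr rfl) ha hs (t := 1) (by norm_num) h ?_)
  rw [heckeXi_one_sub]
  simp

theorem exists_eq_ofReal_of_heckeF_one_eq_zero (hp : 1 < p) (ha : 1 ≤ a) (hs : 1 / 2 < s.re)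
    (hs1 : s ≠ 1) (h : heckeF p 1 a s = 0) : ∃ ρ : ℝ, ρ ∈ Set.Ioo (1 / 2 : ℝ) 1 ∧ s = ρ := by
  rw [heckeF_eq_zero_iff (by rintro rfl; norm_num at hs) hs1
    (by rintro rfl; norm_num at hs)] at h
  have hc : (starRingEnd ℂ) s = s := by
    refine eq_of_heckeXi_eq_zero hp (Or.inl rfl) ha (by simpa using hs) hs ?_ h
    rw [heckeXi_conj ha (Or.inl rfl) (by linarith), heckeXi_one_sub_conj ha (Or.inl rfl) hs]
    simpa using congrArg (starRingEnd ℂ) h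
  obtain ⟨ρ, rfl⟩ := conj_eq_iff_real.mp hc
  rw [ofReal_re] at hs
  refine ⟨ρ, ⟨hs, ?_⟩, rfl⟩
  by_contra! h1
  replace h1 : 1 < ρ := lt_of_le_of_ne h1 (fun h ↦ hs1 (by rw [← h, ofReal_one]))
  have hp0 : (0 : ℝ) < p := by exact_mod_cast (by lia : 0 < p)
  have ha0 : 0 < a := by linarith
  obtain ⟨r₁, hr₁, e₁⟩ := xiEntire_ofReal_pos (x := 2 * ρ) (by linarith)
  obtain ⟨r₂, hr₂, e₂⟩ := xiEntire_ofReal_pos (x := 2 * ρ - 1) (by linarith)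
  push_cast at e₁ e₂
  have f₁ := ofReal_cpow ha0.le ρ
  have f₂ := ofReal_cpow ha0.le (1 - ρ)
  have f₃ := ofReal_cpow hp0.le ρ
  have f₄ := ofReal_cpow hp0.le (1 - ρ)
  push_cast at f₁ f₂ f₃ f₄
  rw [heckeXi_one_sub, heckeXi, e₁, e₂, ← f₁, ← f₂, ← f₃, ← f₄] at h
  norm_cast at h
  have : 0 < (ρ - 1) * (a ^ ρ * ((p : ℝ) ^ ρ + 1) * r₁) := by
    have := sub_pos.mpr h1
    positivity
  have : 0 < ρ * (a ^ (1 - ρ) * ((p : ℝ) ^ (1 - ρ) + 1) * r₂) := by positivity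
  linarith

theorem log_le_of_heckeF_eq_zero (hp : 1 < p) (hε : ε = 1 ∨ ε = -1) (ha : 1 ≤ a) {ρ δ : ℝ}
    (hρ : ρ ∈ Set.Ioo (1 / 2 : ℝ) 1) (h : heckeF p ε a ρ = 0) (hδ : 0 < δ) (hρδ : ρ ≤ 1 - δ) :
    Real.log a ≤ 1 + 1 / (2 * δ) := by
  obtain ⟨h1, h2⟩ := hρ
  have ha0 : 0 < a := by linarith
  rw [heckeF_eq_zero_iff (by exact_mod_cast (by linarith : ρ ≠ 0))
    (by exact_mod_cast (by linarith : ρ ≠ 1))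
    (by
      intro h
      have := congrArg re h
      norm_num at this
      linarith)] at h
  have hlt := norm_heckeXi_one_sub_mul_lt (s := ρ) hp hε ha (by simpa using h1)
  rw [ofReal_re] at hlt
  have hn := congrArg norm (eq_neg_of_add_eq_zero_left h)
  rw [norm_neg, norm_mul, norm_mul, ← ofReal_one, ← ofReal_sub, norm_real, norm_real,
    Real.norm_of_nonneg (by linarith : 0 ≤ ρ), Real.norm_of_nonpos (by linarith), ofReal_one] at hn
  have hpos : 0 < ‖heckeXi p ε a ρ‖ :=
    norm_pos_iff.mpr (heckeXi_ne_zero hp hε ha (by simpa using h1))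
  have hv : a ^ (2 * ρ - 1) * (1 - ρ) ≤ ρ := by
    refine le_of_mul_le_mul_right ?_ hpos
    have hA := Real.rpow_pos_of_pos ha0 (2 * ρ - 1)
    nlinarith
  have hv' : Real.log a * (2 * ρ - 1) + Real.log (1 - ρ) ≤ Real.log ρ := by
    have hA := Real.rpow_pos_of_pos ha0 (2 * ρ - 1)
    have := Real.log_le_log (mul_pos hA (by linarith)) hv
    rw [Real.log_mul hA.ne' (by linarith), Real.log_rpow ha0] at this
    linarith
  have l1 := Real.log_le_sub_one_of_pos (x := 2 * ρ) (by linarith)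
  have l2 := Real.one_sub_inv_le_log_of_pos (x := 2 * (1 - ρ)) (by linarith)
  rw [Real.log_mul (by norm_num) (by linarith)] at l1 l2
  have l3 : (2 * (1 - ρ))⁻¹ - 1 ≤ (2 * ρ - 1) * (1 / (2 * δ)) := by
    have e : (2 * (1 - ρ))⁻¹ - 1 = (2 * ρ - 1) * (1 / (2 * (1 - ρ))) := by
      have : 1 - ρ ≠ 0 := by linarith
      field_simp
      ring
    rw [e]
    refine mul_le_mul_of_nonneg_left ?_ (by linarith)
    exact one_div_le_one_div_of_le (by linarith) (by linarith)
  refine le_of_mul_le_mul_right (a := 2 * ρ - 1) ?_ (by linarith)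
  linarith

end

/-- For every prime `p` and every `a ≥ 1`, the set of zeros of `F₊(a,·)·F₋(a,·)` off the
critical line (and away from `0, 1/2, 1`) is either empty or a pair `{ρ, 1-ρ}` of real
zeros with `ρ ∈ (1/2,1)`; moreover, such real zeros tend to `1` as `a → ∞`. -/
theorem heckeF_offline_zeros (p : ℕ) (hp : p.Prime) :
    (∀ a : ℝ, 1 ≤ a →
      {s : ℂ | s ∉ ({0, 1 / 2, 1} : Set ℂ) ∧ s.re ≠ 1 / 2 ∧
          heckeF p 1 a s * heckeF p (-1) a s = 0} = ∅ ∨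
      ∃ ρ : ℝ, ρ ∈ Set.Ioo (1 / 2 : ℝ) 1 ∧
        {s : ℂ | s ∉ ({0, 1 / 2, 1} : Set ℂ) ∧ s.re ≠ 1 / 2 ∧
          heckeF p 1 a s * heckeF p (-1) a s = 0} = {(ρ : ℂ), 1 - (ρ : ℂ)}) ∧
    (∀ ε : ℝ, 0 < ε → ∃ A : ℝ, 1 ≤ A ∧ ∀ a : ℝ, A < a →
      ∀ ρ : ℝ, ρ ∈ Set.Ioo (1 / 2 : ℝ) 1 →
        heckeF p 1 a ρ * heckeF p (-1) a ρ = 0 → 1 - ε < ρ) := by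
  have hp1 := hp.one_lt
  refine ⟨fun a ha ↦ ?_, fun ε hε ↦ ⟨Real.exp (1 + 1 / (2 * ε)), ?_, fun a ha ρ hρ h ↦ ?_⟩⟩
  · set S := {s : ℂ | s ∉ ({0, 1 / 2, 1} : Set ℂ) ∧ s.re ≠ 1 / 2 ∧
      heckeF p 1 a s * heckeF p (-1) a s = 0} with hS
    have hsymm : ∀ {s}, s ∈ S → 1 - s ∈ S := by
      rintro s ⟨hs, hre, h⟩
      simp only [Set.mem_insert_iff, Set.mem_singleton_iff, not_or] at hs
      refine ⟨?_, ?_, by rwa [heckeF_one_sub, heckeF_one_sub]⟩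
      · simp only [Set.mem_insert_iff, Set.mem_singleton_iff, not_or]
        exact ⟨fun h ↦ hs.2.2 (by linear_combination -h),
          fun h ↦ hs.2.1 (by linear_combination -h), fun h ↦ hs.1 (by linear_combination -h)⟩
      · intro h
        simp only [sub_re, one_re] at h
        exact hre (by linarith)
    have hright : ∀ {s}, s ∈ S → 1 / 2 < s.re → heckeF p 1 a s = 0 ∧ s ≠ 1 := by
      rintro s ⟨hs, -, h⟩ hre
      simp only [Set.mem_insert_iff, Set.mem_singleton_iff, not_or] at hs
      exact ⟨(mul_eq_zero.mp h).resolve_right (heckeF_neg_one_ne_zero hp1 ha hre hs.2.2), hs.2.2⟩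
    have hiff : ∀ {s : ℂ}, 1 / 2 < s.re → s ≠ 1 → heckeF p 1 a s = 0 →
        (s - 1) * heckeXi p 1 a s + s * heckeXi p 1 a (1 - s) = 0 := by
      intro s hs hs1 h
      exact (heckeF_eq_zero_iff (by rintro rfl; norm_num at hs) hs1
        (by rintro rfl; norm_num at hs)).mp h
    rcases S.eq_empty_or_nonempty with hempty | ⟨s₀, hs₀⟩
    · exact Or.inl hempty
    right
    obtain ⟨s, hs, hre⟩ : ∃ s ∈ S, 1 / 2 < s.re := by
      rcases lt_or_gt_of_ne hs₀.2.1 with hlt | hgt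
      · exact ⟨1 - s₀, hsymm hs₀, by simp only [sub_re, one_re]; linarith⟩
      · exact ⟨s₀, hs₀, hgt⟩
    obtain ⟨ρ, hρ, rfl⟩ :=
      exists_eq_ofReal_of_heckeF_one_eq_zero hp1 ha hre (hright hs hre).2 (hright hs hre).1
    have huniq : ∀ {t}, t ∈ S → 1 / 2 < t.re → t = ρ := fun ht htre ↦
      eq_of_heckeXi_eq_zero hp1 (Or.inl rfl) ha htre hre
        (hiff htre (hright ht htre).2 (hright ht htre).1)
        (hiff hre (hright hs hre).2 (hright hs hre).1)
    refine ⟨ρ, hρ, Set.Subset.antisymm (fun t ht ↦ ?_) ?_⟩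
    · rw [Set.mem_insert_iff, Set.mem_singleton_iff]
      rcases lt_or_gt_of_ne ht.2.1 with hlt | hgt
      · right
        rw [← huniq (hsymm ht) (by simp only [sub_re, one_re]; linarith), sub_sub_cancel]
      · exact Or.inl (huniq ht hgt)
    · rintro t (rfl | rfl)
      · exact hs
      · exact hsymm hs
  · exact Real.one_le_exp (by positivity)
  · by_contra! hle
    have ha1 : 1 ≤ a := (Real.one_le_exp (by positivity)).trans ha.le
    have hlog := (Real.lt_log_iff_exp_lt (by linarith)).mpr ha
    rcases mul_eq_zero.mp h with h | h
    · exact hlog.not_ge (log_le_of_heckeF_eq_zero hp1 (Or.inl rfl) ha1 hρ h hε hle)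
    · exact hlog.not_ge (log_le_of_heckeF_eq_zero hp1 (Or.inr rfl) ha1 hρ h hε hle)
end
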